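/- Let μ ∈ (0,1) and let c < c₁(μ), where c₁(μ) is the first critical value. Then either there exists a periodic collision orbit with energy c, or there exist infinitely many consecutive collision orbits with energy c, i.e. the set of pairs (τ, q) with τ > 0 and q : (0,τ) → 𝒦_c a consecutive collision orbit with energy c is infinite. -/

import Mathlib

open Set Filter

/-- Euclidean norm on `ℝ × ℝ`. -/
noncomputable def nrm (v : ℝ × ℝ) : ℝ := Real.sqrt (v.1 ^ 2 + v.2 ^ 2)

/-- Effective potential of the PCR3BP with mass ratio `μ`; the primary `O = (0,0)`
has mass `1 - μ` and the primary `E = (1,0)` has mass `μ`. -/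
noncomputable def V (μ : ℝ) (q : ℝ × ℝ) : ℝ :=
  -(((q.1 - μ) ^ 2 + q.2 ^ 2) / 2) - μ / nrm (q.1 - 1, q.2) - (1 - μ) / nrm q

/-- Critical points of the effective potential. -/
def critSet (μ : ℝ) : Set (ℝ × ℝ) :=
  {q | q ≠ (0, 0) ∧ q ≠ (1, 0) ∧ fderiv ℝ (V μ) q = 0}

/-- The first critical value `c₁(μ)`: the minimum of `V` over its critical points. -/
noncomputable def firstCriticalValue (μ : ℝ) : ℝ := sInf (V μ '' critSet μ)

/-- The Hill region at energy `c`. -/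
def Hill (μ c : ℝ) : Set (ℝ × ℝ) := {q | q ≠ (0, 0) ∧ q ≠ (1, 0) ∧ V μ q ≤ c}

/-- `𝒦_c`: the connected component of the Hill region whose closure contains `O = (0,0)`. -/
def KSet (μ c : ℝ) : Set (ℝ × ℝ) :=
  {q | q ∈ Hill μ c ∧ (0, 0) ∈ closure (connectedComponentIn (Hill μ c) q)}

/-- A consecutive collision orbit with energy `c`: a `C²` solution `q : (0,τ) → 𝒦_c` of
`q̈₁ - 2q̇₂ = -∂V/∂q₁`, `q̈₂ + 2q̇₁ = -∂V/∂q₂` with energy `c`, tending to `O` at both ends. -/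
def IsCCO (μ c : ℝ) (τ : ℝ) (q : ℝ → ℝ × ℝ) : Prop :=
  0 < τ ∧ ∃ q' q'' : ℝ → ℝ × ℝ,
    (∀ t ∈ Ioo (0 : ℝ) τ, HasDerivAt q (q' t) t) ∧
    (∀ t ∈ Ioo (0 : ℝ) τ, HasDerivAt q' (q'' t) t) ∧
    ContinuousOn q'' (Ioo (0 : ℝ) τ) ∧
    (∀ t ∈ Ioo (0 : ℝ) τ, q t ∈ KSet μ c) ∧
    (∀ t ∈ Ioo (0 : ℝ) τ,
      (q'' t).1 - 2 * (q' t).2 = -((fderiv ℝ (V μ) (q t)) (1, 0)) ∧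
      (q'' t).2 + 2 * (q' t).1 = -((fderiv ℝ (V μ) (q t)) (0, 1))) ∧
    (∀ t ∈ Ioo (0 : ℝ) τ, nrm (q' t) ^ 2 / 2 + V μ (q t) = c) ∧
    Tendsto q (nhdsWithin 0 (Ioi 0)) (nhds (0, 0)) ∧
    Tendsto q (nhdsWithin τ (Iio τ)) (nhds (0, 0))

/-- A periodic collision orbit with energy `c`: a continuous `T`-periodic map
`q : ℝ → 𝒦_c ∪ {O}` whose collision set `Z = q⁻¹({O})` is nonempty and discrete,
which is a `C²` solution with energy `c` on `ℝ \ Z`, and which has a well-defined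
collision direction `lim q(t)/‖q(t)‖` at each collision time. -/
def IsPCO (μ c : ℝ) (q : ℝ → ℝ × ℝ) : Prop :=
  Continuous q ∧
  (∃ T > (0 : ℝ), ∀ t, q (t + T) = q t) ∧
  (∀ t, q t ∈ KSet μ c ∪ {(0, 0)}) ∧
  (q ⁻¹' {(0, 0)}).Nonempty ∧
  (∀ t₀ ∈ q ⁻¹' {(0, 0)}, ∃ ε > (0 : ℝ),
    ∀ t ∈ q ⁻¹' {(0, 0)}, |t - t₀| < ε → t = t₀) ∧
  (∃ q' q'' : ℝ → ℝ × ℝ,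
    (∀ t, q t ≠ (0, 0) → HasDerivAt q (q' t) t ∧ HasDerivAt q' (q'' t) t) ∧
    ContinuousOn q'' {t | q t ≠ (0, 0)} ∧
    (∀ t, q t ≠ (0, 0) →
      (q'' t).1 - 2 * (q' t).2 = -((fderiv ℝ (V μ) (q t)) (1, 0)) ∧
      (q'' t).2 + 2 * (q' t).1 = -((fderiv ℝ (V μ) (q t)) (0, 1)) ∧
      nrm (q' t) ^ 2 / 2 + V μ (q t) = c)) ∧
  (∀ t₀, q t₀ = (0, 0) → ∃ v : ℝ × ℝ,
    Tendsto (fun t => (nrm (q t))⁻¹ • q t) (nhdsWithin t₀ {t₀}ᶜ) (nhds v))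

open Topology

section BorsukUlam

/-- The codimension one faces of an ordered simplex. -/
def listFaces {P : Type*} : List P → List (List P)
  | [] => []
  | a :: l => l :: (listFaces l).map (a :: ·)

/-- The prism between the images of an ordered simplex under two maps. -/
def listPrism {P : Type*} (f g : P → P) : List P → List (List P)
  | [] => []
  | a :: l => (f a :: g a :: l.map g) :: (listPrism f g l).map (f a :: ·)

/-- Evaluation of a mod `2` cochain on a chain. -/
def chainEval {P : Type*} (α : List P → ZMod 2) (c : List (List P)) : ZMod 2 := (c.map α).sum

/-- The mod `2` coboundary of a cochain. -/
def coboundary {P : Type*} (α : List P → ZMod 2) (l : List P) : ZMod 2 :=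
  chainEval α (listFaces l)

lemma chainEval_cons {P : Type*} (α : List P → ZMod 2) (l : List P) (c : List (List P)) :
    chainEval α (l :: c) = α l + chainEval α c := by simp [chainEval]

lemma chainEval_append {P : Type*} (α : List P → ZMod 2) (c d : List (List P)) :
    chainEval α (c ++ d) = chainEval α c + chainEval α d := by simp [chainEval]

lemma chainEval_map {P : Type*} (α : List P → ZMod 2) (h : List P → List P) (c : List (List P)) :
    chainEval α (c.map h) = chainEval (fun l => α (h l)) c := by
  simp [chainEval, Function.comp_def]

lemma chainEval_add {P : Type*} (α β : List P → ZMod 2) (c : List (List P)) :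
    chainEval (fun l => α l + β l) c = chainEval α c + chainEval β c := by
  induction c with
  | nil => simp [chainEval]
  | cons a c ih => simp only [chainEval_cons, ih]; ring

lemma chainEval_flatMap {P : Type*} (α : List P → ZMod 2) (h : List P → List (List P))
    (c : List (List P)) :
    chainEval α (c.flatMap h) = chainEval (fun l => chainEval α (h l)) c := by
  induction c with
  | nil => simp [chainEval]
  | cons a c ih => simp only [List.flatMap_cons, chainEval_append, chainEval_cons, ih]

lemma chainEval_congr {P : Type*} {α β : List P → ZMod 2} {c : List (List P)}
    (h : ∀ l ∈ c, α l = β l) : chainEval α c = chainEval β c := by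
  unfold chainEval
  rw [List.map_congr_left h]

lemma ZMod2_add_self (a : ZMod 2) : a + a = 0 := CharTwo.add_self_eq_zero a

lemma coboundary_cons {P : Type*} (α : List P → ZMod 2) (a : P) (l : List P) :
    coboundary α (a :: l) = α l + coboundary (fun m => α (a :: m)) l := by
  simp [coboundary, listFaces, chainEval_cons, chainEval_map]

lemma chainEval_prism_cons {P : Type*} (α : List P → ZMod 2) (f g : P → P) (a : P) (l : List P) :
    chainEval α (listPrism f g (a :: l)) =
      α (f a :: g a :: l.map g) + chainEval (fun m => α (f a :: m)) (listPrism f g l) := by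
  simp [listPrism, chainEval_cons, chainEval_map]

/-- The prism operator is a chain homotopy. -/
lemma prism_homotopy {P : Type*} (f g : P → P) (l : List P) : ∀ α : List P → ZMod 2,
    chainEval (coboundary α) (listPrism f g l) +
      coboundary (fun m => chainEval α (listPrism f g m)) l = α (l.map g) + α (l.map f) := by
  induction l with
  | nil => intro α; simp [listPrism, coboundary, chainEval, listFaces, ZMod2_add_self]
  | cons a l ih =>
    intro α
    have ih' := ih (fun m => α (f a :: m))
    have e1 : chainEval (coboundary α) (listPrism f g (a :: l)) =
        α (g a :: l.map g) + α (f a :: l.map g) +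
          coboundary (fun m => α (f a :: g a :: m)) (l.map g) +
        (chainEval α (listPrism f g l) +
          chainEval (coboundary fun m => α (f a :: m)) (listPrism f g l)) := by
      rw [chainEval_prism_cons, coboundary_cons, coboundary_cons, ← chainEval_add]
      simp only [coboundary_cons]
      ring
    have hmap : ∀ (β : List P → ZMod 2) (l : List P),
        coboundary β (l.map g) = coboundary (fun m => β (m.map g)) l := by
      intro β l
      induction l generalizing β with
      | nil => simp [coboundary, listFaces, chainEval]
      | cons b l ih => simp only [List.map_cons, coboundary_cons, ih]
    have e2 : coboundary (fun m => chainEval α (listPrism f g m)) (a :: l) =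
        chainEval α (listPrism f g l) +
        (coboundary (fun m => α (f a :: g a :: m)) (l.map g) +
          coboundary (fun m => chainEval (fun k => α (f a :: k)) (listPrism f g m)) l) := by
      rw [coboundary_cons, hmap]
      simp only [chainEval_prism_cons]
      unfold coboundary
      rw [chainEval_add]
    rw [e1, e2]
    simp only [List.map_cons]
    have h2 := ZMod2_add_self (chainEval α (listPrism f g l))
    have h3 := ZMod2_add_self (coboundary (fun m => α (f a :: g a :: m)) (l.map g))
    have h4 := ZMod2_add_self (α (f a :: l.map g))
    linear_combination ih' + h2 + h3 + h4

/-- Cup product `w_s ⋯ ε` of the coboundaries of the sign cochains `ε`, ending with a sign. -/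
def signCup {P : Type*} (ε : ℕ → P → ZMod 2) : ℕ → List P → ZMod 2
  | _, [] => 0
  | s, [x] => ε s x
  | s, x :: y :: l => (ε s x + ε s y) * signCup ε (s + 1) (y :: l)

/-- Cup product of the coboundaries of the sign cochains `ε`. -/
def changeCup {P : Type*} (ε : ℕ → P → ZMod 2) : ℕ → List P → ZMod 2
  | _, [] => 0
  | _, [_] => 1
  | s, x :: y :: l => (ε s x + ε s y) * changeCup ε (s + 1) (y :: l)

lemma coboundary_signCup {P : Type*} (ε : ℕ → P → ZMod 2) (l : List P) : ∀ (s : ℕ) (x y : P),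
    coboundary (signCup ε s) (x :: y :: l) = changeCup ε s (x :: y :: l) := by
  induction l with
  | nil =>
    intro s x y
    simp [coboundary, listFaces, chainEval, signCup, changeCup, add_comm]
  | cons z l ih =>
    intro s x y
    have h := ih (s + 1) y z
    rw [coboundary_cons] at h
    rw [coboundary_cons, coboundary_cons]
    have e : coboundary (fun m => signCup ε s (x :: y :: m)) (z :: l) =
        (ε s x + ε s y) * coboundary (fun m => signCup ε (s + 1) (y :: m)) (z :: l) := by
      simp only [coboundary, chainEval, signCup, List.sum_map_mul_left]
    rw [e]
    simp only [signCup] at h ⊢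
    rw [changeCup, ← h]
    have h2 := ZMod2_add_self (ε s z * signCup ε (s + 1) (z :: l))
    linear_combination h2

lemma signCup_add_antipode {P : Type*} (ε : ℕ → P → ZMod 2) (ν : P → P) (l : List P)
    (hl : l ≠ []) (h : ∀ x ∈ l, ∀ s, ε s (ν x) = ε s x + 1) (s : ℕ) :
    signCup ε s l + signCup ε s (l.map ν) = changeCup ε s l := by
  induction l generalizing s with
  | nil => exact absurd rfl hl
  | cons x l ih =>
    cases l with
    | nil =>
      have := h x (by simp) s
      simp only [signCup, changeCup, List.map_cons, List.map_nil, this]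
      linear_combination ZMod2_add_self (ε s x)
    | cons y l =>
      have ih' := ih (by simp) (fun z hz => h z (List.mem_cons_of_mem _ hz)) (s + 1)
      have hx := h x (by simp) s
      have hy := h y (by simp) s
      simp only [List.map_cons] at ih' ⊢
      simp only [signCup, changeCup, hx, hy]
      rw [← ih']
      have h2 := ZMod2_add_self (signCup ε (s + 1) (ν y :: List.map ν l))
      linear_combination h2

/-- If the cup product does not vanish on a simplex, every `ε i` changes along it. -/
lemma exists_change {P : Type*} (ε : ℕ → P → ZMod 2) (l : List P) (s : ℕ)
    (h : changeCup ε s l ≠ 0) (i : ℕ) (hi : s ≤ i) (hil : i + 1 < s + l.length) :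
    ∃ x ∈ l, ∃ y ∈ l, ε i x ≠ ε i y := by
  induction l generalizing s with
  | nil => simp [changeCup] at h
  | cons x l ih =>
    cases l with
    | nil => simp at hil; omega
    | cons y l =>
      simp only [changeCup] at h
      rcases hi.eq_or_lt with rfl | hlt
      · refine ⟨x, by simp, y, by simp, fun e => h ?_⟩
        rw [e, ZMod2_add_self, zero_mul]
      · obtain ⟨a, ha, b, hb, hab⟩ := ih (s + 1) (right_ne_zero_of_mul h) hlt
          (by simp at hil ⊢; omega)
        exact ⟨a, List.mem_cons_of_mem _ ha, b, List.mem_cons_of_mem _ hb, hab⟩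

lemma length_of_mem_prism {P : Type*} (f g : P → P) (l m : List P) (h : m ∈ listPrism f g l) :
    m.length = l.length + 1 := by
  induction l generalizing m with
  | nil => simp [listPrism] at h
  | cons a l ih =>
    simp only [listPrism, List.mem_cons, List.mem_map] at h
    rcases h with rfl | ⟨k, hk, rfl⟩
    · simp
    · simp [ih k hk]

lemma mem_of_mem_prism {P : Type*} (f g : P → P) (l m : List P) (h : m ∈ listPrism f g l)
    (x : P) (hx : x ∈ m) : ∃ y ∈ l, x = f y ∨ x = g y := by
  induction l generalizing m with
  | nil => simp [listPrism] at h
  | cons a l ih =>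
    simp only [listPrism, List.mem_cons, List.mem_map] at h
    rcases h with rfl | ⟨k, hk, rfl⟩
    · simp only [List.mem_cons, List.mem_map] at hx
      rcases hx with rfl | rfl | ⟨y, hy, rfl⟩
      · exact ⟨a, by simp, Or.inl rfl⟩
      · exact ⟨a, by simp, Or.inr rfl⟩
      · exact ⟨y, by simp [hy], Or.inr rfl⟩
    · rcases List.mem_cons.1 hx with rfl | hx
      · exact ⟨a, by simp, Or.inl rfl⟩
      · obtain ⟨y, hy, h⟩ := ih k hk hx
        exact ⟨y, by simp [hy], h⟩

end BorsukUlam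

section BorsukUlam

lemma coboundary_map {P : Type*} (g : P → P) (β : List P → ZMod 2) (l : List P) :
    coboundary β (l.map g) = coboundary (fun m => β (m.map g)) l := by
  induction l generalizing β with
  | nil => simp [coboundary, listFaces, chainEval]
  | cons b l ih => simp only [List.map_cons, coboundary_cons, ih]

/-- The symmetrisation of a chain under a map. -/
def symmChain {P : Type*} (ν : P → P) (c : List (List P)) : List (List P) :=
  c ++ c.map (List.map ν)

lemma chainEval_symmChain {P : Type*} (ν : P → P) (c : List (List P)) (α : List P → ZMod 2) :
    chainEval α (symmChain ν c) = chainEval α c + chainEval (fun l => α (l.map ν)) c := by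
  rw [symmChain, chainEval_append, chainEval_map]

/-- Sweeping a chain along a sequence of maps. -/
def sweep {P : Type*} (h : ℕ → P → P) (b : List (List P)) : ℕ → List (List P)
  | 0 => []
  | k + 1 => sweep h b k ++ b.flatMap (listPrism (h k) (h (k + 1)))

lemma chainEval_coboundary_sweep {P : Type*} (h : ℕ → P → P) (b : List (List P))
    (hb : ∀ β, chainEval (coboundary β) b = 0) (α : List P → ZMod 2) (M : ℕ) :
    chainEval (coboundary α) (sweep h b M) =
      chainEval (fun l => α (l.map (h M))) b + chainEval (fun l => α (l.map (h 0))) b := by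
  induction M with
  | zero => rw [ZMod2_add_self]; simp [sweep, chainEval]
  | succ k ih =>
    have h1 := hb (fun m => chainEval α (listPrism (h k) (h (k + 1)) m))
    have h2 : chainEval (fun l => chainEval (coboundary α) (listPrism (h k) (h (k + 1)) l) +
        coboundary (fun m => chainEval α (listPrism (h k) (h (k + 1)) m)) l) b =
        chainEval (fun l => α (l.map (h (k + 1))) + α (l.map (h k))) b :=
      chainEval_congr fun l _ => prism_homotopy _ _ l α
    rw [chainEval_add, chainEval_add] at h2
    rw [sweep, chainEval_append, chainEval_flatMap, ih]
    have h3 := ZMod2_add_self (chainEval (fun l => α (l.map (h k))) b)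
    linear_combination h2 - h1 + h3

lemma mem_sweep {P : Type*} (h : ℕ → P → P) (b : List (List P)) (M : ℕ) (m : List P)
    (hm : m ∈ sweep h b M) : ∃ k < M, ∃ l ∈ b, m ∈ listPrism (h k) (h (k + 1)) l := by
  induction M with
  | zero => simp [sweep] at hm
  | succ k ih =>
    rw [sweep, List.mem_append, List.mem_flatMap] at hm
    rcases hm with hm | ⟨l, hl, hm⟩
    · obtain ⟨i, hi, l, hl, h⟩ := ih hm
      exact ⟨i, by omega, l, hl, h⟩
    · exact ⟨k, by omega, l, hl, hm⟩

/-- The coordinate vectors of `Fin (n + 1) → ℝ`. -/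
def coordVec (n j : ℕ) : Fin (n + 1) → ℝ := fun i => if (i : ℕ) = j then 1 else 0

/-- Linear contraction to a coordinate vector. -/
noncomputable def contractTo (n j M k : ℕ) (x : Fin (n + 1) → ℝ) : Fin (n + 1) → ℝ :=
  (1 - (k : ℝ) / M) • x + ((k : ℝ) / M) • coordVec n j

/-- Iterated half-spheres in the boundary of the cross-polytope. -/
noncomputable def halfSphere (n M : ℕ) : ℕ → List (List (Fin (n + 1) → ℝ))
  | 0 => [[coordVec n 0]]
  | j + 1 => sweep (contractTo n (j + 1) M) (symmChain Neg.neg (halfSphere n M j)) M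

lemma halfSphere_spec (n M : ℕ) (hM : 0 < M) (j : ℕ) (hj : j ≤ n) :
    ∀ l ∈ halfSphere n M j, l.length = j + 1 ∧
      (∀ x ∈ l, ∑ i, |x i| = 1 ∧ ∀ i : Fin (n + 1), j < i → x i = 0) ∧
      (∀ x ∈ l, ∀ y ∈ l, dist x y ≤ 2 * j / M) := by
  have hM' : (0 : ℝ) < M := by exact_mod_cast hM
  induction j with
  | zero =>
    intro l hl
    simp only [halfSphere, List.mem_singleton] at hl
    subst hl
    refine ⟨rfl, ?_, ?_⟩
    · intro x hx
      rw [List.mem_singleton] at hx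
      subst hx
      refine ⟨?_, ?_⟩
      · rw [Finset.sum_eq_single 0]
        · simp [coordVec]
        · intro i _ hi
          have : (i : ℕ) ≠ 0 := fun h => hi (Fin.ext h)
          simp [coordVec, this]
        · simp
      · intro i hi
        simp [coordVec]
        rintro rfl
        exact lt_irrefl _ hi
    · intro x hx y hy
      rw [List.mem_singleton] at hx hy
      subst hx hy
      simp
  | succ j ih =>
    have ih := ih (by omega)
    intro m hm
    obtain ⟨k, hk, l, hl, hm⟩ := mem_sweep _ _ _ _ hm
    have hl' : l.length = j + 1 ∧
      (∀ x ∈ l, ∑ i, |x i| = 1 ∧ ∀ i : Fin (n + 1), j < i → x i = 0) ∧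
      (∀ x ∈ l, ∀ y ∈ l, dist x y ≤ 2 * j / M) := by
      rw [symmChain, List.mem_append, List.mem_map] at hl
      rcases hl with hl | ⟨a, ha, rfl⟩
      · exact ih l hl
      · obtain ⟨h1, h2, h3⟩ := ih a ha
        refine ⟨by simpa using h1, ?_, ?_⟩
        · intro x hx
          obtain ⟨y, hy, rfl⟩ := List.mem_map.1 hx
          refine ⟨by simpa using (h2 y hy).1, fun i hi => by simpa using (h2 y hy).2 i hi⟩
        · intro x hx y hy
          obtain ⟨x', hx', rfl⟩ := List.mem_map.1 hx
          obtain ⟨y', hy', rfl⟩ := List.mem_map.1 hy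
          rw [dist_neg_neg]
          exact h3 x' hx' y' hy'
    obtain ⟨h1, h2, h3⟩ := hl'
    have key : ∀ x ∈ m, ∃ y ∈ l, ∃ s : ℝ, (k : ℝ) / M ≤ s ∧ s ≤ k / M + 1 / M ∧ 0 ≤ s ∧ s ≤ 1 ∧
        x = (1 - s) • y + s • coordVec n (j + 1) := by
      intro x hx
      obtain ⟨y, hy, h⟩ := mem_of_mem_prism _ _ _ _ hm x hx
      have hkM : (k : ℝ) + 1 ≤ M := by exact_mod_cast hk
      have h0 : (0 : ℝ) ≤ 1 / M := by positivity
      rcases h with h | h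
      · refine ⟨y, hy, k / M, le_rfl, by linarith, by positivity, ?_, h⟩
        rw [div_le_one hM']; linarith
      · refine ⟨y, hy, (k + 1 : ℕ) / M, ?_, ?_, by positivity, ?_, h⟩
        · push_cast; rw [add_div]; linarith
        · push_cast; rw [add_div]
        · rw [div_le_one hM']; push_cast; linarith
    have hj' : j + 1 < n + 1 := by omega
    refine ⟨by rw [length_of_mem_prism _ _ _ _ hm, h1], ?_, ?_⟩
    · intro x hx
      obtain ⟨y, hy, s, -, -, hs0, hs1, rfl⟩ := key x hx
      obtain ⟨hy1, hy2⟩ := h2 y hy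
      refine ⟨?_, ?_⟩
      · have e : ∀ i : Fin (n + 1), |((1 - s) • y + s • coordVec n (j + 1)) i| =
            (1 - s) * |y i| + s * (if i = ⟨j + 1, hj'⟩ then 1 else 0) := by
          intro i
          simp only [Pi.add_apply, Pi.smul_apply, smul_eq_mul, coordVec]
          by_cases hi : i = ⟨j + 1, hj'⟩
          · have : y i = 0 := hy2 i (by rw [hi]; simp)
            rw [this, hi]; simp [abs_of_nonneg hs0]
          · have : (i : ℕ) ≠ j + 1 := fun h => hi (Fin.ext h)
            simp [hi, this, abs_mul, abs_of_nonneg (sub_nonneg.2 hs1)]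
        rw [Finset.sum_congr rfl fun i _ => e i, Finset.sum_add_distrib, ← Finset.mul_sum,
          ← Finset.mul_sum, hy1]
        simp
      · intro i hi
        have h5 : (i : ℕ) ≠ j + 1 := by omega
        simp [coordVec, h5, hy2 i (by omega)]
    · intro x hx x' hx'
      obtain ⟨y, hy, s, hs2, hs3, hs0, hs1, rfl⟩ := key x hx
      obtain ⟨y', hy', s', hs2', hs3', hs0', hs1', rfl⟩ := key x' hx'
      have hd := h3 y hy y' hy'
      rw [dist_pi_le_iff (by positivity)] at hd ⊢
      intro i
      have hd := hd i
      have hb : ∀ z ∈ l, |z i| ≤ 1 := by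
        intro z hz
        rw [← (h2 z hz).1]
        exact Finset.single_le_sum (f := fun i => |z i|) (fun _ _ => abs_nonneg _)
          (Finset.mem_univ i)
      have he : |coordVec n (j + 1) i| ≤ 1 := by
        unfold coordVec; split_ifs <;> simp
      rw [Real.dist_eq] at hd ⊢
      have e : ((1 - s) • y + s • coordVec n (j + 1)) i -
          ((1 - s') • y' + s' • coordVec n (j + 1)) i =
          (1 - s) * (y i - y' i) + (s' - s) * y' i + (s - s') * coordVec n (j + 1) i := by
        simp; ring
      rw [e]
      have hss : |s - s'| ≤ 1 / M := by rw [abs_le]; constructor <;> linarith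
      calc _ ≤ |(1 - s) * (y i - y' i)| + |(s' - s) * y' i| +
            |(s - s') * coordVec n (j + 1) i| := abs_add_three _ _ _
        _ ≤ 1 * (2 * j / M) + 1 / M * 1 + 1 / M * 1 := by
          rw [abs_mul, abs_mul, abs_mul, abs_sub_comm s' s]
          gcongr
          · rw [abs_le]; constructor <;> linarith
          · exact hb y' hy'
        _ = _ := by push_cast; ring

lemma chainEval_halfSphere (n M : ℕ) (hM : 0 < M) (j : ℕ) (hj : j ≤ n) :
    (∀ β, chainEval (coboundary β) (symmChain Neg.neg (halfSphere n M j)) = 0) ∧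
    (j + 1 ≤ n → ∀ α, chainEval (coboundary α) (halfSphere n M (j + 1)) =
      chainEval α (symmChain Neg.neg (halfSphere n M j))) := by
  have hM' : (M : ℝ) ≠ 0 := by exact_mod_cast hM.ne'
  have step : ∀ j ≤ n, (∀ β, chainEval (coboundary β) (symmChain Neg.neg (halfSphere n M j)) = 0) →
      ∀ α, chainEval (coboundary α) (halfSphere n M (j + 1)) =
      chainEval α (symmChain Neg.neg (halfSphere n M j)) := by
    intro j hj hb α
    rw [halfSphere, chainEval_coboundary_sweep _ _ hb]
    have e0 : chainEval (fun l => α (l.map (contractTo n (j + 1) M M)))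
        (symmChain Neg.neg (halfSphere n M j)) = 0 := by
      have : ∀ l ∈ symmChain Neg.neg (halfSphere n M j),
          α (l.map (contractTo n (j + 1) M M)) =
          α (List.replicate (j + 1) (coordVec n (j + 1))) := by
        intro l hl
        have hlen : l.length = j + 1 := by
          rw [symmChain, List.mem_append, List.mem_map] at hl
          rcases hl with hl | ⟨a, ha, rfl⟩
          · exact (halfSphere_spec n M hM j hj l hl).1
          · simpa using (halfSphere_spec n M hM j hj a ha).1
        have hc : contractTo n (j + 1) M M = fun _ => coordVec n (j + 1) := by
          funext x
          simp [contractTo, div_self hM']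
        rw [hc, List.map_const', hlen]
      rw [chainEval_congr (β := fun _ => α (List.replicate (j + 1) (coordVec n (j + 1)))) this,
        chainEval_symmChain]
      exact ZMod2_add_self _
    have e1 : contractTo n (j + 1) M 0 = id := by
      funext x; simp [contractTo]
    rw [e0, e1]
    simp
  have main : ∀ j ≤ n, ∀ β, chainEval (coboundary β) (symmChain Neg.neg (halfSphere n M j)) = 0 := by
    intro j hj
    induction j with
    | zero =>
      intro β
      simp [halfSphere, symmChain, chainEval, coboundary, listFaces, ZMod2_add_self]
    | succ j ih =>
      intro β
      have h := step j (by omega) (ih (by omega))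
      rw [chainEval_symmChain]
      have e : (fun l => coboundary β (l.map Neg.neg)) =
          coboundary (fun l : List (Fin (n + 1) → ℝ) => β (l.map Neg.neg)) := by
        funext l; exact coboundary_map _ _ _
      rw [e, h, h, chainEval_symmChain, chainEval_symmChain]
      have e2 : ∀ l : List (Fin (n + 1) → ℝ), (l.map Neg.neg).map Neg.neg = l := by
        intro l; simp
      simp only [e2]
      have h1 := ZMod2_add_self (chainEval β (halfSphere n M j))
      have h2 := ZMod2_add_self (chainEval (fun l => β (l.map Neg.neg)) (halfSphere n M j))
      linear_combination h1 + h2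
  exact ⟨main j hj, fun _ => step j hj (main j hj)⟩

/-- A combinatorial form of the Borsuk-Ulam theorem. -/
lemma exists_change_halfSphere (n M : ℕ) (hM : 0 < M) (ε : ℕ → (Fin (n + 1) → ℝ) → ZMod 2)
    (hε : ∀ s x, x ≠ 0 → ε s (-x) = ε s x + 1) :
    ∃ l : List (Fin (n + 1) → ℝ), (∀ x ∈ l, ∑ i, |x i| = 1) ∧
      (∀ x ∈ l, ∀ y ∈ l, dist x y ≤ 2 * n / M) ∧
      ∀ i < n, ∃ x ∈ l, ∃ y ∈ l, ε i x ≠ ε i y := by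
  have hne : ∀ x : Fin (n + 1) → ℝ, ∑ i, |x i| = 1 → x ≠ 0 := by
    rintro x hx rfl; simp at hx
  have key : ∀ j ≤ n, chainEval (changeCup ε 0) (halfSphere n M j) = 1 := by
    intro j hj
    induction j with
    | zero => simp [halfSphere, chainEval, changeCup]
    | succ j ih =>
      have ih := ih (by omega)
      have h1 := (chainEval_halfSphere n M hM j (by omega)).2 hj (signCup ε 0)
      rw [chainEval_symmChain, ← chainEval_add] at h1
      rw [← ih]
      have e1 : chainEval (changeCup ε 0) (halfSphere n M (j + 1)) =
          chainEval (coboundary (signCup ε 0)) (halfSphere n M (j + 1)) := by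
        refine chainEval_congr fun l hl => ?_
        have hlen := (halfSphere_spec n M hM (j + 1) hj l hl).1
        match l, hlen with
        | x :: y :: l, _ => exact (coboundary_signCup ε l 0 x y).symm
      rw [e1, h1]
      refine chainEval_congr fun l hl => ?_
      obtain ⟨hlen, hl2, -⟩ := halfSphere_spec n M hM j (by omega) l hl
      refine signCup_add_antipode ε _ l ?_ ?_ 0
      · rintro rfl; simp at hlen
      · intro x hx s
        exact hε s x (hne x (hl2 x hx).1)
  have h1 := key n le_rfl
  have : ∃ l ∈ halfSphere n M n, changeCup ε 0 l ≠ 0 := by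
    by_contra! hcon
    have : chainEval (changeCup ε 0) (halfSphere n M n) = 0 := by
      rw [chainEval_congr (β := fun _ => 0) hcon]
      simp [chainEval]
    rw [this] at h1
    exact zero_ne_one h1
  obtain ⟨l, hl, hc⟩ := this
  obtain ⟨hlen, hl2, hl3⟩ := halfSphere_spec n M hM n le_rfl l hl
  exact ⟨l, fun x hx => (hl2 x hx).1, hl3, fun i hi =>
    exists_change ε l 0 hc i (Nat.zero_le _) (by omega)⟩

open Classical in
/-- **Borsuk-Ulam theorem** for odd maps on a punctured coordinate space. -/
theorem borsukUlam_pi (n : ℕ) (g : (Fin (n + 1) → ℝ) → (Fin n → ℝ))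
    (hg : ContinuousOn g {0}ᶜ) (hodd : ∀ x ≠ 0, g (-x) = -g x) : ∃ x ≠ 0, g x = 0 := by
  by_contra! hcon
  set S : Set (Fin (n + 1) → ℝ) := {x | ∑ i, |x i| = 1} with hS
  have hne : ∀ x ∈ S, x ≠ 0 := by
    rintro x hx rfl; simp [hS] at hx
  have hSc : IsCompact S := by
    refine Metric.isCompact_of_isClosed_isBounded ?_ ?_
    · exact isClosed_eq (by fun_prop) continuous_const
    · refine (Metric.isBounded_iff_subset_closedBall 0).2 ⟨1, fun x hx => ?_⟩
      rw [mem_closedBall_zero_iff, pi_norm_le_iff_of_nonneg zero_le_one]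
      intro i
      rw [← (show ∑ i, |x i| = 1 from hx)]
      exact Finset.single_le_sum (f := fun i => |x i|) (fun _ _ => abs_nonneg _)
        (Finset.mem_univ i)
  have hgS : ContinuousOn g S := hg.mono fun x hx => hne x hx
  have hmin : ∃ δ > 0, ∀ x ∈ S, δ ≤ ‖g x‖ := by
    rcases S.eq_empty_or_nonempty with h | h
    · exact ⟨1, one_pos, by simp [h]⟩
    · obtain ⟨x, hx, hmin⟩ := hSc.exists_isMinOn h hgS.norm
      exact ⟨‖g x‖, norm_pos_iff.2 (hcon x (hne x hx)), fun y hy => hmin hy⟩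
  obtain ⟨δ, hδ, hmin⟩ := hmin
  have huc := hSc.uniformContinuousOn_of_continuous hgS
  rw [Metric.uniformContinuousOn_iff] at huc
  obtain ⟨η, hη, huc⟩ := huc δ hδ
  obtain ⟨M, hM⟩ := exists_nat_gt (2 * n / η)
  have hM0 : 0 < M := by
    have : (0 : ℝ) ≤ 2 * n / η := by positivity
    exact_mod_cast this.trans_lt hM
  have hM0' : (0 : ℝ) < M := by exact_mod_cast hM0
  have hMη : 2 * n / M < η := by
    rw [div_lt_iff₀ hη] at hM
    rw [div_lt_iff₀ hM0']
    linarith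
  let tie : (Fin (n + 1) → ℝ) → Prop := fun x => WellOrderingRel x (-x)
  have htie : ∀ x : Fin (n + 1) → ℝ, x ≠ 0 → (tie (-x) ↔ ¬ tie x) := by
    intro x hx
    have hxn : x ≠ -x := by
      intro h
      exact hx (self_eq_neg.1 h)
    simp only [tie, neg_neg]
    constructor
    · intro h h'
      exact asymm_of WellOrderingRel h h'
    · intro h
      rcases trichotomous_of WellOrderingRel x (-x) with h' | h' | h'
      · exact absurd h' h
      · exact absurd h' hxn
      · exact h'
  let G : ℕ → (Fin (n + 1) → ℝ) → ℝ := fun i x => if h : i < n then g x ⟨i, h⟩ else 0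
  have hG : ∀ i x, x ≠ 0 → G i (-x) = -G i x := by
    intro i x hx
    by_cases h : i < n <;> simp [G, h, hodd x hx]
  obtain ⟨l, hl1, hl2, hl3⟩ := exists_change_halfSphere n M hM0
    (fun i x => if 0 < G i x ∨ (G i x = 0 ∧ tie x) then 1 else 0) (by
      intro s x hx
      have h1 := htie x hx
      rw [hG s x hx]
      have h11 : (1 : ZMod 2) + 1 = 0 := by decide
      rcases lt_trichotomy (G s x) 0 with h | h | h
      · have a1 : ¬ 0 < G s x := by linarith
        have a2 : ¬ G s x = 0 := by linarith
        simp [h, a1, a2]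
      · by_cases ht : tie x
        · simp [h, h1, ht, h11]
        · simp [h, h1, ht]
      · have a1 : ¬ G s x < 0 := by linarith
        have a2 : ¬ G s x = 0 := by linarith
        simp [h, a1, a2, h11])
  rcases Nat.eq_zero_or_pos n with hn | hn
  · subst hn
    exact hcon (fun _ => 1) (fun h => one_ne_zero (congrFun h 0)) (Subsingleton.elim _ _)
  obtain ⟨x₀, hx₀, -⟩ := hl3 0 hn
  have hlt : ∀ i : Fin n, |g x₀ i| < δ := by
    intro i
    have hd : ∀ y ∈ l, |g x₀ i - g y i| < δ := by
      intro y hy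
      have := huc x₀ (hl1 x₀ hx₀) y (hl1 y hy) ((hl2 x₀ hx₀ y hy).trans_lt hMη)
      exact (dist_le_pi_dist (g x₀) (g y) i).trans_lt this
    obtain ⟨x, hx, y, hy, hxy⟩ := hl3 i i.2
    have h1 := hd x hx
    have h2 := hd y hy
    have e : ∀ z, G i z = g z i := fun z => by simp [G]
    simp only [e] at hxy
    rw [abs_lt] at h1 h2 ⊢
    by_cases hxp : 0 < g x i
    · have hyp : g y i ≤ 0 := by
        by_contra! h
        simp [hxp, h] at hxy
      constructor <;> linarith
    · by_cases hyp : 0 < g y i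
      · constructor <;> linarith
      · by_cases hx0 : g x i = 0
        · constructor <;> linarith
        · by_cases hy0 : g y i = 0
          · constructor <;> linarith
          · simp [hxp, hyp, hx0, hy0] at hxy
  have := hmin x₀ (hl1 x₀ hx₀)
  have h2 : ‖g x₀‖ < δ := by
    rw [pi_norm_lt_iff hδ]
    intro i
    exact hlt i
  linarith

/-- **Borsuk-Ulam theorem** for odd maps between finite-dimensional spaces. -/
theorem borsukUlam {X Y : Type*} [NormedAddCommGroup X] [NormedSpace ℝ X] [FiniteDimensional ℝ X]
    [NormedAddCommGroup Y] [NormedSpace ℝ Y] [FiniteDimensional ℝ Y]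
    (hdim : Module.finrank ℝ Y < Module.finrank ℝ X) (g : X → Y)
    (hg : ContinuousOn g {0}ᶜ) (hodd : ∀ x ≠ 0, g (-x) = -g x) : ∃ x ≠ 0, g x = 0 := by
  set n := Module.finrank ℝ Y with hn
  let eY : Y ≃L[ℝ] (Fin n → ℝ) := ContinuousLinearEquiv.ofFinrankEq (by simp [hn])
  obtain ⟨φ, hφ⟩ : ∃ φ : (Fin (n + 1) → ℝ) →ₗ[ℝ] X, Function.Injective φ := by
    rw [← finrank_le_iff_exists_linearMap]
    simpa using hdim
  have hφc : Continuous φ := φ.continuous_of_finiteDimensional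
  have hφ0 : ∀ x ≠ 0, φ x ≠ 0 := fun x hx h => hx (hφ (by simpa using h))
  obtain ⟨x, hx, h⟩ := borsukUlam_pi n (fun x => eY (g (φ x)))
    (eY.continuous.comp_continuousOn (hg.comp hφc.continuousOn fun x hx => hφ0 x hx)) (by
      intro x hx
      simp [hodd _ (hφ0 x hx)])
  exact ⟨φ x, hφ0 x hx, by simpa using h⟩

end BorsukUlam

section Deformation

variable {E : Type*} [NormedAddCommGroup E] [NormedSpace ℝ E] [FiniteDimensional ℝ E]

/-- A function with no critical point on a compact set decreases uniformly on it
under a continuous odd map. -/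
lemma exists_uniform_descent (F : E → ℝ) (hF : ContDiff ℝ 1 F)
    (heven : ∀ x, F (-x) = F x) (S : Set E) (hS : IsCompact S) (hne : ∀ x ∈ S, fderiv ℝ F x ≠ 0) :
    ∃ D : E → E, Continuous D ∧ (∀ x, D (-x) = -D x) ∧ ∃ η > 0, ∀ x ∈ S, F (D x) ≤ F x - η := by
  set b := Module.finBasis ℝ E
  set G : E → E := fun u => ∑ i, fderiv ℝ F u (b i) • b i with hG
  have hdF : Continuous (fderiv ℝ F) := hF.continuous_fderiv one_ne_zero
  have hGc : Continuous G := by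
    refine continuous_finsetSum _ fun i _ => ?_
    exact (hdF.clm_apply continuous_const).smul continuous_const
  have hGodd : ∀ x, G (-x) = -G x := by
    intro x
    have : fderiv ℝ F (-x) = -fderiv ℝ F x := by
      have h1 := (hF.differentiable one_ne_zero (-x)).hasFDerivAt.comp x (hasFDerivAt_id x).neg
      have e : F ∘ Neg.neg = F := funext heven
      rw [e] at h1
      rw [h1.fderiv]
      ext v
      simp
    simp [hG, this]
  have hGpos : ∀ x ∈ S, 0 < fderiv ℝ F x (G x) := by
    intro x hx
    have e : fderiv ℝ F x (G x) = ∑ i, (fderiv ℝ F x (b i)) ^ 2 := by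
      simp [hG, map_sum, sq]
    rw [e]
    refine lt_of_le_of_ne (Finset.sum_nonneg fun i _ => sq_nonneg _) fun h => hne x hx ?_
    have h2 := (Finset.sum_eq_zero_iff_of_nonneg (fun i _ => sq_nonneg _)).1 h.symm
    have : (fderiv ℝ F x : E →ₗ[ℝ] ℝ) = 0 := b.ext fun i => by
      simpa using h2 i (Finset.mem_univ i)
    ext v
    exact LinearMap.congr_fun this v
  rcases S.eq_empty_or_nonempty with hSe | hSn
  · exact ⟨fun x => x, continuous_id, fun x => rfl, 1, one_pos, by simp [hSe]⟩
  obtain ⟨x₀, hx₀, hmin⟩ := hS.exists_isMinOn hSn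
    (f := fun x => fderiv ℝ F x (G x)) (hdF.clm_apply hGc).continuousOn
  set δ := fderiv ℝ F x₀ (G x₀) / 2 with hδ
  have hδ0 : 0 < δ := half_pos (hGpos x₀ hx₀)
  have hopen : IsOpen {p : ℝ × E | δ < fderiv ℝ F (p.2 - p.1 • G p.2) (G p.2)} := by
    refine isOpen_lt continuous_const ?_
    exact (hdF.comp (by fun_prop)).clm_apply (by fun_prop)
  have hsub : ({0} : Set ℝ) ×ˢ S ⊆ {p : ℝ × E | δ < fderiv ℝ F (p.2 - p.1 • G p.2) (G p.2)} := by
    rintro ⟨t, x⟩ ⟨ht, hx⟩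
    obtain rfl : t = 0 := ht
    have h1 : fderiv ℝ F x₀ (G x₀) ≤ fderiv ℝ F x (G x) := hmin hx
    have h2 := hGpos x₀ hx₀
    simp only [mem_ofPred_eq, zero_smul, sub_zero]
    linarith
  obtain ⟨U, W, hU, hW, h0U, hSW, hUW⟩ :=
    generalized_tube_lemma isCompact_singleton hS hopen hsub
  obtain ⟨r, hr, hrU⟩ := Metric.isOpen_iff.1 hU 0 (h0U rfl)
  set h := r / 2 with hh
  have hh0 : 0 < h := half_pos hr
  refine ⟨fun x => x - h • G x, by fun_prop, fun x => by simp only [hGodd]; module, h * δ,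
    mul_pos hh0 hδ0, fun x hx => ?_⟩
  have hderiv : ∀ t : ℝ, HasDerivAt (fun t : ℝ => F (x - t • G x))
      (-(fderiv ℝ F (x - t • G x) (G x))) t := by
    intro t
    have h1 : HasDerivAt (fun t : ℝ => x - t • G x) (-G x) t := by
      simpa using ((hasDerivAt_id t).smul_const (G x)).const_sub x
    have h2 := (hF.differentiable one_ne_zero (x - t • G x)).hasFDerivAt.comp_hasDerivAt t h1
    rw [map_neg] at h2
    exact h2
  obtain ⟨t, ht, hmv⟩ := exists_hasDerivAt_eq_slope (fun t : ℝ => F (x - t • G x))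
    (fun t => -(fderiv ℝ F (x - t • G x) (G x))) hh0
    (fun t _ => (hderiv t).continuousAt.continuousWithinAt) (fun t _ => hderiv t)
  have hlt : δ < fderiv ℝ F (x - t • G x) (G x) := by
    have : ((t, x) : ℝ × E) ∈ U ×ˢ W := by
      refine ⟨hrU ?_, hSW hx⟩
      rw [Metric.mem_ball, dist_zero_right, Real.norm_eq_abs, abs_of_pos ht.1]
      have := ht.2
      linarith
    exact hUW this
  simp only [zero_smul, sub_zero] at hmv
  rw [eq_div_iff hh0.ne'] at hmv
  have : h * δ < h * fderiv ℝ F (x - t • G x) (G x) := mul_lt_mul_of_pos_left hlt hh0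
  simp only
  linarith

/-- If a family of even quadratically homogeneous functions `A - T * B` has no critical points
outside the origin for `T` in an interval, then its index cannot increase along the interval. -/
theorem finrank_le_of_no_critical_point {X Y : Type*} [NormedAddCommGroup X] [NormedSpace ℝ X]
    [FiniteDimensional ℝ X] [NormedAddCommGroup Y] [NormedSpace ℝ Y] [FiniteDimensional ℝ Y]
    (A B : E → ℝ) (hA : ContDiff ℝ 1 A) (hB : ContDiff ℝ 1 B)
    (hA2 : ∀ (r : ℝ) x, A (r • x) = r ^ 2 * A x) (hB2 : ∀ (r : ℝ) x, B (r • x) = r ^ 2 * B x)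
    {T₀ T₁ : ℝ} (hT : T₀ ≤ T₁)
    (hne : ∀ T ∈ Icc T₀ T₁, ∀ x ≠ 0, fderiv ℝ A x ≠ T • fderiv ℝ B x)
    (i : X →ₗ[ℝ] E) (hi : ∀ x ≠ 0, A (i x) < T₁ * B (i x))
    (p : E →ₗ[ℝ] Y) (hp : ∀ y, p y = 0 → T₀ * B y ≤ A y) :
    Module.finrank ℝ X ≤ Module.finrank ℝ Y := by
  by_contra! hdim
  set P : ℝ → Prop := fun T => ∃ g : X → E, ContinuousOn g {0}ᶜ ∧ (∀ x ≠ 0, g (-x) = -g x) ∧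
    ∀ x ≠ 0, A (g x) < T * B (g x) with hP
  have hP1 : P T₁ := ⟨i, i.continuous_of_finiteDimensional.continuousOn, fun x _ => by simp, hi⟩
  have hA0 : A 0 = 0 := by simpa using hA2 0 0
  have hB0 : B 0 = 0 := by simpa using hB2 0 0
  have hloc : ∀ T ∈ Icc T₀ T₁, ∃ ε > 0, ∀ t s, |t - T| < ε → |s - T| < ε → P t → P s := by
    intro T hTm
    set S : Set E := Metric.sphere 0 1 with hS
    have hSc : IsCompact S := isCompact_sphere 0 1
    obtain ⟨D, hDc, hDodd, η, hη, hD⟩ := exists_uniform_descent (fun x => A x - T * B x)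
      (by fun_prop) (fun x => by
        have h1 := hA2 (-1) x
        have h2 := hB2 (-1) x
        simp only [neg_smul, one_smul] at h1 h2
        rw [h1, h2]; ring) S hSc (by
        intro x hx h
        have hx0 : x ≠ 0 := by
          rintro rfl; simp [hS] at hx
        refine hne T hTm x hx0 ?_
        rw [fderiv_fun_sub (hA.differentiable one_ne_zero x)
          ((hB.differentiable one_ne_zero x).const_mul T),
          fderiv_const_mul (hB.differentiable one_ne_zero x)] at h
        exact sub_eq_zero.1 h)
    obtain ⟨C, hC⟩ := (hSc.union (hSc.image hDc)).exists_bound_of_continuousOn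
      (f := B) hB.continuous.continuousOn
    set ε := η / (2 * (|C| + 1)) with hε
    have hC0 : 0 < |C| + 1 := by positivity
    have hε0 : 0 < ε := by positivity
    have hεC : ε * (|C| + 1) = η / 2 := by rw [hε]; field_simp
    have hest : ∀ t, |t - T| < ε → ∀ x ∈ S ∪ D '' S, |(t - T) * B x| ≤ η / 2 := by
      intro t ht x hx
      rw [abs_mul, ← hεC]
      have h1 := hC x hx
      rw [Real.norm_eq_abs] at h1
      have h2 := le_abs_self C
      exact mul_le_mul ht.le (by linarith) (abs_nonneg _) hε0.le
    refine ⟨ε, hε0, fun t s ht hs ⟨g, hgc, hgo, hgn⟩ => ?_⟩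
    have hg0 : ∀ x ≠ 0, g x ≠ 0 := by
      intro x hx h
      have := hgn x hx
      rw [h, hA0, hB0] at this
      simp at this
    refine ⟨fun x => D (‖g x‖⁻¹ • g x), ?_, ?_, ?_⟩
    · refine hDc.comp_continuousOn ?_
      exact (hgc.norm.inv₀ fun x hx => norm_ne_zero_iff.2 (hg0 x hx)).smul hgc
    · intro x hx
      simp only [hgo x hx, norm_neg, smul_neg, hDodd]
    · intro x hx
      set u := ‖g x‖⁻¹ • g x with hu
      have hn : 0 < ‖g x‖ := norm_pos_iff.2 (hg0 x hx)
      have huS : u ∈ S := by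
        simp [hS, hu, norm_smul, hn.ne']
      have h1 := abs_le.1 (hest t ht u (Or.inl huS))
      have h2 := abs_le.1 (hest s hs (D u) (Or.inr ⟨u, huS, rfl⟩))
      have h3 := hD u huS
      have h4 : A u < t * B u := by
        rw [hu, hA2, hB2]
        have := mul_lt_mul_of_pos_left (hgn x hx) (show 0 < ‖g x‖⁻¹ ^ 2 by positivity)
        linarith
      nlinarith
  have hP0 : P T₀ := by
    have := (isPreconnected_Icc (a := T₀) (b := T₁)).induction₂' (fun a b => P a → P b)
      (fun T hTm => by
        obtain ⟨ε, hε, h⟩ := hloc T hTm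
        have hmem : ∀ᶠ t in nhdsWithin T (Icc T₀ T₁), |t - T| < ε :=
          nhdsWithin_le_nhds (Metric.ball_mem_nhds T hε)
        filter_upwards [hmem] with t ht
        exact ⟨h T t (by simpa using hε) ht, h t T ht (by simpa using hε)⟩)
      (fun a b c _ _ _ h1 h2 h => h2 (h1 h)) (right_mem_Icc.2 hT) (left_mem_Icc.2 hT)
    exact this hP1
  obtain ⟨g, hgc, hgo, hgn⟩ := hP0
  obtain ⟨x, hx, h⟩ := borsukUlam hdim (fun x => p (g x))
    (p.continuous_of_finiteDimensional.comp_continuousOn hgc) (fun x hx => by simp [hgo x hx])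
  exact absurd (hp _ h) (not_le.2 (hgn x hx))

end Deformation

section DiscreteAction

variable {V : Type*} [NormedAddCommGroup V] [InnerProductSpace ℝ V]

/-- Extension of a finite sequence by zero. -/
def extZero (n j : ℕ) : (Fin n → V) →L[ℝ] V :=
  if h : j < n then ContinuousLinearMap.proj (⟨j, h⟩ : Fin n) else 0

/-- Extension of a finite sequence by zero, shifted by one. -/
def extShift (n : ℕ) : ℕ → ((Fin n → V) →L[ℝ] V)
  | 0 => 0
  | j + 1 => extZero n j

lemma extZero_of_lt {n j : ℕ} (h : j < n) (a : Fin n → V) : extZero n j a = a ⟨j, h⟩ := by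
  simp [extZero, h]

lemma extZero_of_le {n j : ℕ} (h : n ≤ j) (a : Fin n → V) : extZero n j a = 0 := by
  simp [extZero, not_lt.2 h]

lemma extZero_single {n : ℕ} (i : Fin n) (u : V) (j : ℕ) :
    extZero n j (Pi.single i u) = if j = i then u else 0 := by
  by_cases h : j < n
  · rw [extZero_of_lt h, Pi.single_apply]
    simp [Fin.ext_iff]
  · rw [extZero_of_le (not_lt.1 h), if_neg]
    have := i.2
    omega

/-- The discrete Liouville action. -/
noncomputable def discreteLiouville (M : ℕ) (e : (Fin M → V) × (Fin (M + 1) → V)) : ℝ :=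
  ∑ j ∈ Finset.range (M + 1),
    inner ℝ (extZero (M + 1) j e.2) (extShift M (j + 1) e.1 - extShift M j e.1)

/-- The discrete integral of a Hamiltonian. -/
noncomputable def discreteHam (H : V × V → ℝ) (M : ℕ)
    (e : (Fin M → V) × (Fin (M + 1) → V)) : ℝ :=
  ∑ j ∈ Finset.range (M + 1),
    ((M + 1 : ℕ) : ℝ)⁻¹ * H (extShift M j e.1, extZero (M + 1) j e.2)

lemma hasFDerivAt_discreteLiouville (M : ℕ) (e v : (Fin M → V) × (Fin (M + 1) → V)) :
    fderiv ℝ (discreteLiouville M) e v = ∑ j ∈ Finset.range (M + 1),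
      (inner ℝ (extZero (M + 1) j e.2) (extShift M (j + 1) v.1 - extShift M j v.1) +
      inner ℝ (extZero (M + 1) j v.2) (extShift M (j + 1) e.1 - extShift M j e.1)) := by
  have h : ∀ j, HasFDerivAt (fun e : (Fin M → V) × (Fin (M + 1) → V) =>
      inner ℝ (extZero (M + 1) j e.2) (extShift M (j + 1) e.1 - extShift M j e.1)) _ e :=
    fun j => HasFDerivAt.inner ℝ
      (((extZero (V := V) (M + 1) j).comp
        (ContinuousLinearMap.snd ℝ (Fin M → V) (Fin (M + 1) → V))).hasFDerivAt (x := e))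
      (((extShift (V := V) M (j + 1) - extShift M j).comp
        (ContinuousLinearMap.fst ℝ (Fin M → V) (Fin (M + 1) → V))).hasFDerivAt (x := e))
  have h2 := HasFDerivAt.fun_sum (u := Finset.range (M + 1)) fun j _ => h j
  unfold discreteLiouville
  rw [h2.fderiv]
  simp [fderivInnerCLM_apply]

lemma contDiff_discreteLiouville (M : ℕ) : ContDiff ℝ 1 (discreteLiouville (V := V) M) := by
  unfold discreteLiouville
  refine ContDiff.sum fun j _ => ContDiff.inner ℝ ?_ ?_
  · exact (extZero (V := V) (M + 1) j).contDiff.comp contDiff_snd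
  · exact ((extShift (V := V) M (j + 1)).contDiff.comp contDiff_fst).sub
      ((extShift (V := V) M j).contDiff.comp contDiff_fst)

variable {H : V × V → ℝ} {P Q : V × V → V}

lemma contDiff_discreteHam (hH : ContDiff ℝ 1 H) (M : ℕ) : ContDiff ℝ 1 (discreteHam H M) := by
  unfold discreteHam
  refine ContDiff.sum fun j _ => contDiff_const.mul (hH.comp ?_)
  exact ((extShift (V := V) M j).contDiff.comp contDiff_fst).prodMk
    ((extZero (V := V) (M + 1) j).contDiff.comp contDiff_snd)

lemma fderiv_discreteHam (hH : ContDiff ℝ 1 H)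
    (hPQ : ∀ x v, fderiv ℝ H x v = inner ℝ (P x) v.1 + inner ℝ (Q x) v.2)
    (M : ℕ) (e v : (Fin M → V) × (Fin (M + 1) → V)) :
    fderiv ℝ (discreteHam H M) e v = ∑ j ∈ Finset.range (M + 1), ((M + 1 : ℕ) : ℝ)⁻¹ *
      (inner ℝ (P (extShift M j e.1, extZero (M + 1) j e.2)) (extShift M j v.1) +
       inner ℝ (Q (extShift M j e.1, extZero (M + 1) j e.2)) (extZero (M + 1) j v.2)) := by
  have h : ∀ j, HasFDerivAt (fun e : (Fin M → V) × (Fin (M + 1) → V) =>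
      ((M + 1 : ℕ) : ℝ)⁻¹ * H (extShift M j e.1, extZero (M + 1) j e.2)) _ e :=
    fun j => ((hH.differentiable one_ne_zero _).hasFDerivAt.comp e
      ((((extShift (V := V) M j).comp
        (ContinuousLinearMap.fst ℝ (Fin M → V) (Fin (M + 1) → V)))).hasFDerivAt.prodMk
      (((extZero (V := V) (M + 1) j).comp
        (ContinuousLinearMap.snd ℝ (Fin M → V) (Fin (M + 1) → V))).hasFDerivAt (x := e)))).const_mul
      _
  have h2 := HasFDerivAt.fun_sum (u := Finset.range (M + 1)) fun j _ => h j
  unfold discreteHam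
  rw [h2.fderiv]
  simp [hPQ]

lemma inner_ite_zero_left (p : Prop) [Decidable p] (x y : V) :
    inner ℝ (if p then x else 0) y = if p then inner ℝ x y else 0 := by
  split_ifs <;> simp

lemma inner_ite_zero_right (p : Prop) [Decidable p] (x y : V) :
    inner ℝ x (if p then y else 0) = if p then inner ℝ x y else 0 := by
  split_ifs <;> simp

lemma discrete_hamilton_equations (hH : ContDiff ℝ 1 H)
    (hPQ : ∀ x v, fderiv ℝ H x v = inner ℝ (P x) v.1 + inner ℝ (Q x) v.2)
    (M : ℕ) (e : (Fin M → V) × (Fin (M + 1) → V)) (T : ℝ)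
    (he : fderiv ℝ (discreteLiouville M) e = T • fderiv ℝ (discreteHam H M) e) :
    (∀ j < M + 1, extShift M (j + 1) e.1 - extShift M j e.1 =
      (T / (M + 1 : ℕ)) • Q (extShift M j e.1, extZero (M + 1) j e.2)) ∧
    (∀ j < M, extZero (M + 1) (j + 1) e.2 - extZero (M + 1) j e.2 =
      -((T / (M + 1 : ℕ)) • P (extShift M (j + 1) e.1, extZero (M + 1) (j + 1) e.2))) := by
  have key : ∀ v, _ = _ := fun v => congrArg (fun L => L v) he
  constructor
  · intro j hj
    refine ext_inner_left ℝ fun u => ?_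
    have h := key (0, Pi.single ⟨j, hj⟩ u)
    simp only [smul_apply, hasFDerivAt_discreteLiouville,
      fderiv_discreteHam hH hPQ, map_zero, sub_zero, inner_zero_right, zero_add,
      extZero_single, smul_eq_mul] at h
    simp only [inner_ite_zero_left, inner_ite_zero_right, mul_ite, mul_zero] at h
    rw [Finset.sum_ite_eq', Finset.sum_ite_eq', if_pos (Finset.mem_range.2 hj),
      if_pos (Finset.mem_range.2 hj)] at h
    rw [h, inner_smul_right, real_inner_comm]
    ring
  · intro j hj
    refine ext_inner_left ℝ fun u => ?_
    have h := key (Pi.single ⟨j, hj⟩ u, 0)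
    have hs : ∀ i, extShift M i (Pi.single ⟨j, hj⟩ u) = if i = j + 1 then u else 0 := by
      intro i
      cases i with
      | zero => simp [extShift]
      | succ i => simp [extShift, extZero_single]
    simp only [smul_apply, hasFDerivAt_discreteLiouville,
      fderiv_discreteHam hH hPQ, map_zero, inner_zero_right, inner_zero_left, add_zero,
      hs, smul_eq_mul, inner_sub_right] at h
    simp only [inner_ite_zero_right, mul_ite, mul_zero, sub_zero, add_zero,
      Finset.sum_sub_distrib, Nat.add_right_cancel_iff] at h
    rw [Finset.sum_ite_eq', Finset.sum_ite_eq', Finset.sum_ite_eq',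
      if_pos (Finset.mem_range.2 (by omega)), if_pos (Finset.mem_range.2 (by omega)),
      if_pos (Finset.mem_range.2 (by omega))] at h
    rw [inner_sub_right, inner_neg_right, inner_smul_right, real_inner_comm, real_inner_comm _ u,
      real_inner_comm _ u]
    linear_combination -h

end DiscreteAction

section DiscreteChord

variable {V : Type*} [NormedAddCommGroup V] [InnerProductSpace ℝ V]

lemma sum_range_mul_blocks (f : ℕ → ℝ) (ℓ k : ℕ) :
    ∑ j ∈ Finset.range (k * ℓ), f j =
      ∑ b ∈ Finset.range k, ∑ r ∈ Finset.range ℓ, f (b * ℓ + r) := by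
  induction k with
  | zero => simp
  | succ k ih => rw [Nat.succ_mul, Finset.sum_range_add, ih, Finset.sum_range_succ]

/-- Discrete Poincaré inequality on a block. -/
lemma discrete_poincare_block {W : Type*} [NormedAddCommGroup W] (z : ℕ → W) (hz : z 0 = 0)
    (ℓ : ℕ) :
    ∑ r ∈ Finset.range ℓ, ‖z r‖ ^ 2 ≤ (ℓ : ℝ) ^ 2 *
      ∑ r ∈ Finset.range ℓ, ‖z (r + 1) - z r‖ ^ 2 := by
  have h : ∀ r ∈ Finset.range ℓ, ‖z r‖ ^ 2 ≤ ℓ * ∑ r ∈ Finset.range ℓ, ‖z (r + 1) - z r‖ ^ 2 := by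
    intro r hr
    have hr := (Finset.mem_range.1 hr).le
    have h1 : z r = ∑ i ∈ Finset.range r, (z (i + 1) - z i) := by
      rw [Finset.sum_range_sub, hz, sub_zero]
    have h2 : ‖z r‖ ≤ ∑ i ∈ Finset.range ℓ, ‖z (i + 1) - z i‖ := by
      conv_lhs => rw [h1]
      refine (norm_sum_le _ _).trans ?_
      exact Finset.sum_le_sum_of_subset_of_nonneg (Finset.range_mono hr)
        fun _ _ _ => norm_nonneg _
    calc ‖z r‖ ^ 2 ≤ (∑ i ∈ Finset.range ℓ, ‖z (i + 1) - z i‖) ^ 2 := by gcongr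
      _ ≤ _ := by
        have := sq_sum_le_card_mul_sum_sq (s := Finset.range ℓ)
          (f := fun i => ‖z (i + 1) - z i‖)
        simpa using this
  refine (Finset.sum_le_sum h).trans ?_
  simp only [Finset.sum_const, Finset.card_range, nsmul_eq_mul]
  rw [← mul_assoc, sq]

lemma sum_sq_parabola (L : ℝ) (n : ℕ) :
    ∑ r ∈ Finset.range n, ((r : ℝ) * (L - r)) ^ 2 =
      L ^ 2 * (n * (n - 1) * (2 * n - 1) / 6) - L * (n ^ 2 * (n - 1) ^ 2 / 2) +
        n * (n - 1) * (2 * n - 1) * (3 * n ^ 2 - 3 * n - 1) / 30 := by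
  induction n with
  | zero => simp
  | succ n ih => rw [Finset.sum_range_succ, ih]; push_cast; ring

lemma sum_sq_diff_parabola (L : ℝ) (n : ℕ) :
    ∑ r ∈ Finset.range n, (((r + 1 : ℕ) : ℝ) * (L - (r + 1 : ℕ)) - (r : ℝ) * (L - r)) ^ 2 =
      n * (L - 1) ^ 2 - 2 * (L - 1) * (n * (n - 1)) + 4 * (n * (n - 1) * (2 * n - 1) / 6) := by
  induction n with
  | zero => simp
  | succ n ih => rw [Finset.sum_range_succ, ih]; push_cast; ring

lemma sum_parabola_ineq (ℓ : ℕ) (hℓ : 1 ≤ ℓ) :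
    (ℓ : ℝ) ^ 2 * ∑ r ∈ Finset.range ℓ,
        (((r + 1 : ℕ) : ℝ) * ((ℓ : ℝ) - (r + 1 : ℕ)) - (r : ℝ) * ((ℓ : ℝ) - r)) ^ 2 ≤
      10 * ∑ r ∈ Finset.range ℓ, ((r : ℝ) * ((ℓ : ℝ) - r)) ^ 2 := by
  rw [sum_sq_parabola, sum_sq_diff_parabola]
  have h : (1 : ℝ) ≤ ℓ := by exact_mod_cast hℓ
  have h1 : (0 : ℝ) ≤ (ℓ : ℝ) * (ℓ ^ 2 - 1) := by
    apply mul_nonneg <;> nlinarith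
  nlinarith

variable {H : V × V → ℝ} {P Q : V × V → V}

set_option maxHeartbeats 1000000 in
/-- Existence of solutions of the discrete Hamilton equations with Dirichlet conditions,
uniformly in the mesh. -/
theorem exists_discrete_chord [FiniteDimensional ℝ V] [Nontrivial V] (hH : ContDiff ℝ 1 H)
    (hPQ : ∀ x v, fderiv ℝ H x v = inner ℝ (P x) v.1 + inner ℝ (Q x) v.2)
    (hH2 : ∀ (r : ℝ) x, H (r • x) = r ^ 2 * H x) {ε C T₀ T₁ : ℝ} (hε : 0 < ε)
    (hlow : ∀ x, ε * (‖x.1‖ ^ 2 + ‖x.2‖ ^ 2) ≤ H x) (hup : ∀ x, H x ≤ C * (‖x.1‖ ^ 2 + ‖x.2‖ ^ 2))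
    (hT₀ : 0 ≤ T₀) (k : ℕ) (hk : 2 * T₀ * C ≤ k + 1) (hT₁ : 3 * (k + 1) / ε ≤ T₁) (hT : T₀ ≤ T₁)
    (ℓ : ℕ) (hℓ : 2 ≤ ℓ) (M : ℕ) (hM : M + 1 = (k + 1) * ℓ) :
    ∃ T ∈ Icc T₀ T₁, ∃ z w : ℕ → V, z 0 = 0 ∧ z (M + 1) = 0 ∧
      (∀ j < M + 1, z (j + 1) - z j = (T / (M + 1 : ℕ)) • Q (z j, w j)) ∧
      (∀ j < M, w (j + 1) - w j = -((T / (M + 1 : ℕ)) • P (z (j + 1), w (j + 1)))) ∧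
      ∃ j < M + 1, (z j, w j) ≠ 0 := by
  have hℓ0 : (0 : ℝ) < ℓ := by exact_mod_cast (by omega : 0 < ℓ)
  have hN0 : (0 : ℝ) < (M + 1 : ℕ) := by positivity
  have hNk : ((M + 1 : ℕ) : ℝ) = (k + 1) * ℓ := by rw [hM]; push_cast; ring
  have hk0 : (0 : ℝ) < k + 1 := by positivity
  have hM0 : ∀ z : Fin M → V, extShift M (M + 1) z = 0 := fun z => extZero_of_le le_rfl z
  suffices hcrit : ∃ T ∈ Icc T₀ T₁, ∃ e : (Fin M → V) × (Fin (M + 1) → V), e ≠ 0 ∧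
      fderiv ℝ (discreteLiouville M) e = T • fderiv ℝ (discreteHam H M) e by
    obtain ⟨T, hTm, e, he, hc⟩ := hcrit
    obtain ⟨h1, h2⟩ := discrete_hamilton_equations hH hPQ M e T hc
    refine ⟨T, hTm, fun j => extShift M j e.1, fun j => extZero (M + 1) j e.2, rfl, hM0 _,
      h1, h2, ?_⟩
    by_contra! hcon
    apply he
    ext i
    · have := congrArg Prod.fst (hcon (i + 1) (by omega))
      simpa [extShift, extZero_of_lt i.2] using this
    · have := congrArg Prod.snd (hcon i (by omega))
      simpa [extZero_of_lt i.2] using this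
  by_contra! hcon
  -- the subspace on which the action is negative
  let ι : ((Fin (k + 1) → V) × (Fin (M + 1) → V)) →ₗ[ℝ] ((Fin M → V) × (Fin (M + 1) → V)) :=
    LinearMap.prod
      (LinearMap.pi fun i : Fin M =>
        ((((i + 1 : ℕ) % ℓ : ℕ) : ℝ) * ((ℓ : ℝ) - ((i + 1 : ℕ) % ℓ : ℕ))) •
          ((extZero (k + 1) ((i + 1 : ℕ) / ℓ) : (Fin (k + 1) → V) →L[ℝ] V) :
            (Fin (k + 1) → V) →ₗ[ℝ] V) ∘ₗ LinearMap.fst ℝ _ _)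
      (LinearMap.snd ℝ _ _)
  let π : ((Fin M → V) × (Fin (M + 1) → V)) →ₗ[ℝ] ((Fin k → V) × (Fin (M + 1) → V)) :=
    LinearMap.prod
      (LinearMap.pi fun i : Fin k =>
        ((extShift M ((i + 1) * ℓ) : (Fin M → V) →L[ℝ] V) : (Fin M → V) →ₗ[ℝ] V) ∘ₗ
          LinearMap.fst ℝ _ _)
      (LinearMap.pi fun i : Fin (M + 1) =>
        ((extZero (M + 1) i : (Fin (M + 1) → V) →L[ℝ] V) : (Fin (M + 1) → V) →ₗ[ℝ] V) ∘ₗ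
          LinearMap.snd ℝ _ _ -
        (ℓ : ℝ) • ((extShift M (i + 1) - extShift M i : (Fin M → V) →L[ℝ] V) :
          (Fin M → V) →ₗ[ℝ] V) ∘ₗ LinearMap.fst ℝ _ _)
  have hdim := finrank_le_of_no_critical_point (discreteLiouville (V := V) M) (discreteHam H M)
    (contDiff_discreteLiouville M) (contDiff_discreteHam hH M)
    (by
      intro r e
      simp only [discreteLiouville, Prod.smul_fst, Prod.smul_snd, map_smul, ← smul_sub,
        inner_smul_left, inner_smul_right, Finset.mul_sum]
      refine Finset.sum_congr rfl fun j _ => ?_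
      simp; ring)
    (by
      intro r e
      simp only [discreteHam, Prod.smul_fst, Prod.smul_snd, map_smul, Finset.mul_sum]
      refine Finset.sum_congr rfl fun j _ => ?_
      rw [← Prod.smul_mk, hH2]; ring)
    hT (fun T hTm e he => hcon T hTm e he) ι ?_ π ?_
  · simp only [Module.finrank_prod, Module.finrank_pi_fintype,
      Finset.sum_const, Finset.card_univ, Fintype.card_fin, smul_eq_mul] at hdim
    have := Module.finrank_pos (R := ℝ) (M := V)
    nlinarith
  · rintro ⟨a, w⟩ hne
    set z : Fin M → V := (ι (a, w)).1 with hz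
    have hw : (ι (a, w)).2 = w := rfl
    let φ : ℕ → ℝ := fun r => (r : ℝ) * ((ℓ : ℝ) - r)
    have hφℓ : φ ℓ = 0 := by simp [φ]
    have hφ0 : φ 0 = 0 := by simp [φ]
    have hzb : ∀ b < k + 1, ∀ r ≤ ℓ,
        extShift M (b * ℓ + r) z = φ r • extZero (k + 1) b a := by
      intro b hb r hr
      have hgen : ∀ j ≤ M, extShift M j z = φ (j % ℓ) • extZero (k + 1) (j / ℓ) a := by
        intro j hj
        cases j with
        | zero => simp [extShift, hφ0]
        | succ j =>
          have hj' : j < M := hj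
          rw [extShift, extZero_of_lt hj']
          simp [hz, ι, φ]
      have hbk : b * ℓ + ℓ ≤ (k + 1) * ℓ := by
        have := Nat.mul_le_mul_right ℓ hb
        rwa [Nat.succ_mul] at this
      rcases hr.lt_or_eq with hr | rfl
      · rw [hgen _ (by omega)]
        rw [Nat.mul_comm b ℓ, Nat.mul_add_mod, Nat.mod_eq_of_lt hr,
          Nat.mul_add_div (by omega), Nat.div_eq_of_lt hr, add_zero]
      · rw [hφℓ, zero_smul]
        by_cases h : b * r + r = M + 1
        · rw [h, hM0]
        · rw [hgen _ (by omega), show b * r + r = (b + 1) * r by ring, Nat.mul_mod_left, hφ0,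
            zero_smul]
    set S := ∑ b ∈ Finset.range (k + 1), ‖extZero (k + 1) b a‖ ^ 2 with hS
    set Sφ := ∑ r ∈ Finset.range ℓ, φ r ^ 2 with hSφ
    have hsumz : ∑ j ∈ Finset.range (M + 1), ‖extShift M j z‖ ^ 2 = S * Sφ := by
      rw [hM, sum_range_mul_blocks, hS, Finset.sum_mul]
      refine Finset.sum_congr rfl fun b hb => ?_
      rw [hSφ, Finset.mul_sum]
      refine Finset.sum_congr rfl fun r hr => ?_
      rw [hzb b (Finset.mem_range.1 hb) r (Finset.mem_range.1 hr).le, norm_smul, mul_pow,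
        Real.norm_eq_abs, sq_abs, mul_comm]
    have hsumd : ∑ j ∈ Finset.range (M + 1), ‖extShift M (j + 1) z - extShift M j z‖ ^ 2 =
        S * ∑ r ∈ Finset.range ℓ, (φ (r + 1) - φ r) ^ 2 := by
      rw [hM, sum_range_mul_blocks, hS, Finset.sum_mul]
      refine Finset.sum_congr rfl fun b hb => ?_
      rw [Finset.mul_sum]
      refine Finset.sum_congr rfl fun r hr => ?_
      have hr := Finset.mem_range.1 hr
      rw [add_assoc, hzb b (Finset.mem_range.1 hb) r hr.le,
        hzb b (Finset.mem_range.1 hb) (r + 1) hr, ← sub_smul, norm_smul, mul_pow,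
        Real.norm_eq_abs, sq_abs, mul_comm]
    have hS0 : 0 ≤ S := Finset.sum_nonneg fun _ _ => sq_nonneg _
    have hratio : (ℓ : ℝ) ^ 2 * ∑ j ∈ Finset.range (M + 1),
        ‖extShift M (j + 1) z - extShift M j z‖ ^ 2 ≤
        10 * ∑ j ∈ Finset.range (M + 1), ‖extShift M j z‖ ^ 2 := by
      rw [hsumz, hsumd]
      have := mul_le_mul_of_nonneg_left (sum_parabola_ineq ℓ (by omega)) hS0
      simp only [hSφ, φ]
      linarith
    set Zs := ∑ j ∈ Finset.range (M + 1), ‖extShift M j z‖ ^ 2 with hZs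
    set Ds := ∑ j ∈ Finset.range (M + 1), ‖extShift M (j + 1) z - extShift M j z‖ ^ 2 with hDs
    set Ws := ∑ j ∈ Finset.range (M + 1), ‖extZero (M + 1) j w‖ ^ 2 with hWs
    have hW0 : 0 ≤ Ws := Finset.sum_nonneg fun _ _ => sq_nonneg _
    have hZ0 : 0 ≤ Zs := Finset.sum_nonneg fun _ _ => sq_nonneg _
    have hSφ0 : 0 < Sφ := by
      refine Finset.sum_pos' (fun _ _ => sq_nonneg _) ⟨1, Finset.mem_range.2 (by omega), ?_⟩
      have : (2 : ℝ) ≤ ℓ := by exact_mod_cast hℓ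
      simp only [φ]
      push_cast
      have : 0 < 1 * ((ℓ : ℝ) - 1) := by linarith
      positivity
    have hpos : 0 < Zs + Ws := by
      refine lt_of_le_of_ne (by positivity) fun h => hne ?_
      have hZ : S * Sφ = 0 := by rw [← hsumz]; linarith
      have hW : Ws = 0 := by linarith
      have hS' : S = 0 := by
        rcases mul_eq_zero.1 hZ with h | h
        · exact h
        · exact absurd h hSφ0.ne'
      rw [hS, Finset.sum_eq_zero_iff_of_nonneg (fun _ _ => sq_nonneg _)] at hS'
      rw [hWs, Finset.sum_eq_zero_iff_of_nonneg (fun _ _ => sq_nonneg _)] at hW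
      ext i
      · have := hS' i (Finset.mem_range.2 i.2)
        rw [extZero_of_lt i.2] at this
        simpa using this
      · have := hW i (Finset.mem_range.2 i.2)
        rw [extZero_of_lt i.2] at this
        simpa using this
    have hA : discreteLiouville M (ι (a, w)) ≤ 2 / ℓ * Ws + ℓ / 8 * Ds := by
      rw [discreteLiouville, hWs, hDs, Finset.mul_sum, Finset.mul_sum, ← Finset.sum_add_distrib]
      refine Finset.sum_le_sum fun j _ => ?_
      rw [← hz, hw]
      refine (real_inner_le_norm _ _).trans ?_
      have h := sq_nonneg (4 * ‖extZero (M + 1) j w‖ - ℓ * ‖extShift M (j + 1) z - extShift M j z‖)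
      set x := ‖extZero (M + 1) j w‖
      set y := ‖extShift M (j + 1) z - extShift M j z‖
      have e : 2 / (ℓ : ℝ) * x ^ 2 + ℓ / 8 * y ^ 2 - x * y = (4 * x - ℓ * y) ^ 2 / (8 * ℓ) := by
        field_simp; ring
      have : 0 ≤ (4 * x - ℓ * y) ^ 2 / (8 * ℓ) := by positivity
      linarith
    have hB : ((M + 1 : ℕ) : ℝ)⁻¹ * (ε * (Zs + Ws)) ≤ discreteHam H M (ι (a, w)) := by
      rw [discreteHam, hZs, hWs, ← Finset.sum_add_distrib, Finset.mul_sum, Finset.mul_sum]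
      refine Finset.sum_le_sum fun j _ => ?_
      rw [← hz, hw]
      exact mul_le_mul_of_nonneg_left (hlow (_, _)) (by positivity)
    have hT1 : 0 ≤ T₁ := le_trans (by positivity) hT₁
    have hTB : 3 / ℓ * (Zs + Ws) ≤ T₁ * discreteHam H M (ι (a, w)) := by
      refine le_trans ?_ (mul_le_mul_of_nonneg_left hB hT1)
      refine le_trans ?_ (mul_le_mul_of_nonneg_right hT₁ (by positivity))
      rw [hNk]
      apply le_of_eq
      field_simp
    have hDs' : ℓ / 8 * Ds ≤ (10 / 8) / ℓ * Zs := by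
      rw [div_mul_eq_mul_div, div_mul_eq_mul_div, div_le_div_iff₀ (by norm_num) hℓ0]
      have e : ℓ * Ds * ℓ = (ℓ : ℝ) ^ 2 * Ds := by ring
      linarith
    have h1 : (10 / 8) / ℓ * Zs ≤ 2 / ℓ * Zs := by gcongr; norm_num
    have h2 : 2 / ℓ * (Zs + Ws) < 3 / ℓ * (Zs + Ws) := by gcongr; norm_num
    linarith
  · rintro ⟨z, w⟩ hker
    have hker1 : ∀ b ≤ k + 1, extShift M (b * ℓ) z = 0 := by
      intro b hb
      rcases Nat.eq_zero_or_pos b with rfl | hb0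
      · simp [extShift]
      rcases hb.eq_or_lt with rfl | hb
      · rw [← hM, hM0]
      have := congrFun (congrArg Prod.fst hker) ⟨b - 1, by omega⟩
      simp only [π, LinearMap.prod_apply] at this
      simpa [Nat.sub_add_cancel hb0] using this
    have hker2 : ∀ j < M + 1, extZero (M + 1) j w =
        (ℓ : ℝ) • (extShift M (j + 1) z - extShift M j z) := by
      intro j hj
      have := congrFun (congrArg Prod.snd hker) ⟨j, hj⟩
      simp only [π, LinearMap.prod_apply] at this
      simpa [sub_eq_zero] using this
    set Zs := ∑ j ∈ Finset.range (M + 1), ‖extShift M j z‖ ^ 2 with hZs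
    set Ds := ∑ j ∈ Finset.range (M + 1), ‖extShift M (j + 1) z - extShift M j z‖ ^ 2 with hDs
    have hZ0 : 0 ≤ Zs := Finset.sum_nonneg fun _ _ => sq_nonneg _
    have hD0 : 0 ≤ Ds := Finset.sum_nonneg fun _ _ => sq_nonneg _
    have hA : discreteLiouville M (z, w) = ℓ * Ds := by
      rw [discreteLiouville, hDs, Finset.mul_sum]
      refine Finset.sum_congr rfl fun j hj => ?_
      simp only
      rw [hker2 j (Finset.mem_range.1 hj), inner_smul_left, real_inner_self_eq_norm_sq]
      simp
    have hpoin : Zs ≤ (ℓ : ℝ) ^ 2 * Ds := by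
      rw [hZs, hDs, hM, sum_range_mul_blocks, sum_range_mul_blocks, Finset.mul_sum]
      refine Finset.sum_le_sum fun b hb => ?_
      have := discrete_poincare_block (fun r => extShift M (b * ℓ + r) z)
        (by simpa using hker1 b (Finset.mem_range.1 hb).le) ℓ
      simpa only [add_assoc] using this
    have hC : 0 ≤ C := by
      obtain ⟨v, hv⟩ := exists_ne (0 : V)
      have h1 := (hlow (v, 0)).trans (hup (v, 0))
      have h2 : 0 < ‖v‖ ^ 2 := by positivity
      simp only [norm_zero] at h1
      by_contra! hneg
      nlinarith
    have hB : discreteHam H M (z, w) ≤ ((M + 1 : ℕ) : ℝ)⁻¹ * (C * (Zs + ℓ ^ 2 * Ds)) := by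
      rw [discreteHam, hZs, hDs, Finset.mul_sum, ← Finset.sum_add_distrib, Finset.mul_sum,
        Finset.mul_sum]
      refine Finset.sum_le_sum fun j hj => ?_
      refine mul_le_mul_of_nonneg_left ((hup (_, _)).trans (le_of_eq ?_)) (by positivity)
      simp only
      rw [hker2 j (Finset.mem_range.1 hj), norm_smul, mul_pow]
      simp
    rw [hA]
    have h1 : C * (Zs + ℓ ^ 2 * Ds) ≤ C * (2 * ℓ ^ 2 * Ds) := by gcongr; linarith
    calc T₀ * discreteHam H M (z, w)
        ≤ T₀ * (((M + 1 : ℕ) : ℝ)⁻¹ * (C * (2 * ℓ ^ 2 * Ds))) := by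
          refine mul_le_mul_of_nonneg_left (hB.trans ?_) hT₀
          exact mul_le_mul_of_nonneg_left h1 (by positivity)
      _ = (2 * T₀ * C) * (ℓ * Ds / (k + 1)) := by rw [hNk]; field_simp
      _ ≤ (k + 1) * (ℓ * Ds / (k + 1)) := mul_le_mul_of_nonneg_right hk (by positivity)
      _ = ℓ * Ds := by field_simp

end DiscreteChord

section LongChord

variable {V : Type*} [NormedAddCommGroup V] [InnerProductSpace ℝ V]
variable {H : V × V → ℝ} {P Q : V × V → V}

lemma norm_sub_le_of_steps {W : Type*} [NormedAddCommGroup W] {x : ℕ → W × W} {M : ℕ} {κ : ℝ}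
    (h : ∀ j < M, ‖x (j + 1) - x j‖ ≤ κ) {a b : ℕ} (hab : a ≤ b) (hb : b ≤ M) :
    ‖x b - x a‖ ≤ ((b : ℝ) - a) * κ := by
  induction b, hab using Nat.le_induction with
  | base => simp
  | succ b hab ih =>
    have h1 := h b (by omega)
    have h2 := ih (by omega)
    calc ‖x (b + 1) - x a‖ = ‖(x (b + 1) - x b) + (x b - x a)‖ := by congr 1; abel
      _ ≤ κ + ((b : ℝ) - a) * κ := (norm_add_le _ _).trans (add_le_add h1 h2)
      _ = _ := by push_cast; ring

lemma discrete_drift {x : ℕ → V × V} {M : ℕ} {τ K ε δ : ℝ} (hτ : 0 ≤ τ)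
    (hx : ∀ j < M, x (j + 1) - x j = τ • (Q (x j), -P (x (j + 1)))) (hb : ∀ j ≤ M, ‖x j‖ ≤ 1)
    (hK : ∀ j < M, ‖x (j + 1) - x j‖ ≤ τ * K)
    (hu : ∀ y y' : V × V, ‖y‖ ≤ 1 → ‖y'‖ ≤ 1 → ‖y - y'‖ ≤ δ →
      ‖Q y - Q y'‖ ≤ ε ∧ ‖P y - P y'‖ ≤ ε)
    (hK0 : 0 ≤ K) {a b c : ℕ} (hac : a ≤ c) (hcb : c ≤ b) (hbM : b ≤ M)
    (hδ : ((b : ℝ) - a) * (τ * K) ≤ δ) :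
    ‖x b - x a - (((b : ℝ) - a) * τ) • (Q (x c), -P (x c))‖ ≤ ((b : ℝ) - a) * (τ * ε) := by
  have hclose : ∀ i, a ≤ i → i ≤ b → ‖x i - x c‖ ≤ δ := by
    intro i hai hib
    have hi : (a : ℝ) ≤ i := by exact_mod_cast hai
    have hi' : (i : ℝ) ≤ b := by exact_mod_cast hib
    have hc : (a : ℝ) ≤ c := by exact_mod_cast hac
    have hc' : (c : ℝ) ≤ b := by exact_mod_cast hcb
    have h0 : 0 ≤ τ * K := mul_nonneg hτ hK0
    rcases le_total i c with h | h
    · rw [norm_sub_rev]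
      refine (norm_sub_le_of_steps hK h (hcb.trans hbM)).trans (le_trans ?_ hδ)
      gcongr
    · refine (norm_sub_le_of_steps hK h (hib.trans hbM)).trans (le_trans ?_ hδ)
      gcongr
  have key : ∀ i, a ≤ i → i ≤ b →
      ‖x i - x a - (((i : ℝ) - a) * τ) • (Q (x c), -P (x c))‖ ≤ ((i : ℝ) - a) * (τ * ε) := by
    intro i hai
    induction i, hai using Nat.le_induction with
    | base => simp
    | succ i hai ih =>
      intro hib
      have h2 := ih (by omega)
      have hq := (hu _ _ (hb i (by omega)) (hb c (by omega)) (hclose i hai (by omega))).1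
      have hp := (hu _ _ (hb (i + 1) (by omega)) (hb c (by omega))
        (hclose (i + 1) (by omega) hib)).2
      have h1 : ‖(x (i + 1) - x i) - τ • (Q (x c), -P (x c))‖ ≤ τ * ε := by
        rw [hx i (by omega), ← smul_sub, norm_smul, Real.norm_of_nonneg hτ]
        refine mul_le_mul_of_nonneg_left ?_ hτ
        rw [Prod.mk_sub_mk, Prod.norm_mk]
        refine max_le hq ?_
        rw [← norm_neg]
        simpa [sub_eq_add_neg, add_comm] using hp
      calc _ = ‖((x (i + 1) - x i) - τ • (Q (x c), -P (x c))) +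
            (x i - x a - (((i : ℝ) - a) * τ) • (Q (x c), -P (x c)))‖ := by
              congr 1; push_cast; module
        _ ≤ τ * ε + ((i : ℝ) - a) * (τ * ε) := (norm_add_le _ _).trans (add_le_add h1 h2)
        _ = _ := by push_cast; ring
  exact key b (hac.trans hcb) le_rfl

lemma quadratic_bounds [FiniteDimensional ℝ V] [Nontrivial V] (hHc : Continuous H)
    (hH2 : ∀ (r : ℝ) x, H (r • x) = r ^ 2 * H x) (hpos : ∀ x ≠ 0, 0 < H x) :
    ∃ ε > 0, ∃ C, ∀ x : V × V, ε * (‖x.1‖ ^ 2 + ‖x.2‖ ^ 2) ≤ H x ∧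
      H x ≤ C * (‖x.1‖ ^ 2 + ‖x.2‖ ^ 2) := by
  set S : Set (V × V) := {x | ‖x.1‖ ^ 2 + ‖x.2‖ ^ 2 = 1} with hS
  have hSc : IsCompact S := by
    refine Metric.isCompact_of_isClosed_isBounded ?_ ?_
    · exact isClosed_eq (by fun_prop) continuous_const
    · refine (Metric.isBounded_iff_subset_closedBall 0).2 ⟨1, fun x hx => ?_⟩
      have hx : ‖x.1‖ ^ 2 + ‖x.2‖ ^ 2 = 1 := hx
      rw [mem_closedBall_zero_iff, Prod.norm_def]
      refine max_le ?_ ?_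
      · nlinarith [norm_nonneg x.1, norm_nonneg x.2]
      · nlinarith [norm_nonneg x.1, norm_nonneg x.2]
  have hSn : S.Nonempty := by
    obtain ⟨v, hv⟩ := exists_norm_eq V (zero_le_one (α := ℝ))
    exact ⟨(v, 0), by simp [hS, hv]⟩
  obtain ⟨x₀, hx₀, hmin⟩ := hSc.exists_isMinOn hSn hHc.continuousOn
  obtain ⟨x₁, hx₁, hmax⟩ := hSc.exists_isMaxOn hSn hHc.continuousOn
  have hx₀0 : x₀ ≠ 0 := by
    rintro rfl; simp [hS] at hx₀
  refine ⟨H x₀, hpos _ hx₀0, H x₁, fun x => ?_⟩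
  by_cases hx : x = 0
  · have : H 0 = 0 := by simpa using hH2 0 0
    simp [hx, this]
  set s := ‖x.1‖ ^ 2 + ‖x.2‖ ^ 2 with hs
  have hs0 : 0 < s := by
    refine lt_of_le_of_ne (by positivity) fun h => hx ?_
    have h1 : ‖x.1‖ ^ 2 = 0 := by nlinarith [sq_nonneg ‖x.1‖, sq_nonneg ‖x.2‖]
    have h2 : ‖x.2‖ ^ 2 = 0 := by nlinarith [sq_nonneg ‖x.1‖, sq_nonneg ‖x.2‖]
    exact Prod.ext (by simpa using h1) (by simpa using h2)
  have hy : (Real.sqrt s)⁻¹ • x ∈ S := by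
    simp only [hS, mem_ofPred_eq, Prod.smul_fst, Prod.smul_snd, norm_smul, mul_pow,
      ← mul_add, ← hs, norm_inv, Real.norm_eq_abs, inv_pow, sq_abs, Real.sq_sqrt hs0.le]
    exact inv_mul_cancel₀ hs0.ne'
  have e : H ((Real.sqrt s)⁻¹ • x) = s⁻¹ * H x := by
    rw [hH2, inv_pow, Real.sq_sqrt hs0.le]
  have h1 : H x₀ ≤ s⁻¹ * H x := e ▸ hmin hy
  have h2 : s⁻¹ * H x ≤ H x₁ := e ▸ hmax hy
  rw [inv_mul_eq_div] at h1 h2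
  exact ⟨(le_div_iff₀ hs0).1 h1, (div_le_iff₀ hs0).1 h2⟩

lemma grad_homogeneous (hH : ContDiff ℝ 1 H)
    (hPQ : ∀ x v, fderiv ℝ H x v = inner ℝ (P x) v.1 + inner ℝ (Q x) v.2)
    (hH2 : ∀ (r : ℝ) x, H (r • x) = r ^ 2 * H x) {r : ℝ} (hr : r ≠ 0) (x : V × V) :
    P (r • x) = r • P x ∧ Q (r • x) = r • Q x := by
  have h1 : HasFDerivAt (fun x => H (r • x)) (r • fderiv ℝ H (r • x)) x := by
    have := (hH.differentiable one_ne_zero (r • x)).hasFDerivAt.comp x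
      ((hasFDerivAt_id (𝕜 := ℝ) x).const_smul r)
    refine this.congr_fderiv ?_
    ext v <;> simp
  have h2 : HasFDerivAt (fun x => H (r • x)) (r ^ 2 • fderiv ℝ H x) x := by
    rw [show (fun x => H (r • x)) = fun x => r ^ 2 * H x from funext fun x => hH2 r x]
    exact (hH.differentiable one_ne_zero x).hasFDerivAt.const_mul _
  have h3 : ∀ v, fderiv ℝ H (r • x) v = r * fderiv ℝ H x v := by
    intro v
    have := congrArg (fun L => L v) (h1.unique h2)
    simp only [smul_apply, smul_eq_mul] at this
    have h4 : r * (fderiv ℝ H (r • x) v - r * fderiv ℝ H x v) = 0 := by linear_combination this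
    rcases mul_eq_zero.1 h4 with h | h
    · exact absurd h hr
    · linarith
  constructor
  · refine ext_inner_right ℝ fun u => ?_
    have := h3 (u, 0)
    simpa [hPQ, inner_smul_left] using this
  · refine ext_inner_right ℝ fun u => ?_
    have := h3 (0, u)
    simpa [hPQ, inner_smul_left] using this

/-- Normalised discrete chords. -/
lemma exists_normalized_discrete_chord [FiniteDimensional ℝ V] [Nontrivial V]
    (hH : ContDiff ℝ 1 H)
    (hPQ : ∀ x v, fderiv ℝ H x v = inner ℝ (P x) v.1 + inner ℝ (Q x) v.2)
    (hH2 : ∀ (r : ℝ) x, H (r • x) = r ^ 2 * H x) (hpos : ∀ x ≠ 0, 0 < H x) {T₀ : ℝ}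
    (hT₀ : 0 ≤ T₀) : ∃ T₁, ∀ n : ℕ, ∃ M ≥ n, 0 < M ∧ ∃ T ∈ Icc T₀ T₁, ∃ x : ℕ → V × V,
      (x 0).1 = 0 ∧ ‖(x M).1‖ ≤ T / (M + 1 : ℕ) * ‖Q (x M)‖ ∧
      (∀ j < M, x (j + 1) - x j = (T / (M + 1 : ℕ)) • (Q (x j), -P (x (j + 1)))) ∧
      (∀ j ≤ M, ‖x j‖ ≤ 1) ∧ ∃ j ≤ M, ‖x j‖ = 1 := by
  obtain ⟨ε, hε, C, hEC⟩ := quadratic_bounds hH.continuous hH2 hpos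
  obtain ⟨k, hk⟩ := exists_nat_ge (2 * T₀ * C)
  refine ⟨max T₀ (3 * (k + 1) / ε), fun n => ?_⟩
  have hM : ((k + 1) * (n + 2) - 1) + 1 = (k + 1) * (n + 2) := by
    have : 0 < (k + 1) * (n + 2) := by positivity
    omega
  have hMn : n + 2 ≤ (k + 1) * (n + 2) := Nat.le_mul_of_pos_left _ (by omega)
  set M := (k + 1) * (n + 2) - 1 with hMdef
  obtain ⟨T, hT, z, w, hz0, hzM, hz, hw, j₀, hj₀, hne⟩ := exists_discrete_chord hH hPQ hH2 hε
    (fun x => (hEC x).1) (fun x => (hEC x).2) hT₀ k (by linarith) (le_max_right _ _)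
    (le_max_left _ _) (n + 2) (by omega) M hM
  refine ⟨M, by omega, by omega, T, hT, ?_⟩
  obtain ⟨i, hi, himax⟩ := Finset.exists_max_image (Finset.range (M + 1))
    (fun j => ‖(z j, w j)‖) ⟨0, by simp⟩
  set m := ‖(z i, w i)‖ with hm
  have hm0 : 0 < m := (norm_pos_iff.2 hne).trans_le (himax j₀ (Finset.mem_range.2 hj₀))
  have hQm : ∀ y, Q (m⁻¹ • y) = m⁻¹ • Q y :=
    fun y => (grad_homogeneous hH hPQ hH2 (inv_ne_zero hm0.ne') y).2
  have hPm : ∀ y, P (m⁻¹ • y) = m⁻¹ • P y :=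
    fun y => (grad_homogeneous hH hPQ hH2 (inv_ne_zero hm0.ne') y).1
  refine ⟨fun j => m⁻¹ • (z j, w j), by simp [hz0], ?_, ?_, ?_, i, ?_, ?_⟩
  · have h := hz M (by omega)
    rw [hzM, zero_sub] at h
    have h2 : ‖z M‖ = ‖(T / (M + 1 : ℕ)) • Q (z M, w M)‖ := by rw [← h, norm_neg]
    have hT0 : 0 ≤ T := hT₀.trans hT.1
    rw [norm_smul, Real.norm_of_nonneg (by positivity)] at h2
    rw [hQm, Prod.smul_fst, norm_smul, norm_smul, h2]
    apply le_of_eq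
    ring
  · intro j hj
    rw [hQm, hPm, ← smul_neg, ← Prod.smul_mk, smul_comm, ← smul_sub]
    congr 1
    rw [Prod.mk_sub_mk, hz j (by omega), hw j hj, Prod.smul_mk, smul_neg]
  · intro j hj
    rw [norm_smul, norm_inv, norm_norm, inv_mul_le_iff₀ hm0, mul_one]
    exact himax j (Finset.mem_range.2 (by omega))
  · have := Finset.mem_range.1 hi; omega
  · rw [norm_smul, norm_inv, norm_norm, ← hm, inv_mul_cancel₀ hm0.ne']

end LongChord

section LongChordLimit

variable {V : Type*} [NormedAddCommGroup V] [InnerProductSpace ℝ V]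
variable {H : V × V → ℝ} {P Q : V × V → V}

lemma IsCompact.exists_tendsto_ultrafilter {X ι : Type*} [TopologicalSpace X] {C : Set X}
    (hC : IsCompact C) (𝒰 : Ultrafilter ι) {u : ι → X} (hu : ∀ n, u n ∈ C) :
    ∃ y ∈ C, Tendsto u 𝒰 (𝓝 y) := by
  obtain ⟨y, hy, h⟩ := hC.ultrafilter_le_nhds (𝒰.map u)
    (by
      rw [le_principal_iff, Ultrafilter.coe_map, mem_map]
      exact Eventually.of_forall hu)
  exact ⟨y, hy, h⟩

/-- An ultrafilter limit of normalized discrete chords whose meshes tend to zero is a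
chord of the limiting Hamiltonian system. -/
lemma exists_limit_chord [FiniteDimensional ℝ V] (hP : Continuous P) (hQ : Continuous Q)
    {T₀ T₁ : ℝ} (hT₀ : 0 ≤ T₀) {M : ℕ → ℕ} (hM : ∀ n, n ≤ M n) (hM0 : ∀ n, 0 < M n)
    {T : ℕ → ℝ} (hT : ∀ n, T n ∈ Icc T₀ T₁) {x : ℕ → ℕ → V × V}
    (hx0 : ∀ n, (x n 0).1 = 0)
    (hxM : ∀ n, ‖(x n (M n)).1‖ ≤ T n / (M n + 1 : ℕ) * ‖Q (x n (M n))‖)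
    (hx : ∀ n, ∀ j < M n, x n (j + 1) - x n j =
      (T n / (M n + 1 : ℕ)) • (Q (x n j), -P (x n (j + 1))))
    (hb : ∀ n, ∀ j ≤ M n, ‖x n j‖ ≤ 1) (hne : ∀ n, ∃ j ≤ M n, ‖x n j‖ = 1) :
    ∃ S ≥ T₀, ∃ f : ℝ → V × V,
      (∀ s ∈ Icc (0 : ℝ) 1, HasDerivWithinAt f (S • (Q (f s), -P (f s))) (Icc 0 1) s) ∧
      (f 0).1 = 0 ∧ (f 1).1 = 0 ∧ ∃ s ∈ Icc (0 : ℝ) 1, f s ≠ 0 := by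
  have : ProperSpace V := FiniteDimensional.proper_real V
  have hcpt : IsCompact (Metric.closedBall (0 : V × V) 1) := isCompact_closedBall _ _
  obtain ⟨KQ, hKQ⟩ := hcpt.exists_bound_of_continuousOn hQ.continuousOn
  obtain ⟨KP, hKP⟩ := hcpt.exists_bound_of_continuousOn hP.continuousOn
  set K := max 0 (max KQ KP) with hKdef
  have hK0 : 0 ≤ K := le_max_left _ _
  have hKQ' : ∀ y : V × V, ‖y‖ ≤ 1 → ‖Q y‖ ≤ K := fun y hy =>
    (hKQ y (by simpa using hy)).trans ((le_max_left _ _).trans (le_max_right _ _))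
  have hKP' : ∀ y : V × V, ‖y‖ ≤ 1 → ‖P y‖ ≤ K := fun y hy =>
    (hKP y (by simpa using hy)).trans ((le_max_right _ _).trans (le_max_right _ _))
  set 𝒰 : Ultrafilter ℕ := hyperfilter ℕ with h𝒰
  have h𝒰top : (𝒰 : Filter ℕ) ≤ atTop := Nat.hyperfilter_le_atTop
  have hMtop : Tendsto M 𝒰 atTop :=
    (tendsto_atTop_mono hM tendsto_id).mono_left h𝒰top
  have hMR : Tendsto (fun n => (M n : ℝ)) 𝒰 atTop := tendsto_natCast_atTop_atTop.comp hMtop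
  obtain ⟨S, hS, hTS⟩ := isCompact_Icc.exists_tendsto_ultrafilter 𝒰 hT
  set τ : ℕ → ℝ := fun n => T n / (M n + 1 : ℕ) with hτ
  have hT0 : ∀ n, 0 ≤ T n := fun n => hT₀.trans (hT n).1
  have hτ0 : ∀ n, 0 ≤ τ n := fun n => div_nonneg (hT0 n) (by positivity)
  have hMτ : Tendsto (fun n => (M n : ℝ) * τ n) 𝒰 (𝓝 S) := by
    have h1 : Tendsto (fun n => T n * ((M n : ℝ) / (M n + 1))) 𝒰 (𝓝 (S * 1)) := by
      refine hTS.mul ?_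
      exact (tendsto_natCast_div_add_atTop (𝕜 := ℝ) 1).comp hMtop
    rw [mul_one] at h1
    refine h1.congr fun n => ?_
    simp only [hτ]; push_cast; ring
  have hτlim : Tendsto τ 𝒰 (𝓝 0) := by
    have := hMτ.mul (tendsto_inv_atTop_zero.comp hMR)
    rw [mul_zero] at this
    refine this.congr fun n => ?_
    have : (M n : ℝ) ≠ 0 := by exact_mod_cast (hM0 n).ne'
    simp only [Function.comp_apply]; field_simp
  set ι : ℝ → ℕ → ℕ := fun s n => ⌊s * M n⌋₊ with hι
  have hιle : ∀ s ∈ Icc (0 : ℝ) 1, ∀ n, ι s n ≤ M n := by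
    intro s hs n
    refine Nat.floor_le_of_le ?_
    exact mul_le_of_le_one_left (by positivity) hs.2
  have hιmono : ∀ {s t : ℝ}, s ≤ t → ∀ n, ι s n ≤ ι t n := by
    intro s t hst n
    exact Nat.floor_le_floor (by gcongr)
  have hιτ : ∀ s ∈ Icc (0 : ℝ) 1, Tendsto (fun n => (ι s n : ℝ) * τ n) 𝒰 (𝓝 (s * S)) := by
    intro s hs
    have h1 : Tendsto (fun n => (ι s n : ℝ) / M n) 𝒰 (𝓝 s) :=
      (tendsto_nat_floor_mul_div_atTop hs.1).comp hMR
    refine (h1.mul hMτ).congr fun n => ?_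
    have : (M n : ℝ) ≠ 0 := by exact_mod_cast (hM0 n).ne'
    field_simp
  have hfex : ∀ s : ℝ, ∃ y : V × V, s ∈ Icc (0 : ℝ) 1 →
      ‖y‖ ≤ 1 ∧ Tendsto (fun n => x n (ι s n)) 𝒰 (𝓝 y) := by
    intro s
    by_cases hs : s ∈ Icc (0 : ℝ) 1
    · obtain ⟨y, hy, h⟩ := hcpt.exists_tendsto_ultrafilter 𝒰
        (u := fun n => x n (ι s n)) (fun n => by simpa using hb n _ (hιle s hs n))
      exact ⟨y, fun _ => ⟨by simpa using hy, h⟩⟩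
    · exact ⟨0, fun h => absurd h hs⟩
  choose f hf using hfex
  have hstep : ∀ n, ∀ j < M n, ‖x n (j + 1) - x n j‖ ≤ τ n * K := by
    intro n j hj
    rw [hx n j hj, norm_smul, Real.norm_of_nonneg (hτ0 n)]
    refine mul_le_mul_of_nonneg_left ?_ (hτ0 n)
    rw [Prod.norm_def]
    exact max_le (hKQ' _ (hb n _ hj.le)) (by simpa using hKP' _ (hb n _ hj))
  have hunif : ∀ ε > 0, ∃ δ > 0, ∀ y y' : V × V, ‖y‖ ≤ 1 → ‖y'‖ ≤ 1 → ‖y - y'‖ ≤ δ →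
      ‖Q y - Q y'‖ ≤ ε ∧ ‖P y - P y'‖ ≤ ε := by
    intro ε hε
    obtain ⟨δ₁, hδ₁, h1⟩ := Metric.uniformContinuousOn_iff.1
      (hcpt.uniformContinuousOn_of_continuous hQ.continuousOn) ε hε
    obtain ⟨δ₂, hδ₂, h2⟩ := Metric.uniformContinuousOn_iff.1
      (hcpt.uniformContinuousOn_of_continuous hP.continuousOn) ε hε
    refine ⟨min δ₁ δ₂ / 2, by positivity, fun y y' hy hy' hyy => ?_⟩
    have hlt : min δ₁ δ₂ / 2 < min δ₁ δ₂ := half_lt_self (by positivity)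
    have h3 := h1 y (by simpa using hy) y' (by simpa using hy')
      (by rw [dist_eq_norm]; exact (hyy.trans_lt hlt).trans_le (min_le_left _ _))
    have h4 := h2 y (by simpa using hy) y' (by simpa using hy')
      (by rw [dist_eq_norm]; exact (hyy.trans_lt hlt).trans_le (min_le_right _ _))
    rw [dist_eq_norm] at h3 h4
    exact ⟨h3.le, h4.le⟩
  have hX : Continuous fun y : V × V => (Q y, -P y) := hQ.prodMk hP.neg
  have hdrift : ∀ ε > 0, ∃ δ > 0, ∀ s ∈ Icc (0 : ℝ) 1, ∀ t ∈ Icc (0 : ℝ) 1,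
      ∀ r ∈ Icc (0 : ℝ) 1, s ≤ r → r ≤ t → (t - s) * (S * K) < δ →
      ‖f t - f s - ((t - s) * S) • (Q (f r), -P (f r))‖ ≤ (t - s) * (S * ε) := by
    intro ε hε
    obtain ⟨δ, hδ, hu⟩ := hunif ε hε
    refine ⟨δ, hδ, fun s hs t ht r hr hsr hrt hlt => ?_⟩
    have hdiff : Tendsto (fun n => ((ι t n : ℝ) - ι s n) * τ n) 𝒰 (𝓝 ((t - s) * S)) := by
      simpa only [sub_mul] using (hιτ t ht).sub (hιτ s hs)
    have hl := (((hf t ht).2.sub (hf s hs).2).sub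
      (hdiff.smul ((hX.tendsto _).comp (hf r hr).2))).norm
    have hrr : Tendsto (fun n => ((ι t n : ℝ) - ι s n) * (τ n * ε)) 𝒰
        (𝓝 ((t - s) * (S * ε))) := by
      simpa only [mul_assoc] using hdiff.mul_const ε
    have hev : ∀ᶠ n in (𝒰 : Filter ℕ), ((ι t n : ℝ) - ι s n) * (τ n * K) < δ := by
      have : Tendsto (fun n => ((ι t n : ℝ) - ι s n) * (τ n * K)) 𝒰
          (𝓝 ((t - s) * (S * K))) := by
        simpa only [mul_assoc] using hdiff.mul_const K
      exact this.eventually_lt_const hlt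
    refine le_of_tendsto_of_tendsto hl hrr ?_
    filter_upwards [hev] with n hn
    exact discrete_drift (hτ0 n) (hx n) (hb n) (hstep n) hu hK0 (hιmono hsr n)
      (hιmono hrt n) (hιle t ht n) hn.le
  have hS0 : 0 ≤ S := hT₀.trans hS.1
  refine ⟨S, hS.1, f, ?_, ?_, ?_, ?_⟩
  · intro s hs
    rw [hasDerivWithinAt_iff_isLittleO, Asymptotics.isLittleO_iff]
    intro c hc
    obtain ⟨δ, hδ, h⟩ := hdrift (c / (S + 1)) (by positivity)
    have hnb : ∀ᶠ t in 𝓝[Icc 0 1] s, |t - s| * (S * K) < δ := by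
      refine (Tendsto.mono_left ?_ nhdsWithin_le_nhds).eventually_lt_const hδ
      have : Continuous fun t : ℝ => |t - s| * (S * K) := by fun_prop
      simpa using this.tendsto s
    have hle : ∀ a : ℝ, 0 ≤ a → a * (S * (c / (S + 1))) ≤ c * a := by
      intro a ha
      have : S / (S + 1) ≤ 1 := (div_le_one (by positivity)).2 (by linarith)
      calc a * (S * (c / (S + 1))) = c * a * (S / (S + 1)) := by ring
        _ ≤ c * a * 1 := by gcongr
        _ = _ := by ring
    filter_upwards [hnb, self_mem_nhdsWithin] with t ht htI
    rcases le_total s t with hst | hst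
    · have h1 := h s hs t htI s hs le_rfl hst (by rwa [abs_of_nonneg (by linarith)] at ht)
      rw [smul_smul, Real.norm_of_nonneg (by linarith)]
      exact h1.trans (hle _ (by linarith))
    · have h1 := h t htI s hs s hs hst le_rfl
        (by rwa [abs_of_nonpos (by linarith), neg_sub] at ht)
      rw [smul_smul, Real.norm_of_nonpos (by linarith), neg_sub, ← norm_neg]
      refine le_trans (le_of_eq ?_) (h1.trans (hle _ (by linarith)))
      congr 1
      rw [show (t - s) * S = -((s - t) * S) by ring, neg_smul]
      abel
  · have h0 := (hf 0 (by simp)).2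
    have h1 : Tendsto (fun n => (x n (ι 0 n)).1) 𝒰 (𝓝 (f 0).1) :=
      (continuous_fst.tendsto _).comp h0
    have h2 : (fun n => (x n (ι 0 n)).1) = fun _ => 0 := by
      funext n; simp [hι, hx0]
    rw [h2] at h1
    exact tendsto_nhds_unique h1 tendsto_const_nhds
  · have h0 := (hf 1 (by simp)).2
    have h1 : Tendsto (fun n => (x n (ι 1 n)).1) 𝒰 (𝓝 (f 1).1) :=
      (continuous_fst.tendsto _).comp h0
    refine tendsto_nhds_unique h1 ?_
    have h3 : Tendsto (fun n => τ n * K) 𝒰 (𝓝 0) := by simpa using hτlim.mul_const K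
    refine squeeze_zero_norm (fun n => ?_) h3
    have : ι 1 n = M n := by simp [hι]
    rw [this]
    exact (hxM n).trans (mul_le_mul_of_nonneg_left (hKQ' _ (hb n _ le_rfl)) (hτ0 n))
  · choose j hj hj1 using hne
    obtain ⟨s, hs, hlim⟩ := (isCompact_Icc (a := (0 : ℝ)) (b := 1)).exists_tendsto_ultrafilter 𝒰
      (u := fun n => (j n : ℝ) / M n) (fun n => by
        have : (0 : ℝ) < M n := by exact_mod_cast hM0 n
        exact ⟨by positivity, (div_le_one this).2 (by exact_mod_cast hj n)⟩)
    refine ⟨s, hs, fun h0 => ?_⟩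
    have hjτ : Tendsto (fun n => (j n : ℝ) * τ n) 𝒰 (𝓝 (s * S)) := by
      refine (hlim.mul hMτ).congr fun n => ?_
      have : (M n : ℝ) ≠ 0 := by exact_mod_cast (hM0 n).ne'
      field_simp
    have hd : Tendsto (fun n => |(j n : ℝ) * τ n - ι s n * τ n| * K) 𝒰 (𝓝 0) := by
      simpa using ((hjτ.sub (hιτ s hs)).abs).mul_const K
    have hxs : Tendsto (fun n => ‖x n (ι s n)‖) 𝒰 (𝓝 0) := by
      have := (hf s hs).2.norm
      rwa [h0, norm_zero] at this
    have hsum := hd.add hxs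
    rw [add_zero] at hsum
    have : (1 : ℝ) ≤ 0 := by
      refine ge_of_tendsto hsum (Eventually.of_forall fun n => ?_)
      have hdist : ‖x n (j n) - x n (ι s n)‖ ≤ |(j n : ℝ) * τ n - ι s n * τ n| * K := by
        rw [← sub_mul, abs_mul, abs_of_nonneg (hτ0 n), mul_assoc]
        rcases le_total (ι s n) (j n) with h | h
        · rw [abs_of_nonneg (by simpa using h)]
          exact norm_sub_le_of_steps (hstep n) h (hj n)
        · rw [abs_of_nonpos (by simpa using h), neg_sub, norm_sub_rev]
          exact norm_sub_le_of_steps (hstep n) h (hιle s hs n)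
      have h2 := norm_sub_norm_le (x n (j n)) (x n (ι s n))
      rw [hj1 n] at h2
      linarith
    linarith

/-- A positive, even-homogeneous Hamiltonian of degree two admits arbitrarily long chords
from the subspace `q = 0` to itself on the energy surface `H = 1`. -/
theorem exists_long_chord [FiniteDimensional ℝ V] [Nontrivial V] (hH : ContDiff ℝ 1 H)
    (hP : Continuous P) (hQ : Continuous Q)
    (hPQ : ∀ x v, fderiv ℝ H x v = inner ℝ (P x) v.1 + inner ℝ (Q x) v.2)
    (hH2 : ∀ (r : ℝ) x, H (r • x) = r ^ 2 * H x) (hpos : ∀ x ≠ 0, 0 < H x) {T₀ : ℝ}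
    (hT₀ : 0 ≤ T₀) : ∃ T ≥ T₀, ∃ f : ℝ → V × V,
      (∀ s ∈ Icc (0 : ℝ) 1, HasDerivWithinAt f (T • (Q (f s), -P (f s))) (Icc 0 1) s) ∧
      (f 0).1 = 0 ∧ (f 1).1 = 0 ∧ ∀ s ∈ Icc (0 : ℝ) 1, H (f s) = 1 := by
  obtain ⟨T₁, h⟩ := exists_normalized_discrete_chord hH hPQ hH2 hpos hT₀
  choose M hM hM0 T hT x hx0 hxM hx hb hne using h
  obtain ⟨S, hS, f, hf, hf0, hf1, s₀, hs₀, hfs⟩ :=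
    exists_limit_chord hP hQ hT₀ hM hM0 hT hx0 hxM hx hb hne
  have hder : ∀ s ∈ Icc (0 : ℝ) 1, HasDerivWithinAt (fun s => H (f s)) 0 (Icc 0 1) s := by
    intro s hs
    have h1 := ((hH.differentiable (by norm_num)) (f s)).hasFDerivAt.comp_hasDerivWithinAt s
      (hf s hs)
    refine h1.congr_deriv ?_
    rw [hPQ]
    simp only [Prod.smul_fst, Prod.smul_snd, inner_smul_right, inner_neg_right]
    rw [real_inner_comm (P (f s))]
    ring
  have hconst : ∀ s ∈ Icc (0 : ℝ) 1, H (f s) = H (f s₀) := by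
    intro s hs
    have := (convex_Icc (0 : ℝ) 1).norm_image_sub_le_of_norm_hasDerivWithin_le (C := 0)
      hder (fun _ _ => by simp) hs₀ hs
    rw [zero_mul] at this
    exact sub_eq_zero.1 (norm_le_zero_iff.1 this)
  have hE := hpos _ hfs
  set r := (Real.sqrt (H (f s₀)))⁻¹ with hr
  have hr0 : r ≠ 0 := by positivity
  have hg : ∀ y, P (r • y) = r • P y ∧ Q (r • y) = r • Q y := fun y =>
    grad_homogeneous hH hPQ hH2 hr0 y
  refine ⟨S, hS, fun s => r • f s, fun s hs => ?_, by simp [hf0], by simp [hf1], fun s hs => ?_⟩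
  · refine ((hf s hs).const_smul r).congr_deriv ?_
    rw [(hg _).1, (hg _).2, smul_comm r S]
    congr 1
    ext <;> simp
  · rw [hH2, hconst s hs, hr, inv_pow, Real.sq_sqrt hE.le, inv_mul_cancel₀ hE.ne']

end LongChordLimit

section GaugeHamiltonian

variable {E : Type*} [NormedAddCommGroup E] [NormedSpace ℝ E]

/-- A function homogeneous of degree two and `C¹` away from the origin is `C¹`. -/
lemma contDiff_one_of_homogeneous [FiniteDimensional ℝ E] {H : E → ℝ}
    (hH : ∀ x ≠ 0, ContDiffAt ℝ 1 H x) (hH2 : ∀ (r : ℝ) x, H (r • x) = r ^ 2 * H x) :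
    ContDiff ℝ 1 H := by
  have : ProperSpace E := FiniteDimensional.proper_real E
  have hH0 : H 0 = 0 := by simpa using hH2 0 0
  have hS : IsCompact (Metric.sphere (0 : E) 1) := isCompact_sphere _ _
  have hS0 : ∀ x ∈ Metric.sphere (0 : E) 1, x ≠ 0 := by
    rintro x hx rfl; simp at hx
  obtain ⟨C, hC⟩ := hS.exists_bound_of_continuousOn
    (f := H) fun x hx => (hH x (hS0 x hx)).continuousAt.continuousWithinAt
  have hcd : ∀ x ≠ 0, ContinuousAt (fderiv ℝ H) x := fun x hx =>
    (hH x hx).continuousAt_fderiv one_ne_zero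
  obtain ⟨D, hD⟩ := hS.exists_bound_of_continuousOn
    (f := fderiv ℝ H) fun x hx => (hcd x (hS0 x hx)).continuousWithinAt
  have hunit : ∀ x : E, x ≠ 0 → ‖x‖⁻¹ • x ∈ Metric.sphere (0 : E) 1 := by
    intro x hx
    simp [norm_smul, norm_ne_zero_iff.2 hx]
  have hbound : ∀ x, ‖H x‖ ≤ C * ‖x‖ ^ 2 := by
    intro x
    by_cases hx : x = 0
    · simp [hx, hH0]
    · have h1 := hC _ (hunit x hx)
      have hn : 0 < ‖x‖ := norm_pos_iff.2 hx
      rw [hH2, norm_mul, Real.norm_of_nonneg (by positivity : (0 : ℝ) ≤ ‖x‖⁻¹ ^ 2)] at h1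
      calc ‖H x‖ = (‖x‖⁻¹ ^ 2 * ‖H x‖) * ‖x‖ ^ 2 := by field_simp
        _ ≤ _ := by gcongr
  have h0 : HasFDerivAt H (0 : E →L[ℝ] ℝ) 0 := by
    rw [hasFDerivAt_iff_isLittleO_nhds_zero]
    simp only [zero_add, hH0, sub_zero, _root_.zero_apply]
    refine (Asymptotics.IsBigO.of_bound C (Eventually.of_forall fun x => ?_) :
      H =O[𝓝 0] fun x => ‖x‖ ^ 2).trans_isLittleO ?_
    · simpa using hbound x
    · exact Asymptotics.isLittleO_norm_pow_id one_lt_two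
  have hdiff : Differentiable ℝ H := by
    intro x
    by_cases hx : x = 0
    · exact hx ▸ h0.differentiableAt
    · exact (hH x hx).differentiableAt one_ne_zero
  have hd0 : fderiv ℝ H 0 = 0 := h0.fderiv
  have hdsmul : ∀ r : ℝ, r ≠ 0 → ∀ x, fderiv ℝ H (r • x) = r • fderiv ℝ H x := by
    intro r hr x
    have h1 : HasFDerivAt (fun x => H (r • x)) (r • fderiv ℝ H (r • x)) x := by
      have := (hdiff (r • x)).hasFDerivAt.comp x ((hasFDerivAt_id (𝕜 := ℝ) x).const_smul r)
      refine this.congr_fderiv ?_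
      ext v; simp
    have h2 : HasFDerivAt (fun x => H (r • x)) (r ^ 2 • fderiv ℝ H x) x := by
      simp only [hH2]
      exact (hdiff x).hasFDerivAt.const_smul (r ^ 2)
    have h3 := h1.unique h2
    rw [pow_two, mul_smul] at h3
    exact smul_right_injective _ hr h3
  have hdbound : ∀ x, ‖fderiv ℝ H x‖ ≤ D * ‖x‖ := by
    intro x
    by_cases hx : x = 0
    · simp [hx, hd0]
    · have h1 := hD _ (hunit x hx)
      have hn : 0 < ‖x‖ := norm_pos_iff.2 hx
      rw [hdsmul _ (by positivity), norm_smul, norm_inv, norm_norm] at h1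
      calc ‖fderiv ℝ H x‖ = (‖x‖⁻¹ * ‖fderiv ℝ H x‖) * ‖x‖ := by field_simp
        _ ≤ _ := by gcongr
  rw [contDiff_one_iff_fderiv]
  refine ⟨hdiff, continuous_iff_continuousAt.2 fun x => ?_⟩
  by_cases hx : x = 0
  · subst hx
    rw [ContinuousAt, hd0]
    refine squeeze_zero_norm hdbound ?_
    have : Continuous fun x : E => D * ‖x‖ := by fun_prop
    simpa using this.tendsto 0
  · exact hcd x hx

variable {K : E → ℝ} {Ω : Set E}

/-- Transversality to rays makes the zero of `K` on a ray unique. -/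
lemma eq_of_zeros_on_ray (hΩs : ∀ x ∈ Ω, ∀ t ∈ Icc (0 : ℝ) 1, t • x ∈ Ω)
    (hK : ∀ x ∈ Ω, ContDiffAt ℝ 1 K x) (hpos : ∀ x ∈ Ω, K x = 0 → 0 < fderiv ℝ K x x)
    {x : E} {a b : ℝ} (ha : 0 < a) (hab : a ≤ b) (hb : b • x ∈ Ω) (hKa : K (a • x) = 0)
    (hKb : K (b • x) = 0) : a = b := by
  by_contra hne
  have hlt : a < b := lt_of_le_of_ne hab hne
  have hmem : ∀ t ∈ Icc a b, t • x ∈ Ω := by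
    intro t ht
    have hb0 : 0 < b := ha.trans hlt
    have := hΩs _ hb (t / b) ⟨by have := ha.trans_le ht.1; positivity, (div_le_one hb0).2 ht.2⟩
    rwa [smul_smul, div_mul_cancel₀ _ hb0.ne'] at this
  have hder : ∀ t ∈ Icc a b, HasDerivAt (fun t : ℝ => K (t • x)) (fderiv ℝ K (t • x) x) t := by
    intro t ht
    have h1 := ((hK _ (hmem t ht)).differentiableAt one_ne_zero).hasFDerivAt.comp_hasDerivAt t
      ((hasDerivAt_id t).smul_const x)
    exact h1.congr_deriv (by simp)
  have hdp : ∀ t ∈ Icc a b, K (t • x) = 0 → 0 < fderiv ℝ K (t • x) x := by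
    intro t ht h0
    have ht0 : 0 < t := ha.trans_le ht.1
    have := hpos _ (hmem t ht) h0
    rw [map_smul, smul_eq_mul] at this
    exact pos_of_mul_pos_right this ht0.le
  have hle := image_le_of_deriv_right_lt_deriv_boundary' (f := fun t => -K (t • x))
    (f' := fun t => -fderiv ℝ K (t • x) x) (B := fun _ => 0) (B' := fun _ => 0) (a := a) (b := b)
    (fun t ht => (hder t ht).neg.continuousAt.continuousWithinAt)
    (fun t ht => (hder t (Ico_subset_Icc_self ht)).neg.hasDerivWithinAt) (by simp [hKa])
    continuousOn_const (fun t _ => hasDerivWithinAt_const _ _ _)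
    (fun t ht h => by
      have := hdp t (Ico_subset_Icc_self ht) (by simpa using h)
      simpa using this)
  have hbI : b ∈ Icc a b := ⟨hab, le_rfl⟩
  have hslope := (hasDerivAt_iff_tendsto_slope_left_right.1 (hder b hbI)).1
  have hev := (hslope.eventually_const_lt (hdp b hbI hKb)).and
    (Ioo_mem_nhdsLT hlt)
  obtain ⟨t, ht, htI⟩ := hev.exists
  have h1 := hle ⟨htI.1.le, htI.2.le⟩
  simp only [slope_def_field, hKb] at ht
  have h2 : t - b < 0 := by linarith [htI.2]
  have h3 : (K (t • x) - 0) / (t - b) ≤ 0 :=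
    div_nonpos_of_nonneg_of_nonpos (by simp at h1; linarith) h2.le
  linarith

lemma exists_zero_on_ray (hΩs : ∀ x ∈ Ω, ∀ t ∈ Icc (0 : ℝ) 1, t • x ∈ Ω)
    (hK : ∀ x ∈ Ω, ContDiffAt ℝ 1 K x) (h0 : K 0 < 0) {x : E} {r : ℝ} (hr : 0 < r)
    (hrx : r • x ∈ Ω) (hKr : 0 ≤ K (r • x)) : ∃ a > (0 : ℝ), a • x ∈ Ω ∧ K (a • x) = 0 := by
  have hmem : ∀ t ∈ Icc 0 r, t • x ∈ Ω := by
    intro t ht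
    have := hΩs _ hrx (t / r) ⟨div_nonneg ht.1 hr.le, (div_le_one hr).2 ht.2⟩
    rwa [smul_smul, div_mul_cancel₀ _ hr.ne'] at this
  have hc : ContinuousOn (fun t : ℝ => K (t • x)) (Icc 0 r) := by
    intro t ht
    refine (ContinuousAt.comp (f := fun t : ℝ => t • x) (hK _ (hmem t ht)).continuousAt
      ?_).continuousWithinAt
    fun_prop
  obtain ⟨a, ha, hKa⟩ := intermediate_value_Icc hr.le hc
    (show (0 : ℝ) ∈ Icc _ _ from ⟨by simpa using h0.le, hKr⟩)
  refine ⟨a, lt_of_le_of_ne ha.1 ?_, hmem a ha, hKa⟩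
  rintro rfl
  simp at hKa
  linarith

/-- An even function that is negative at the origin and transversal to rays on its zero set has
the same zero set, up to a positive factor in the differential, as a `C¹` function which is
homogeneous of degree two. -/
theorem exists_homogeneous_hamiltonian [FiniteDimensional ℝ E] (hΩ : IsOpen Ω)
    (hΩs : ∀ x ∈ Ω, ∀ t ∈ Icc (0 : ℝ) 1, t • x ∈ Ω) (hΩe : ∀ x ∈ Ω, -x ∈ Ω)
    (hK : ∀ x ∈ Ω, ContDiffAt ℝ 1 K x) (hKe : ∀ x, K (-x) = K x) (h0 : K 0 < 0)
    (hpos : ∀ x ∈ Ω, K x = 0 → 0 < fderiv ℝ K x x)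
    (hray : ∀ x ≠ 0, ∃ r > (0 : ℝ), r • x ∈ Ω ∧ 0 ≤ K (r • x)) :
    ∃ H : E → ℝ, ContDiff ℝ 1 H ∧ (∀ (r : ℝ) x, H (r • x) = r ^ 2 * H x) ∧
      (∀ x ≠ 0, 0 < H x) ∧ ∀ x, H x = 1 → x ∈ Ω ∧ K x = 0 ∧
        fderiv ℝ H x = (2 / fderiv ℝ K x x) • fderiv ℝ K x := by
  have hex : ∀ x : E, ∃ a : ℝ, x ≠ 0 → 0 < a ∧ a • x ∈ Ω ∧ K (a • x) = 0 := by
    intro x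
    by_cases hx : x = 0
    · exact ⟨0, fun h => absurd hx h⟩
    · obtain ⟨r, hr, hrx, hKr⟩ := hray x hx
      obtain ⟨a, ha, h1, h2⟩ := exists_zero_on_ray hΩs hK h0 hr hrx hKr
      exact ⟨a, fun _ => ⟨ha, h1, h2⟩⟩
  choose ρ hρ using hex
  have huniq : ∀ x ≠ 0, ∀ a > (0 : ℝ), a • x ∈ Ω → K (a • x) = 0 → ρ x = a := by
    intro x hx a ha h1 h2
    obtain ⟨hp, h3, h4⟩ := hρ x hx
    rcases le_total (ρ x) a with h | h
    · exact eq_of_zeros_on_ray hΩs hK hpos hp h h1 h4 h2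
    · exact (eq_of_zeros_on_ray hΩs hK hpos ha h h3 h2 h4).symm
  have hρsmul : ∀ r : ℝ, r ≠ 0 → ∀ x ≠ 0, ρ (r • x) = ρ x / |r| := by
    intro r hr x hx
    obtain ⟨hp, h3, h4⟩ := hρ x hx
    have hr' : 0 < |r| := abs_pos.2 hr
    have key : (ρ x / |r|) • r • x = ρ x • x ∨ (ρ x / |r|) • r • x = -(ρ x • x) := by
      rw [smul_smul]
      rcases abs_choice r with h | h
      · left; rw [h, div_mul_cancel₀ _ hr]
      · right; rw [h, div_neg, neg_mul, div_mul_cancel₀ _ hr, neg_smul]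
    refine huniq _ (smul_ne_zero hr hx) _ (by positivity) ?_ ?_
    · rcases key with h | h <;> rw [h]
      exacts [h3, hΩe _ h3]
    · rcases key with h | h <;> rw [h]
      exacts [h4, (hKe _).trans h4]
  have hρC : ∀ x ≠ 0, ContDiffAt ℝ 1 ρ x := by
    intro x hx
    obtain ⟨hp, h3, h4⟩ := hρ x hx
    set F : E × ℝ → ℝ := fun p => K (p.2 • p.1) with hF
    have hFd : ContDiffAt ℝ 1 F (x, ρ x) :=
      ContDiffAt.comp (x, ρ x) (f := fun p : E × ℝ => p.2 • p.1) (hK _ h3)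
        (contDiffAt_snd.smul contDiffAt_fst)
    have hval : (fderiv ℝ F (x, ρ x) ∘L .inr ℝ E ℝ) 1 = fderiv ℝ K (ρ x • x) x := by
      have h1 : HasDerivAt (fun t : ℝ => F (x, t)) (fderiv ℝ F (x, ρ x) (0, 1)) (ρ x) :=
        (hFd.differentiableAt one_ne_zero).hasFDerivAt.comp_hasDerivAt (ρ x)
          ((hasDerivAt_const _ x).prodMk (hasDerivAt_id _))
      have h2 : HasDerivAt (fun t : ℝ => F (x, t)) (fderiv ℝ K (ρ x • x) x) (ρ x) := by
        have := ((hK _ h3).differentiableAt one_ne_zero).hasFDerivAt.comp_hasDerivAt (ρ x)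
          ((hasDerivAt_id (ρ x)).smul_const x)
        exact this.congr_deriv (by simp)
      simpa using h1.unique h2
    have hd : fderiv ℝ K (ρ x • x) x ≠ 0 := by
      have := hpos _ h3 h4
      rw [map_smul, smul_eq_mul] at this
      exact (pos_of_mul_pos_right this hp.le).ne'
    have hinv : (fderiv ℝ F (x, ρ x) ∘L .inr ℝ E ℝ).IsInvertible :=
      ⟨ContinuousLinearEquiv.unitsEquivAut ℝ (Units.mk0 _ hd), by
        ext
        rw [hval]
        simp⟩
    have hC := hFd.contDiffAt_implicitFunction one_ne_zero hinv
    have hself := hFd.implicitFunction_apply_self one_ne_zero hinv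
    have hev := hFd.eventually_apply_implicitFunction one_ne_zero hinv
    set ψ := hFd.implicitFunction one_ne_zero hinv with hψ
    simp only at hC hself hev
    refine hC.congr_of_eventuallyEq ?_
    have hc := hC.continuousAt
    have e1 : ∀ᶠ y in 𝓝 x, 0 < ψ y := by
      refine hc.tendsto.eventually_const_lt ?_
      rw [hself]; exact hp
    have e2 : ∀ᶠ y in 𝓝 x, ψ y • y ∈ Ω := by
      have : ContinuousAt (fun y => ψ y • y) x := hc.smul continuousAt_id
      refine this.eventually_mem (hΩ.mem_nhds ?_)
      rw [hself]; exact h3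
    filter_upwards [e1, e2, hev, isOpen_ne.mem_nhds hx] with y h5 h6 h7 h8
    refine huniq y h8 _ h5 h6 ?_
    simpa [hF, h4] using h7
  set H : E → ℝ := fun x => open Classical in if x = 0 then 0 else (ρ x)⁻¹ ^ 2 with hHdef
  have hHx : ∀ x ≠ 0, H x = (ρ x)⁻¹ ^ 2 := fun x hx => by simp [hHdef, hx]
  have hHev : ∀ x ≠ 0, H =ᶠ[𝓝 x] fun x => (ρ x)⁻¹ ^ 2 := by
    intro x hx
    filter_upwards [isOpen_ne.mem_nhds hx] with y hy using hHx y hy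
  have hH2 : ∀ (r : ℝ) x, H (r • x) = r ^ 2 * H x := by
    intro r x
    by_cases hx : x = 0
    · simp [hHdef, hx]
    by_cases hr : r = 0
    · simp [hHdef, hr]
    rw [hHx _ hx, hHx _ (smul_ne_zero hr hx), hρsmul r hr x hx, inv_div, div_pow, sq_abs, inv_pow]
    ring
  refine ⟨H, contDiff_one_of_homogeneous (fun x hx => ?_) hH2, hH2, fun x hx => ?_,
    fun x hx1 => ?_⟩
  · refine ContDiffAt.congr_of_eventuallyEq ?_ (hHev x hx)
    exact ((hρC x hx).inv (hρ x hx).1.ne').pow 2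
  · rw [hHx x hx]
    have := (hρ x hx).1
    positivity
  · have hx : x ≠ 0 := by
      rintro rfl
      simp [hHdef] at hx1
    obtain ⟨hp, h3, h4⟩ := hρ x hx
    have hρ1 : ρ x = 1 := by
      rw [hHx x hx, inv_pow, inv_eq_one] at hx1
      nlinarith
    have h3' : x ∈ Ω := by simpa [hρ1] using h3
    have h4' : K x = 0 := by simpa [hρ1] using h4
    refine ⟨h3', h4', ?_⟩
    have hρd := ((hρC x hx).differentiableAt one_ne_zero).hasFDerivAt
    have hsm : HasFDerivAt (fun y => ρ y • y) _ x := hρd.smul (hasFDerivAt_id x)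
    have hKd : HasFDerivAt K (fderiv ℝ K x) (ρ x • x) := by
      rw [hρ1, one_smul]
      exact ((hK x h3').differentiableAt one_ne_zero).hasFDerivAt
    have hcomp := HasFDerivAt.comp (f := fun y => ρ y • y) x hKd hsm
    have hzero : HasFDerivAt (fun y => K (ρ y • y)) (0 : E →L[ℝ] ℝ) x := by
      refine (hasFDerivAt_const (0 : ℝ) x).congr_of_eventuallyEq ?_
      filter_upwards [isOpen_ne.mem_nhds hx] with y hy using (hρ y hy).2.2
    have heq := hcomp.unique hzero
    have hHd : HasFDerivAt H _ x :=
      ((((hasDerivAt_inv hp.ne').fun_pow 2)).comp_hasFDerivAt x hρd).congr_of_eventuallyEq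
        (hHev x hx)
    rw [hHd.fderiv]
    have hKx := hpos x h3' h4'
    ext v
    have h5 := DFunLike.congr_fun heq v
    simp [hρ1] at h5 ⊢
    field_simp
    linarith

end GaugeHamiltonian

section GaugeChord

variable {V : Type*} [NormedAddCommGroup V] [InnerProductSpace ℝ V]
variable {K : V × V → ℝ} {P Q : V × V → V} {Ω : Set (V × V)}

/-- Reparametrized Hamiltonian chords of arbitrarily large weight on the zero level of an even
Hamiltonian which is transversal to rays. -/
theorem exists_weighted_chord [FiniteDimensional ℝ V] [Nontrivial V] (hΩ : IsOpen Ω)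
    (hΩs : ∀ x ∈ Ω, ∀ t ∈ Icc (0 : ℝ) 1, t • x ∈ Ω) (hΩe : ∀ x ∈ Ω, -x ∈ Ω)
    (hK : ∀ x ∈ Ω, ContDiffAt ℝ 1 K x) (hKe : ∀ x, K (-x) = K x) (h0 : K 0 < 0)
    (hpos : ∀ x ∈ Ω, K x = 0 → 0 < fderiv ℝ K x x)
    (hray : ∀ x ≠ 0, ∃ r > (0 : ℝ), r • x ∈ Ω ∧ 0 ≤ K (r • x))
    (hPQ : ∀ x ∈ Ω, ∀ v, fderiv ℝ K x v = inner ℝ (P x) v.1 + inner ℝ (Q x) v.2)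
    {Θ : ℝ} (hΘ : 0 ≤ Θ) :
    ∃ (θ : ℝ → ℝ) (f : ℝ → V × V), ContinuousOn θ (Icc 0 1) ∧
      (∀ s ∈ Icc (0 : ℝ) 1, 0 < θ s ∧ Θ ≤ θ s) ∧
      (∀ s ∈ Icc (0 : ℝ) 1, f s ∈ Ω ∧ K (f s) = 0 ∧
        HasDerivWithinAt f (θ s • (Q (f s), -P (f s))) (Icc 0 1) s) ∧
      (f 0).1 = 0 ∧ (f 1).1 = 0 := by
  have : ProperSpace V := FiniteDimensional.proper_real V
  obtain ⟨H, hH, hH2, hHpos, hHK⟩ :=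
    exists_homogeneous_hamiltonian hΩ hΩs hΩe hK hKe h0 hpos hray
  obtain ⟨ε, hε, C, hεC⟩ := quadratic_bounds hH.continuous hH2 hHpos
  set S : Set (V × V) := {x | H x = 1} with hSdef
  have hSc : IsCompact S := by
    refine Metric.isCompact_of_isClosed_isBounded
      (isClosed_singleton.preimage hH.continuous) ?_
    refine (Metric.isBounded_closedBall (x := (0 : V × V)) (r := max 1 (1 / ε))).subset
      fun x hx => ?_
    have h1 := (hεC x).1
    rw [show H x = 1 from hx] at h1
    rw [mem_closedBall_zero_iff, le_max_iff]
    by_contra! h2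
    have hn : ‖x‖ ^ 2 ≤ ‖x.1‖ ^ 2 + ‖x.2‖ ^ 2 := by
      rw [Prod.norm_def]
      rcases max_choice ‖x.1‖ ‖x.2‖ with h | h <;> rw [h] <;>
        nlinarith [sq_nonneg ‖x.1‖, sq_nonneg ‖x.2‖]
    have h3 : 1 < ε * ‖x‖ := by
      have := h2.2
      rw [div_lt_iff₀ hε] at this
      linarith
    nlinarith [h2.1]
  have hκc : ContinuousOn (fun x => 2 / fderiv ℝ K x x) S := by
    intro x hx
    obtain ⟨h1, h2, -⟩ := hHK x hx
    have h3 : ContinuousAt (fun x => fderiv ℝ K x x) x :=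
      ((hK x h1).continuousAt_fderiv one_ne_zero).clm_apply continuousAt_id
    exact (continuousAt_const.div h3 (hpos x h1 h2).ne').continuousWithinAt
  obtain ⟨κ, hκ0, hκ⟩ : ∃ κ > 0, ∀ x ∈ S, κ ≤ 2 / fderiv ℝ K x x := by
    rcases S.eq_empty_or_nonempty with h | h
    · exact ⟨1, one_pos, by simp [h]⟩
    · obtain ⟨x, hx, hmin⟩ := hSc.exists_isMinOn h hκc
      refine ⟨_, ?_, fun y hy => hmin hy⟩
      have := hpos x (hHK x hx).1 (hHK x hx).2.1
      positivity
  set G : V × V → V × V := fun x =>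
    ((InnerProductSpace.toDual ℝ V).symm ((fderiv ℝ H x).comp (.inl ℝ V V)),
     (InnerProductSpace.toDual ℝ V).symm ((fderiv ℝ H x).comp (.inr ℝ V V))) with hG
  have hGc : Continuous G := by
    have h1 : Continuous (fderiv ℝ H) := hH.continuous_fderiv one_ne_zero
    refine Continuous.prodMk ?_ ?_
    · exact (LinearIsometryEquiv.continuous _).comp (h1.clm_comp continuous_const)
    · exact (LinearIsometryEquiv.continuous _).comp (h1.clm_comp continuous_const)
  have hGH : ∀ x v, fderiv ℝ H x v = inner ℝ (G x).1 v.1 + inner ℝ (G x).2 v.2 := by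
    intro x v
    simp only [hG, InnerProductSpace.toDual_symm_apply, ContinuousLinearMap.comp_apply,
      ← map_add]
    congr 1
    ext <;> simp
  have hGPQ : ∀ x ∈ S, G x = (2 / fderiv ℝ K x x) • (P x, Q x) := by
    intro x hx
    obtain ⟨h1, -, h3⟩ := hHK x hx
    refine Prod.ext ?_ ?_
    · refine ext_inner_right ℝ fun v => ?_
      have h4 := hGH x (v, 0)
      rw [h3, smul_apply, hPQ x h1 (v, 0)] at h4
      simpa [inner_smul_left] using h4.symm
    · refine ext_inner_right ℝ fun v => ?_
      have h4 := hGH x (0, v)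
      rw [h3, smul_apply, hPQ x h1 (0, v)] at h4
      simpa [inner_smul_left] using h4.symm
  obtain ⟨T, hT, f, hf, hf0, hf1, hfH⟩ := exists_long_chord hH (hGc.fst) (hGc.snd) hGH hH2 hHpos
    (T₀ := (Θ + 1) / κ) (by positivity)
  have hT0 : 0 < T := lt_of_lt_of_le (by positivity) hT
  have hfc : ContinuousOn f (Icc 0 1) := fun s hs => (hf s hs).continuousWithinAt
  refine ⟨fun s => T * (2 / fderiv ℝ K (f s) (f s)), f, ?_, fun s hs => ?_, fun s hs => ?_,
    hf0, hf1⟩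
  · exact continuousOn_const.mul (hκc.comp hfc fun s hs => hfH s hs)
  · have h1 := hκ _ (hfH s hs)
    have h2 : Θ + 1 ≤ T * κ := by rwa [ge_iff_le, div_le_iff₀ hκ0] at hT
    have h3 : T * κ ≤ T * (2 / fderiv ℝ K (f s) (f s)) := by gcongr
    exact ⟨by linarith, by linarith⟩
  · obtain ⟨h1, h2, -⟩ := hHK _ (hfH s hs)
    refine ⟨h1, h2, (hf s hs).congr_deriv ?_⟩
    rw [hGPQ _ (hfH s hs), mul_smul]
    congr 1
    ext <;> simp

end GaugeChord

section RadialEstimates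

lemma rho_bounds {R x ρ : ℝ} (hR : 0 < R) (hR1 : R < 1) (hx : x ∈ Icc (-1 : ℝ) 1) (hρ : 0 ≤ ρ)
    (hρ2 : ρ ^ 2 = R ^ 2 - 2 * x * R + 1) : 1 - R ≤ ρ ∧ ρ ≤ 1 + R := by
  constructor
  · refine abs_le_of_sq_le_sq' ?_ hρ |>.2
    nlinarith [hx.2]
  · refine abs_le_of_sq_le_sq' ?_ (by linarith) |>.2
    nlinarith [hx.1]

lemma radial_attraction_nonneg {R x ρ : ℝ} (hR : 0 < R) (hR1 : R < 1)
    (hx : x ∈ Icc (-1 : ℝ) 1) (hρ : 0 ≤ ρ) (hρ2 : ρ ^ 2 = R ^ 2 - 2 * x * R + 1) :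
    0 ≤ (R - x) / ρ ^ 3 + x - 1 + 1 / (1 - R) ^ 2 := by
  obtain ⟨h1, h2⟩ := rho_bounds hR hR1 hx hρ hρ2
  obtain ⟨u, rfl⟩ : ∃ u, R = 1 - u := ⟨1 - R, by ring⟩
  have hu0 : 0 < u := by linarith
  have hu1 : u < 1 := by linarith
  rw [sub_sub_cancel] at *
  have h2' : ρ ≤ 2 - u := by linarith
  have hρ0 : 0 < ρ := by linarith
  have e1 : 2 * u ^ 2 * ρ ^ 2 ≤ (2 - u) * ρ + u ^ 2 := by
    have hp : u * (2 - u) ≤ 1 := by nlinarith [sq_nonneg (u - 1)]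
    have hA : 2 * u ^ 2 * (2 - u) ^ 2 ≤ (2 - u) * (2 - u) + u ^ 2 := by
      have hp0 : 0 ≤ u * (2 - u) := by nlinarith
      nlinarith
    have hB : 2 * u ^ 2 * u ^ 2 ≤ (2 - u) * u + u ^ 2 := by
      have : u ^ 3 ≤ 1 := pow_le_one₀ hu0.le hu1.le
      nlinarith
    have hC : 0 ≤ u ^ 2 * ((ρ - u) * (2 - u - ρ)) := by
      have := mul_nonneg (sub_nonneg.2 h1) (sub_nonneg.2 h2')
      positivity
    rcases eq_or_lt_of_le (show u ≤ 2 - u by linarith) with h | h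
    · linarith
    · have hd : 0 < 2 - u - u := by linarith
      have h3 := mul_nonneg (sub_nonneg.2 h1) (sub_nonneg.2 hA)
      have h4 := mul_nonneg (sub_nonneg.2 h2') (sub_nonneg.2 hB)
      have h5 : 0 ≤ (2 - u - u) * ((2 - u) * ρ + u ^ 2 - 2 * u ^ 2 * ρ ^ 2) := by
        have := mul_nonneg hd.le hC
        nlinarith
      have := nonneg_of_mul_nonneg_right h5 hd
      linarith
  have hQ : 0 ≤ -u ^ 2 * ρ ^ 4 - u ^ 3 * ρ ^ 3 + (2 - 2 * u) * ρ ^ 2 + (2 * u - u ^ 2) * ρ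
      + 2 * u ^ 2 - u ^ 3 := by
    have a1 : u ^ 2 * ρ ^ 3 * (ρ + u) ≤ u ^ 2 * ρ ^ 3 * 2 := by
      gcongr; linarith
    have a2 : u * ρ * ρ ≤ u * ρ * (2 - u) := by gcongr
    have a3 : u ^ 2 * ρ ≤ u ^ 2 * (2 - u) := by gcongr
    have a4 := mul_le_mul_of_nonneg_left e1 hρ0.le
    nlinarith
  have hx' : x = ((1 - u) ^ 2 + 1 - ρ ^ 2) / (2 * (1 - u)) := by
    field_simp
    linarith
  have key : (1 - u - x) / ρ ^ 3 + x - 1 + 1 / u ^ 2 =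
      (ρ - u) * (-u ^ 2 * ρ ^ 4 - u ^ 3 * ρ ^ 3 + (2 - 2 * u) * ρ ^ 2 + (2 * u - u ^ 2) * ρ
      + 2 * u ^ 2 - u ^ 3) / (2 * (1 - u) * ρ ^ 3 * u ^ 2) := by
    rw [hx']
    have : (1 - u) ≠ 0 := by linarith
    field_simp
    ring
  rw [key]
  have := mul_nonneg (sub_nonneg.2 h1) hQ
  positivity

lemma tidal_bound {u ρ D : ℝ} (hu0 : 0 < u) (hu1 : u < 1) (huρ : u ≤ ρ)
    (hD : 2 * (1 - u) * D = ρ ^ 2 - 2 * u + u ^ 2) :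
    (ρ ^ 2 - 3 * D ^ 2) * (u ^ 3 * (3 - 3 * u + u ^ 2)) ≤ 2 * (1 + u + u ^ 2) * ρ ^ 5 := by
  have hρ0 : 0 < ρ := hu0.trans_le huρ
  have hw : 0 < 3 - 3 * u + u ^ 2 := by nlinarith [sq_nonneg u]
  have h5 : ρ ^ 2 * u ^ 3 ≤ ρ ^ 5 := by
    calc ρ ^ 2 * u ^ 3 ≤ ρ ^ 2 * ρ ^ 3 := by gcongr
      _ = ρ ^ 5 := by ring
  have hfirst : (ρ ^ 2 - 3 * D ^ 2) * (u ^ 3 * (3 - 3 * u + u ^ 2)) ≤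
      (ρ ^ 2 * u ^ 3) * (3 - 3 * u + u ^ 2) := by
    have : 0 ≤ 3 * D ^ 2 * (u ^ 3 * (3 - 3 * u + u ^ 2)) := by positivity
    nlinarith
  by_cases h : 1 ≤ u ^ 2 + 5 * u
  · refine hfirst.trans ?_
    calc (ρ ^ 2 * u ^ 3) * (3 - 3 * u + u ^ 2) ≤ ρ ^ 5 * (2 * (1 + u + u ^ 2)) := by
          gcongr
          nlinarith
      _ = _ := by ring
  push Not at h
  have hu2 : u < 1 / 5 := by nlinarith
  by_cases hρu : 23 / 20 * u ≤ ρ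
  · refine hfirst.trans ?_
    have h6 : (23 / 20 * u) ^ 3 ≤ ρ ^ 3 := by gcongr
    have h7 : ρ ^ 2 * u ^ 3 * 3 ≤ 2 * ρ ^ 5 := by
      have : ρ ^ 2 * (23 / 20 * u) ^ 3 ≤ ρ ^ 2 * ρ ^ 3 := by gcongr
      have h8 : 0 ≤ ρ ^ 2 * u ^ 3 := by positivity
      nlinarith
    calc (ρ ^ 2 * u ^ 3) * (3 - 3 * u + u ^ 2) ≤ (ρ ^ 2 * u ^ 3) * 3 := by
          gcongr; nlinarith
      _ ≤ 2 * ρ ^ 5 := h7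
      _ ≤ _ := by
        have : 0 ≤ (u + u ^ 2) * ρ ^ 5 := by positivity
        nlinarith
  · push Not at hρu
    have hρ2 : ρ ^ 2 ≤ (23 / 20 * u) ^ 2 := by gcongr
    have hDneg : 9 / 10 * u ≤ -D := by
      have : 2 * (1 - u) * (9 / 10 * u) ≤ 2 * (1 - u) * (-D) := by nlinarith
      exact le_of_mul_le_mul_left this (by linarith)
    have hD2 : (9 / 10 * u) ^ 2 ≤ (-D) ^ 2 := by gcongr
    have hneg : ρ ^ 2 - 3 * D ^ 2 ≤ 0 := by nlinarith
    have : (ρ ^ 2 - 3 * D ^ 2) * (u ^ 3 * (3 - 3 * u + u ^ 2)) ≤ 0 :=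
      mul_nonpos_of_nonpos_of_nonneg hneg (by positivity)
    exact this.trans (by positivity)

/-- The effective potential along the ray in direction `(x, ±√(1 - x²))`. -/
noncomputable def radialPotential (μ x R : ℝ) : ℝ :=
  -((R ^ 2 - 2 * μ * x * R + μ ^ 2) / 2) - μ / √(R ^ 2 - 2 * x * R + 1) - (1 - μ) / R

/-- Radial derivative of the effective potential. -/
noncomputable def radialForce (μ x R : ℝ) : ℝ :=
  -R + μ * x + μ * (R - x) / √(R ^ 2 - 2 * x * R + 1) ^ 3 + (1 - μ) / R ^ 2

/-- Second radial derivative of the effective potential. -/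
noncomputable def radialForceDeriv (μ x R : ℝ) : ℝ :=
  -1 + μ / √(R ^ 2 - 2 * x * R + 1) ^ 3 -
    3 * μ * (R - x) ^ 2 / √(R ^ 2 - 2 * x * R + 1) ^ 5 - 2 * (1 - μ) / R ^ 3

lemma hasDerivAt_dist {x R : ℝ} (h : 0 < R ^ 2 - 2 * x * R + 1) :
    HasDerivAt (fun R => √(R ^ 2 - 2 * x * R + 1))
      ((R - x) / √(R ^ 2 - 2 * x * R + 1)) R := by
  have h1 : HasDerivAt (fun R : ℝ => R ^ 2 - 2 * x * R + 1) (2 * R - 2 * x) R := by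
    have := (((hasDerivAt_id R).pow 2).sub ((hasDerivAt_id R).const_mul (2 * x))).add_const 1
    refine this.congr_deriv ?_
    simp
  refine (h1.sqrt h.ne').congr_deriv ?_
  have := Real.sqrt_pos.2 h
  field_simp

lemma hasDerivAt_radialPotential {μ x R : ℝ} (hR : R ≠ 0) (h : 0 < R ^ 2 - 2 * x * R + 1) :
    HasDerivAt (radialPotential μ x) (radialForce μ x R) R := by
  have hd := hasDerivAt_dist h
  have hs := Real.sqrt_pos.2 h
  have h1 : HasDerivAt (fun R : ℝ => -((R ^ 2 - 2 * μ * x * R + μ ^ 2) / 2)) (-R + μ * x) R := by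
    have := (((((hasDerivAt_id R).pow 2).sub
      ((hasDerivAt_id R).const_mul (2 * μ * x))).add_const (μ ^ 2)).div_const 2).neg
    refine this.congr_deriv ?_
    simp; ring
  have h2 := (hasDerivAt_const R μ).div hd hs.ne'
  have h3 := (hasDerivAt_const R (1 - μ)).div (hasDerivAt_id R) hR
  refine ((h1.sub h2).sub h3).congr_deriv ?_
  simp only [radialForce, id]
  field_simp
  ring

lemma hasDerivAt_radialForce {μ x R : ℝ} (hR : R ≠ 0) (h : 0 < R ^ 2 - 2 * x * R + 1) :
    HasDerivAt (radialForce μ x) (radialForceDeriv μ x R) R := by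
  have hd := hasDerivAt_dist h
  have hs := Real.sqrt_pos.2 h
  have h1 : HasDerivAt (fun R : ℝ => -R + μ * x) (-1) R := (hasDerivAt_id R).neg.add_const _
  have h2 := (((hasDerivAt_id R).sub_const x).const_mul μ).div (hd.fun_pow 3)
    (pow_ne_zero 3 hs.ne')
  have h3 := (hasDerivAt_const R (1 - μ)).div ((hasDerivAt_id R).pow 2) (by simpa using hR)
  refine ((h1.add h2).add h3).congr_deriv ?_
  simp only [radialForceDeriv, id, Pi.pow_apply]
  generalize √(R ^ 2 - 2 * x * R + 1) = ρ at hs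
  have := hs.ne'
  push_cast
  field_simp
  ring

lemma collinear_balance_pos {μ R r₀ : ℝ} (hμ : μ ∈ Ioo (0 : ℝ) 1) (hR : 0 < R) (hr : R < r₀)
    (hr1 : r₀ < 1) (h0 : (1 - μ) / r₀ ^ 2 - r₀ + μ - μ / (1 - r₀) ^ 2 = 0) :
    0 < (1 - μ) / R ^ 2 - R + μ - μ / (1 - R) ^ 2 := by
  have h1 : (1 - μ) / r₀ ^ 2 ≤ (1 - μ) / R ^ 2 := by
    have : 0 ≤ 1 - μ := by linarith [hμ.2]
    gcongr
  have h2 : μ / (1 - R) ^ 2 ≤ μ / (1 - r₀) ^ 2 := by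
    have h3 := hμ.1.le
    have h4 : 0 < 1 - r₀ := by linarith
    gcongr
  linarith

lemma dist_sq_pos {x R : ℝ} (hR : 0 < R) (hR1 : R < 1) (hx : x ∈ Icc (-1 : ℝ) 1) :
    0 < R ^ 2 - 2 * x * R + 1 := by
  have : 0 < (1 - R) ^ 2 := by
    have : 0 < 1 - R := by linarith
    positivity
  nlinarith [hx.2]

lemma radialForce_pos {μ x R : ℝ} (hμ : μ ∈ Ioo (0 : ℝ) 1) (hR : 0 < R)
    (hR1 : R < 1) (hx : x ∈ Icc (-1 : ℝ) 1)
    (h0 : 0 < (1 - μ) / R ^ 2 - R + μ - μ / (1 - R) ^ 2) : 0 < radialForce μ x R := by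
  have hs := dist_sq_pos hR hR1 hx
  have h2 := radial_attraction_nonneg hR hR1 hx (Real.sqrt_nonneg _) (Real.sq_sqrt hs.le)
  have h3 := mul_nonneg hμ.1.le h2
  have : radialForce μ x R = ((1 - μ) / R ^ 2 - R + μ - μ / (1 - R) ^ 2) +
      μ * ((R - x) / √(R ^ 2 - 2 * x * R + 1) ^ 3 + x - 1 + 1 / (1 - R) ^ 2) := by
    rw [radialForce]; ring
  linarith

lemma radialForceDeriv_le {μ x R : ℝ} (hμ : μ ∈ Ioo (0 : ℝ) 1) (hR : 0 < R)
    (hR1 : R < 1) (hx : x ∈ Icc (-1 : ℝ) 1)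
    (h0 : 0 < (1 - μ) / R ^ 2 - R + μ - μ / (1 - R) ^ 2) : radialForceDeriv μ x R ≤ -1 := by
  have hs := dist_sq_pos hR hR1 hx
  have hsq := Real.sq_sqrt hs.le
  have hρ0 := Real.sqrt_pos.2 hs
  rw [radialForceDeriv]
  set ρ := √(R ^ 2 - 2 * x * R + 1) with hρ
  obtain ⟨h1, h2⟩ := rho_bounds hR hR1 hx hρ0.le hsq
  obtain ⟨u, rfl⟩ : ∃ u, R = 1 - u := ⟨1 - R, by ring⟩
  have hu0 : 0 < u := by linarith
  have hu1 : u < 1 := by linarith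
  rw [sub_sub_cancel] at h0 h1
  have hB := tidal_bound hu0 hu1 h1 (D := 1 - u - x) (by rw [hsq]; ring)
  have hμ0 := hμ.1
  have hμ1 : 0 < 1 - μ := by linarith [hμ.2]
  have hw : 0 < 3 - 3 * u + u ^ 2 := by nlinarith [sq_nonneg u]
  have h3 : μ * (1 - u) ^ 3 * (1 + u + u ^ 2) ≤ (1 - μ) * u ^ 3 * (3 - 3 * u + u ^ 2) := by
    have e : (1 - μ) / (1 - u) ^ 2 - (1 - u) + μ - μ / u ^ 2 =
        ((1 - μ) * u ^ 3 * (3 - 3 * u + u ^ 2) - μ * (1 - u) ^ 3 * (1 + u + u ^ 2)) /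
          (u ^ 2 * (1 - u) ^ 2) := by
      field_simp
      ring
    rw [e] at h0
    have := (div_pos_iff_of_pos_right (by positivity)).1 h0
    linarith
  have h4 : μ * (ρ ^ 2 - 3 * (1 - u - x) ^ 2) * (1 - u) ^ 3 ≤ 2 * (1 - μ) * ρ ^ 5 := by
    have hk : 0 < u ^ 3 * (3 - 3 * u + u ^ 2) := by positivity
    refine le_of_mul_le_mul_right ?_ hk
    have a1 := mul_le_mul_of_nonneg_left hB (show 0 ≤ μ * (1 - u) ^ 3 by positivity)
    have a2 := mul_le_mul_of_nonneg_left h3 (show 0 ≤ 2 * ρ ^ 5 by positivity)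
    nlinarith
  have e : -1 + μ / ρ ^ 3 - 3 * μ * (1 - u - x) ^ 2 / ρ ^ 5 - 2 * (1 - μ) / (1 - u) ^ 3 =
      -1 + (μ * (ρ ^ 2 - 3 * (1 - u - x) ^ 2) * (1 - u) ^ 3 - 2 * (1 - μ) * ρ ^ 5) /
        (ρ ^ 5 * (1 - u) ^ 3) := by
    field_simp
    ring
  rw [e]
  have : (μ * (ρ ^ 2 - 3 * (1 - u - x) ^ 2) * (1 - u) ^ 3 - 2 * (1 - μ) * ρ ^ 5) /
        (ρ ^ 5 * (1 - u) ^ 3) ≤ 0 :=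
    div_nonpos_of_nonpos_of_nonneg (by linarith) (by positivity)
  linarith

lemma radialPotential_ge {μ x r₀ : ℝ} (hμ : μ ∈ Ioo (0 : ℝ) 1) (hr : 0 < r₀) (hr1 : r₀ < 1)
    (hx : x ∈ Icc (-1 : ℝ) 1) : radialPotential μ 1 r₀ ≤ radialPotential μ x r₀ := by
  have hs := dist_sq_pos hr hr1 hx
  have hsq := Real.sq_sqrt hs.le
  have hρ0 := Real.sqrt_pos.2 hs
  rw [radialPotential, radialPotential, show r₀ ^ 2 - 2 * 1 * r₀ + 1 = (1 - r₀) ^ 2 by ring,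
    Real.sqrt_sq (by linarith)]
  set ρ := √(r₀ ^ 2 - 2 * x * r₀ + 1) with hρ
  obtain ⟨h1, h2⟩ := rho_bounds hr hr1 hx hρ0.le hsq
  have hu : 0 < 1 - r₀ := by linarith
  have key : ρ * (1 - r₀) * (ρ + (1 - r₀)) ≤ 2 := by
    have a1 : ρ * (1 - r₀) * (ρ + (1 - r₀)) ≤ (1 + r₀) * (1 - r₀) * 2 := by
      gcongr; linarith
    nlinarith
  have h3 : (ρ ^ 2 - (1 - r₀) ^ 2) / 2 ≤ 1 / (1 - r₀) - 1 / ρ := by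
    rw [div_sub_div _ _ hu.ne' hρ0.ne', div_le_div_iff₀ two_pos (by positivity)]
    have := mul_le_mul_of_nonneg_left key (sub_nonneg.2 h1)
    nlinarith
  have h4 := mul_le_mul_of_nonneg_left h3 hμ.1.le
  have e1 : μ / (1 - r₀) = μ * (1 / (1 - r₀)) := by ring
  have e2 : μ / ρ = μ * (1 / ρ) := by ring
  rw [e1, e2]
  rw [hsq] at h4
  linarith

/-- Inside the disc through the critical point, the kinetic energy available to a particle is
dominated by the square of the radial force. -/
lemma lt_radialForce_sq {μ x R r₀ c : ℝ} (hμ : μ ∈ Ioo (0 : ℝ) 1) (hR : 0 < R) (hr : R < r₀)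
    (hr1 : r₀ < 1) (hx : x ∈ Icc (-1 : ℝ) 1)
    (h0 : (1 - μ) / r₀ ^ 2 - r₀ + μ - μ / (1 - r₀) ^ 2 = 0) (hc : c < radialPotential μ 1 r₀) :
    c < radialForce μ x R ^ 2 / 2 + radialPotential μ x R := by
  have hd : ∀ t ∈ Icc R r₀, HasDerivAt
      (fun t => radialForce μ x t ^ 2 / 2 + radialPotential μ x t)
      (radialForce μ x t * (radialForceDeriv μ x t + 1)) t := by
    intro t ht
    have ht0 : 0 < t := hR.trans_le ht.1
    have hs := dist_sq_pos ht0 (ht.2.trans_lt hr1) hx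
    have h1 := hasDerivAt_radialForce (μ := μ) ht0.ne' hs
    have h2 := hasDerivAt_radialPotential (μ := μ) ht0.ne' hs
    refine (((h1.pow 2).div_const 2).add h2).congr_deriv ?_
    norm_num
    ring
  have hanti : AntitoneOn (fun t => radialForce μ x t ^ 2 / 2 + radialPotential μ x t)
      (Icc R r₀) := by
    refine antitoneOn_of_deriv_nonpos (convex_Icc _ _)
      (fun t ht => (hd t ht).continuousAt.continuousWithinAt)
      (fun t ht => (hd t (interior_subset ht)).differentiableAt.differentiableWithinAt)
      fun t ht => ?_
    rw [(hd t (interior_subset ht)).deriv]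
    rw [interior_Icc] at ht
    have ht0 : 0 < t := hR.trans ht.1
    have hb := collinear_balance_pos hμ ht0 ht.2 hr1 h0
    have h1 := radialForce_pos hμ ht0 (ht.2.trans hr1) hx hb
    have h2 := radialForceDeriv_le hμ ht0 (ht.2.trans hr1) hx hb
    exact mul_nonpos_of_nonneg_of_nonpos h1.le (by linarith)
  have h1 := hanti ⟨le_rfl, hr.le⟩ ⟨hr.le, le_rfl⟩ hr.le
  have h2 := radialPotential_ge hμ (hR.trans hr) hr1 hx
  simp only at h1
  nlinarith [sq_nonneg (radialForce μ x r₀)]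

end RadialEstimates

section CriticalValue

/-- First component of the gradient of the effective potential. -/
noncomputable def gradV1 (μ x y : ℝ) : ℝ :=
  -(x - μ) + μ * (x - 1) / √((x - 1) ^ 2 + y ^ 2) ^ 3 + (1 - μ) * x / √(x ^ 2 + y ^ 2) ^ 3

/-- Second component of the gradient of the effective potential. -/
noncomputable def gradV2 (μ x y : ℝ) : ℝ :=
  -y + μ * y / √((x - 1) ^ 2 + y ^ 2) ^ 3 + (1 - μ) * y / √(x ^ 2 + y ^ 2) ^ 3

lemma sq_add_sq_pos_of_ne {x y a : ℝ} (h : (x, y) ≠ (a, 0)) : 0 < (x - a) ^ 2 + y ^ 2 := by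
  refine lt_of_le_of_ne (by positivity) fun h0 => h ?_
  have h1 : (x - a) ^ 2 = 0 := by nlinarith [sq_nonneg (x - a), sq_nonneg y]
  have h2 : y ^ 2 = 0 := by nlinarith [sq_nonneg (x - a), sq_nonneg y]
  rw [Prod.mk.injEq]
  exact ⟨by simpa [sub_eq_zero] using h1, by simpa using h2⟩

lemma hasFDerivAt_sqrt_sq_add_sq {a : ℝ} {q : ℝ × ℝ} (h : 0 < (q.1 - a) ^ 2 + q.2 ^ 2) :
    HasFDerivAt (fun q : ℝ × ℝ => √((q.1 - a) ^ 2 + q.2 ^ 2))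
      (((q.1 - a) / √((q.1 - a) ^ 2 + q.2 ^ 2)) • ContinuousLinearMap.fst ℝ ℝ ℝ +
        (q.2 / √((q.1 - a) ^ 2 + q.2 ^ 2)) • ContinuousLinearMap.snd ℝ ℝ ℝ) q := by
  have h1 : HasFDerivAt (fun q : ℝ × ℝ => q.1) (ContinuousLinearMap.fst ℝ ℝ ℝ) q := hasFDerivAt_fst
  have h2 : HasFDerivAt (fun q : ℝ × ℝ => q.2) (ContinuousLinearMap.snd ℝ ℝ ℝ) q := hasFDerivAt_snd
  refine ((((h1.sub_const a).pow 2).add (h2.pow 2)).sqrt h.ne').congr_fderiv ?_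
  have hs := (Real.sqrt_pos.2 h).ne'
  ext <;> simp <;> field_simp

lemma hasFDerivAt_V {μ : ℝ} {q : ℝ × ℝ} (h0 : q ≠ (0, 0)) (h1 : q ≠ (1, 0)) :
    HasFDerivAt (V μ) (gradV1 μ q.1 q.2 • ContinuousLinearMap.fst ℝ ℝ ℝ +
      gradV2 μ q.1 q.2 • ContinuousLinearMap.snd ℝ ℝ ℝ) q := by
  have hn : 0 < (q.1 - 0) ^ 2 + q.2 ^ 2 := sq_add_sq_pos_of_ne h0
  have hd : 0 < (q.1 - 1) ^ 2 + q.2 ^ 2 := sq_add_sq_pos_of_ne h1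
  have en := hasFDerivAt_sqrt_sq_add_sq hn
  have ed := hasFDerivAt_sqrt_sq_add_sq hd
  simp only [sub_zero] at en hn
  have h1 : HasFDerivAt (fun q : ℝ × ℝ => q.1) (ContinuousLinearMap.fst ℝ ℝ ℝ) q := hasFDerivAt_fst
  have h2 : HasFDerivAt (fun q : ℝ × ℝ => q.2) (ContinuousLinearMap.snd ℝ ℝ ℝ) q := hasFDerivAt_snd
  have e1 := (((h1.sub_const μ).pow 2).add (h2.pow 2)).const_smul (-(1 / 2) : ℝ)
  have e2 := ((hasDerivAt_inv (Real.sqrt_pos.2 hd).ne').comp_hasFDerivAt q ed).const_smul μ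
  have e3 := ((hasDerivAt_inv (Real.sqrt_pos.2 hn).ne').comp_hasFDerivAt q en).const_smul (1 - μ)
  have hV : V μ = fun q : ℝ × ℝ => (-(1 / 2) : ℝ) • ((q.1 - μ) ^ 2 + q.2 ^ 2) -
      μ • (√((q.1 - 1) ^ 2 + q.2 ^ 2))⁻¹ - (1 - μ) • (√(q.1 ^ 2 + q.2 ^ 2))⁻¹ := by
    funext q
    simp only [V, nrm, smul_eq_mul]
    ring
  rw [hV]
  refine ((e1.sub e2).sub e3).congr_fderiv ?_
  have hs := Real.sqrt_pos.2 hd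
  have hs' := Real.sqrt_pos.2 hn
  generalize hde : √((q.1 - 1) ^ 2 + q.2 ^ 2) = d at hs
  generalize hne : √(q.1 ^ 2 + q.2 ^ 2) = n at hs'
  ext <;> simp [gradV1, gradV2, hde, hne] <;> field_simp

lemma fderiv_V {μ : ℝ} {q : ℝ × ℝ} (h0 : q ≠ (0, 0)) (h1 : q ≠ (1, 0)) :
    fderiv ℝ (V μ) q (1, 0) = gradV1 μ q.1 q.2 ∧ fderiv ℝ (V μ) q (0, 1) = gradV2 μ q.1 q.2 := by
  rw [(hasFDerivAt_V h0 h1).fderiv]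
  simp

lemma exists_collinear_point {μ : ℝ} (hμ : μ ∈ Ioo (0 : ℝ) 1) :
    ∃ r ∈ Ioo (0 : ℝ) 1, (1 - μ) / r ^ 2 - r + μ - μ / (1 - r) ^ 2 = 0 := by
  have hc : ContinuousOn (fun r : ℝ => (1 - μ) * (1 - r) ^ 2 - (r - μ) * r ^ 2 * (1 - r) ^ 2 -
      μ * r ^ 2) (Icc 0 1) := by fun_prop
  obtain ⟨r, hr, h⟩ := intermediate_value_Icc' zero_le_one hc
    (show (0 : ℝ) ∈ Icc _ _ by norm_num; exact ⟨hμ.1.le, hμ.2.le⟩)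
  simp only at h
  have hμ0 := hμ.1
  have hμ1 := hμ.2
  have h0 : 0 < r := lt_of_le_of_ne hr.1 (by rintro rfl; norm_num at h; linarith)
  have h1 : r < 1 := lt_of_le_of_ne hr.2 (by rintro rfl; norm_num at h; linarith)
  refine ⟨r, ⟨h0, h1⟩, ?_⟩
  have : 1 - r ≠ 0 := by linarith
  field_simp
  linarith

lemma mem_critSet {μ r : ℝ} (hr : r ∈ Ioo (0 : ℝ) 1)
    (h : (1 - μ) / r ^ 2 - r + μ - μ / (1 - r) ^ 2 = 0) : (r, (0 : ℝ)) ∈ critSet μ := by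
  have h0 := hr.1
  have h1 := hr.2
  have n0 : (r, (0 : ℝ)) ≠ (0, 0) := by simp [h0.ne']
  have n1 : (r, (0 : ℝ)) ≠ (1, 0) := by simp [h1.ne]
  refine ⟨n0, n1, ?_⟩
  rw [(hasFDerivAt_V n0 n1).fderiv]
  have hu : 0 < 1 - r := by linarith
  have e1 : √((r - 1) ^ 2 + 0 ^ 2) = 1 - r := by
    rw [show (r - 1) ^ 2 + 0 ^ 2 = (1 - r) ^ 2 by ring, Real.sqrt_sq hu.le]
  have e2 : √(r ^ 2 + 0 ^ 2) = r := by
    rw [show r ^ 2 + 0 ^ 2 = r ^ 2 by ring, Real.sqrt_sq h0.le]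
  have h2 : gradV2 μ r 0 = 0 := by simp [gradV2]
  have h3 : gradV1 μ r 0 = 0 := by
    rw [gradV1, e1, e2, ← h]
    field_simp
    ring
  simp only [h2, h3]
  simp

lemma collinear_crit_bounds {μ x : ℝ} (hμ : μ ∈ Ioo (0 : ℝ) 1) (h0 : x ≠ 0) (h1 : x ≠ 1)
    (h : -(x - μ) + μ * (x - 1) / |x - 1| ^ 3 + (1 - μ) * x / |x| ^ 3 = 0) :
    |x| ≤ 3 ∧ (1 - μ) / |x| ≤ 8 ∧ μ / |x - 1| ≤ 8 := by
  have hμ0 := hμ.1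
  have hμ1 : 0 < 1 - μ := by linarith [hμ.2]
  have p0 : 0 < |x| := abs_pos.2 h0
  have p1 : 0 < |x - 1| := abs_pos.2 (sub_ne_zero.2 h1)
  have b1 : |μ * (x - 1) / |x - 1| ^ 3| = μ / |x - 1| ^ 2 := by
    rw [abs_div, abs_mul, abs_of_pos hμ0, abs_of_pos (pow_pos p1 3)]
    field_simp
  have b0 : |(1 - μ) * x / |x| ^ 3| = (1 - μ) / |x| ^ 2 := by
    rw [abs_div, abs_mul, abs_of_pos hμ1, abs_of_pos (pow_pos p0 3)]
    field_simp
  have tri1 : |x - 1| ≤ |x| + 1 := by simpa using abs_sub x 1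
  have tri2 : |x| ≤ |x - 1| + 1 := by
    have := abs_add_le (x - 1) 1
    simpa using this
  have tri3 : 1 ≤ |x| + |x - 1| := by
    have := abs_sub x (x - 1)
    simpa using this
  have tri4 : |x| ≤ |x - μ| + 1 := by
    have := abs_add_le (x - μ) μ
    rw [sub_add_cancel, abs_of_pos hμ0] at this
    linarith [hμ.2]
  have tri5 : |x - μ| ≤ |x| + 1 := by
    have := abs_sub x μ
    rw [abs_of_pos hμ0] at this
    linarith [hμ.2]
  have m1 : |x - μ| ≤ μ / |x - 1| ^ 2 + (1 - μ) / |x| ^ 2 := by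
    rw [← b1, ← b0]
    rw [show x - μ = μ * (x - 1) / |x - 1| ^ 3 + (1 - μ) * x / |x| ^ 3 by linarith]
    exact abs_add_le _ _
  have m2 : μ / |x - 1| ^ 2 ≤ |x - μ| + (1 - μ) / |x| ^ 2 := by
    rw [← b1, ← b0]
    rw [show μ * (x - 1) / |x - 1| ^ 3 = (x - μ) - (1 - μ) * x / |x| ^ 3 by linarith]
    exact abs_sub _ _
  have m3 : (1 - μ) / |x| ^ 2 ≤ |x - μ| + μ / |x - 1| ^ 2 := by
    rw [← b1, ← b0]
    rw [show (1 - μ) * x / |x| ^ 3 = (x - μ) - μ * (x - 1) / |x - 1| ^ 3 by linarith]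
    exact abs_sub _ _
  have small : ∀ {m d : ℝ}, 0 < m → m < 1 → 1 / 2 ≤ d → m / d ^ 2 ≤ 4 ∧ m / d ≤ 8 := by
    intro m d hm0 hm hd
    have hd0 : 0 < d := by linarith
    rw [div_le_iff₀ (by positivity), div_le_iff₀ hd0]
    constructor <;> nlinarith
  have big : ∀ {m d B : ℝ}, 0 < d → d ≤ 1 → 0 < m → m / d ^ 2 ≤ B → m / d ≤ B := by
    intro m d B hd0 hd hm h
    refine le_trans ?_ h
    have : d ^ 2 ≤ d := by nlinarith
    gcongr
  refine ⟨?_, ?_, ?_⟩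
  · by_contra! hx
    have h2 : 2 ≤ |x - 1| := by linarith
    have e1 : μ / |x - 1| ^ 2 ≤ μ / 2 ^ 2 := by gcongr
    have e2 : (1 - μ) / |x| ^ 2 ≤ (1 - μ) / 3 ^ 2 := by gcongr
    linarith
  · by_cases hx : 1 / 2 ≤ |x|
    · exact (small hμ1 (by linarith) hx).2
    · push Not at hx
      have := (small hμ0 hμ.2 (show 1 / 2 ≤ |x - 1| by linarith)).1
      exact big p0 (by linarith) hμ1 (by linarith)
  · by_cases hx : 1 / 2 ≤ |x - 1|
    · exact (small hμ0 hμ.2 hx).2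
    · push Not at hx
      have := (small hμ1 (by linarith) (show 1 / 2 ≤ |x| by linarith)).1
      exact big p1 (by linarith) hμ0 (by linarith)

lemma bddBelow_critical_values {μ : ℝ} (hμ : μ ∈ Ioo (0 : ℝ) 1) :
    BddBelow (V μ '' critSet μ) := by
  refine ⟨-30, ?_⟩
  rintro _ ⟨⟨x, y⟩, ⟨n0, n1, hf⟩, rfl⟩
  obtain ⟨g1, g2⟩ := fderiv_V (μ := μ) n0 n1
  rw [hf] at g1 g2
  simp only [_root_.zero_apply] at g1 g2
  have hμ0 := hμ.1
  have hμ1 := hμ.2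
  simp only [V, nrm]
  by_cases hy : y = 0
  · subst hy
    have h0 : x ≠ 0 := by simpa using n0
    have h1 : x ≠ 1 := by simpa using n1
    rw [gradV1] at g1
    simp only [ne_eq, OfNat.ofNat_ne_zero, not_false_eq_true, zero_pow, add_zero,
      Real.sqrt_sq_eq_abs] at g1 ⊢
    obtain ⟨a, b, d⟩ := collinear_crit_bounds hμ h0 h1 g1.symm
    have := abs_le.1 a
    nlinarith
  · have hd : 0 < (x - 1) ^ 2 + y ^ 2 := sq_add_sq_pos_of_ne n1
    have hn : 0 < (x - 0) ^ 2 + y ^ 2 := sq_add_sq_pos_of_ne n0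
    rw [sub_zero] at hn
    have hds := Real.sqrt_pos.2 hd
    have hns := Real.sqrt_pos.2 hn
    have hsq := Real.sq_sqrt hn.le
    rw [gradV1] at g1
    rw [gradV2] at g2
    generalize √((x - 1) ^ 2 + y ^ 2) = d at *
    generalize √(x ^ 2 + y ^ 2) = n at *
    have k2 : -1 + μ / d ^ 3 + (1 - μ) / n ^ 3 = 0 := by
      have : y * (-1 + μ / d ^ 3 + (1 - μ) / n ^ 3) = 0 := by rw [g2]; ring
      exact (mul_eq_zero.1 this).resolve_left hy
    have k1 : μ - μ / d ^ 3 = 0 := by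
      have : x * (-1 + μ / d ^ 3 + (1 - μ) / n ^ 3) + (μ - μ / d ^ 3) = 0 := by rw [g1]; ring
      rwa [k2, mul_zero, zero_add] at this
    have cube : ∀ {t : ℝ}, 0 < t → t ^ 3 = 1 → t = 1 := by
      intro t ht h
      exact (pow_eq_one_iff_of_nonneg ht.le (by norm_num)).1 h
    have d1 : d = 1 := by
      refine cube hds ?_
      have h3 : μ / d ^ 3 = μ := by linarith
      rw [div_eq_iff (by positivity)] at h3
      have h4 : μ * (d ^ 3 - 1) = 0 := by linarith
      have := (mul_eq_zero.1 h4).resolve_left hμ0.ne'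
      linarith
    have n1' : n = 1 := by
      refine cube hns ?_
      rw [d1] at k2
      have : 1 - μ ≠ 0 := by linarith
      field_simp at k2
      have h3 : (1 - μ) * (n ^ 3 - 1) = 0 := by linarith
      have := (mul_eq_zero.1 h3).resolve_left this
      linarith
    subst d1 n1'
    have hx : -1 ≤ x ∧ x ≤ 1 := abs_le_of_sq_le_sq' (by nlinarith) zero_le_one |>.imp id id
    nlinarith

/-- The first critical value is at most the value at the collinear critical point between the
two primaries. -/
lemma firstCriticalValue_le {μ r : ℝ} (hμ : μ ∈ Ioo (0 : ℝ) 1) (hr : r ∈ Ioo (0 : ℝ) 1)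
    (h : (1 - μ) / r ^ 2 - r + μ - μ / (1 - r) ^ 2 = 0) :
    firstCriticalValue μ ≤ radialPotential μ 1 r := by
  refine (csInf_le (bddBelow_critical_values hμ) ⟨_, mem_critSet hr h, rfl⟩).trans_eq ?_
  simp only [V, nrm, radialPotential]
  have e1 : √((r - 1) ^ 2 + 0 ^ 2) = √(r ^ 2 - 2 * 1 * r + 1) := by congr 1; ring
  have e2 : √(r ^ 2 + 0 ^ 2) = r := by
    rw [show r ^ 2 + 0 ^ 2 = r ^ 2 by ring, Real.sqrt_sq hr.1.le]
  rw [e1, e2]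
  ring

end CriticalValue

section Regularization

/-- Distance to `E` of the square of `a + b i`. -/
noncomputable def dist₁ (a b : ℝ) : ℝ := √((a ^ 2 - b ^ 2 - 1) ^ 2 + (2 * a * b) ^ 2)

/-- The Levi-Civita regularized potential: `4 R (c - V)` at the square of `a + b i`. -/
noncomputable def regW (μ c a b : ℝ) : ℝ :=
  4 * (a ^ 2 + b ^ 2) *
    (c + ((a ^ 2 - b ^ 2 - μ) ^ 2 + (2 * a * b) ^ 2) / 2 + μ / dist₁ a b) + 4 * (1 - μ)

/-- First partial derivative of `regW`. -/
noncomputable def regWa (μ c a b : ℝ) : ℝ :=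
  8 * a * (c + ((a ^ 2 - b ^ 2 - μ) ^ 2 + (2 * a * b) ^ 2) / 2 + μ / dist₁ a b) +
  8 * (a ^ 2 + b ^ 2) * ((a ^ 2 - b ^ 2 - μ) * a + 2 * a * b * b -
    μ * ((a ^ 2 - b ^ 2 - 1) * a + 2 * a * b * b) / dist₁ a b ^ 3)

/-- Second partial derivative of `regW`. -/
noncomputable def regWb (μ c a b : ℝ) : ℝ :=
  8 * b * (c + ((a ^ 2 - b ^ 2 - μ) ^ 2 + (2 * a * b) ^ 2) / 2 + μ / dist₁ a b) +
  8 * (a ^ 2 + b ^ 2) * (2 * a * b * a - (a ^ 2 - b ^ 2 - μ) * b -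
    μ * (2 * a * b * a - (a ^ 2 - b ^ 2 - 1) * b) / dist₁ a b ^ 3)

lemma dist₁_radicand_pos {a b : ℝ} (h : a ^ 2 + b ^ 2 < 1) :
    0 < (a ^ 2 - b ^ 2 - 1) ^ 2 + (2 * a * b) ^ 2 := by
  have h1 : 0 < 1 - (a ^ 2 - b ^ 2) := by nlinarith [sq_nonneg b]
  have : 0 < (a ^ 2 - b ^ 2 - 1) ^ 2 := by
    have : 0 < (1 - (a ^ 2 - b ^ 2)) ^ 2 := by positivity
    nlinarith
  positivity

lemma dist₁_pos {a b : ℝ} (h : a ^ 2 + b ^ 2 < 1) : 0 < dist₁ a b :=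
  Real.sqrt_pos.2 (dist₁_radicand_pos h)

lemma hasDerivAt_dist₁ {a b : ℝ → ℝ} {a' b' t : ℝ} (ha : HasDerivAt a a' t)
    (hb : HasDerivAt b b' t) (h : a t ^ 2 + b t ^ 2 < 1) :
    HasDerivAt (fun t => dist₁ (a t) (b t))
      (2 * (((a t ^ 2 - b t ^ 2 - 1) * a t + 2 * a t * b t * b t) * a' +
        (2 * a t * b t * a t - (a t ^ 2 - b t ^ 2 - 1) * b t) * b') / dist₁ (a t) (b t)) t := by
  have h1 := (((ha.fun_pow 2).fun_sub (hb.fun_pow 2)).sub_const 1).fun_pow 2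
  have h2 := ((ha.const_mul 2).fun_mul hb).fun_pow 2
  have h3 := (h1.fun_add h2).sqrt (dist₁_radicand_pos h).ne'
  have hs := dist₁_pos h
  refine h3.congr_deriv ?_
  rw [dist₁] at *
  generalize √((a t ^ 2 - b t ^ 2 - 1) ^ 2 + (2 * a t * b t) ^ 2) = d at *
  field_simp
  push_cast
  ring

lemma hasDerivAt_regW {μ c : ℝ} {a b : ℝ → ℝ} {a' b' t : ℝ} (ha : HasDerivAt a a' t)
    (hb : HasDerivAt b b' t) (h : a t ^ 2 + b t ^ 2 < 1) :
    HasDerivAt (fun t => regW μ c (a t) (b t))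
      (regWa μ c (a t) (b t) * a' + regWb μ c (a t) (b t) * b') t := by
  have hs := dist₁_pos h
  have h1 := (((ha.fun_pow 2).fun_sub (hb.fun_pow 2)).sub_const μ).fun_pow 2
  have h2 := ((ha.const_mul 2).fun_mul hb).fun_pow 2
  have h3 := (hasDerivAt_const t μ).fun_div (hasDerivAt_dist₁ ha hb h) hs.ne'
  have h4 := (((h1.fun_add h2).div_const 2).const_add c).fun_add h3
  have h5 := ((ha.fun_pow 2).fun_add (hb.fun_pow 2)).const_mul 4
  refine ((h5.fun_mul h4).add_const (4 * (1 - μ))).congr_deriv ?_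
  rw [regWa, regWb]
  generalize dist₁ (a t) (b t) = d at *
  field_simp
  push_cast
  ring

lemma contDiffAt_regW {μ c : ℝ} {z : ℂ} (h : z.re ^ 2 + z.im ^ 2 < 1) :
    ContDiffAt ℝ 1 (fun z : ℂ => regW μ c z.re z.im) z := by
  have hre : ContDiffAt ℝ 1 (fun z : ℂ => z.re) z := Complex.reCLM.contDiff.contDiffAt
  have him : ContDiffAt ℝ 1 (fun z : ℂ => z.im) z := Complex.imCLM.contDiff.contDiffAt
  have hd : ContDiffAt ℝ 1 (fun z : ℂ => dist₁ z.re z.im) z := by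
    unfold dist₁
    exact ContDiffAt.sqrt (by fun_prop) (dist₁_radicand_pos h).ne'
  have h1 : ContDiffAt ℝ 1 (fun z : ℂ => μ / dist₁ z.re z.im) z :=
    contDiffAt_const.div hd (dist₁_pos h).ne'
  unfold regW
  fun_prop

/-- The regularized Hamiltonian. -/
noncomputable def regK (μ c : ℝ) (x : ℂ × ℂ) : ℝ :=
  ((x.2.re + 2 * (x.1.re ^ 2 + x.1.im ^ 2) * x.1.im) ^ 2 +
    (x.2.im - 2 * (x.1.re ^ 2 + x.1.im ^ 2) * x.1.re) ^ 2) / 2 - regW μ c x.1.re x.1.im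

/-- The velocity (momentum gradient of `regK`). -/
noncomputable def regQ (x : ℂ × ℂ) : ℂ :=
  ⟨x.2.re + 2 * (x.1.re ^ 2 + x.1.im ^ 2) * x.1.im,
    x.2.im - 2 * (x.1.re ^ 2 + x.1.im ^ 2) * x.1.re⟩

/-- The position gradient of `regK`. -/
noncomputable def regP (μ c : ℝ) (x : ℂ × ℂ) : ℂ :=
  ⟨4 * x.1.re * x.1.im * (regQ x).re -
      (2 * (x.1.re ^ 2 + x.1.im ^ 2) + 4 * x.1.re ^ 2) * (regQ x).im - regWa μ c x.1.re x.1.im,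
    (2 * (x.1.re ^ 2 + x.1.im ^ 2) + 4 * x.1.im ^ 2) * (regQ x).re -
      4 * x.1.re * x.1.im * (regQ x).im - regWb μ c x.1.re x.1.im⟩

lemma contDiffAt_regK {μ c : ℝ} {x : ℂ × ℂ} (h : x.1.re ^ 2 + x.1.im ^ 2 < 1) :
    ContDiffAt ℝ 1 (regK μ c) x := by
  have h1 : ContDiffAt ℝ 1 (fun x : ℂ × ℂ => x.1.re) x :=
    (Complex.reCLM.contDiff.comp contDiff_fst).contDiffAt
  have h2 : ContDiffAt ℝ 1 (fun x : ℂ × ℂ => x.1.im) x :=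
    (Complex.imCLM.contDiff.comp contDiff_fst).contDiffAt
  have h3 : ContDiffAt ℝ 1 (fun x : ℂ × ℂ => x.2.re) x :=
    (Complex.reCLM.contDiff.comp contDiff_snd).contDiffAt
  have h4 : ContDiffAt ℝ 1 (fun x : ℂ × ℂ => x.2.im) x :=
    (Complex.imCLM.contDiff.comp contDiff_snd).contDiffAt
  have h5 : ContDiffAt ℝ 1 (fun x : ℂ × ℂ => regW μ c x.1.re x.1.im) x :=
    ContDiffAt.comp (g := fun z : ℂ => regW μ c z.re z.im) x (contDiffAt_regW h) contDiffAt_fst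
  unfold regK
  fun_prop

lemma fderiv_regK {μ c : ℝ} {x : ℂ × ℂ} (h : x.1.re ^ 2 + x.1.im ^ 2 < 1) (v : ℂ × ℂ) :
    fderiv ℝ (regK μ c) x v =
      (regP μ c x).re * v.1.re + (regP μ c x).im * v.1.im +
      ((regQ x).re * v.2.re + (regQ x).im * v.2.im) := by
  have hdiff := ((contDiffAt_regK (μ := μ) (c := c) h).differentiableAt one_ne_zero).hasFDerivAt
  have hline : HasDerivAt (fun t : ℝ => x + t • v) v 0 := by
    simpa using ((hasDerivAt_id (0 : ℝ)).smul_const v).const_add x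
  have hc := HasFDerivAt.comp_hasDerivAt (f := fun t : ℝ => x + t • v) (0 : ℝ)
    (by simpa using hdiff) hline
  have lin : ∀ α β : ℝ, HasDerivAt (fun t : ℝ => α + t * β) β 0 := fun α β => by
    simpa using ((hasDerivAt_id (0 : ℝ)).mul_const β).const_add α
  have ha := lin x.1.re v.1.re
  have hb := lin x.1.im v.1.im
  have hp := lin x.2.re v.2.re
  have hq := lin x.2.im v.2.im
  have hW := hasDerivAt_regW (μ := μ) (c := c) ha hb (by simpa using h)
  have hR := ((ha.fun_pow 2).fun_add (hb.fun_pow 2)).const_mul 2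
  have h1 := (hp.fun_add (hR.fun_mul hb)).fun_pow 2
  have h2 := (hq.fun_sub (hR.fun_mul ha)).fun_pow 2
  have h3 := ((h1.fun_add h2).div_const 2).fun_sub hW
  have h4 : regK μ c ∘ (fun t : ℝ => x + t • v) = fun t : ℝ =>
      ((x.2.re + t * v.2.re + 2 * ((x.1.re + t * v.1.re) ^ 2 + (x.1.im + t * v.1.im) ^ 2) *
        (x.1.im + t * v.1.im)) ^ 2 +
      (x.2.im + t * v.2.im - 2 * ((x.1.re + t * v.1.re) ^ 2 + (x.1.im + t * v.1.im) ^ 2) *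
        (x.1.re + t * v.1.re)) ^ 2) / 2 -
      regW μ c (x.1.re + t * v.1.re) (x.1.im + t * v.1.im) := by
    funext t
    simp [regK]
  rw [h4] at hc
  have h5 := hc.unique h3
  refine h5.trans ?_
  simp only [zero_mul, add_zero, regP, regQ]
  push_cast
  ring

end Regularization

section RegularizedChord

lemma cos_double_mem {a b : ℝ} (h : 0 < a ^ 2 + b ^ 2) :
    (a ^ 2 - b ^ 2) / (a ^ 2 + b ^ 2) ∈ Icc (-1 : ℝ) 1 := by
  constructor
  · rw [le_div_iff₀ h]; nlinarith [sq_nonneg a]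
  · rw [div_le_iff₀ h]; nlinarith [sq_nonneg b]

lemma dist₁_eq {a b R x : ℝ} (hR : R = a ^ 2 + b ^ 2) (hx : x * R = a ^ 2 - b ^ 2) :
    dist₁ a b = √(R ^ 2 - 2 * x * R + 1) := by
  rw [dist₁]
  congr 1
  rw [mul_assoc 2 x R, hx, hR]
  ring

lemma regW_eq_radial {μ c a b R x : ℝ} (hR : R = a ^ 2 + b ^ 2) (hx : x * R = a ^ 2 - b ^ 2)
    (h : 0 < R) : regW μ c a b = 4 * R * (c - radialPotential μ x R) := by
  have hN : (a ^ 2 - b ^ 2 - μ) ^ 2 + (2 * a * b) ^ 2 = R ^ 2 - 2 * μ * (x * R) + μ ^ 2 := by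
    rw [hx, hR]; ring
  rw [regW, radialPotential, dist₁_eq hR hx, hN, ← hR]
  have := h.ne'
  field_simp
  ring

lemma regW_radial_deriv {μ c a b R x : ℝ} (hR : R = a ^ 2 + b ^ 2)
    (hx : x * R = a ^ 2 - b ^ 2) (h : 0 < R) :
    regWa μ c a b * a + regWb μ c a b * b =
      8 * R * (c - radialPotential μ x R) - 8 * R ^ 2 * radialForce μ x R := by
  have hN : (a ^ 2 - b ^ 2 - μ) ^ 2 + (2 * a * b) ^ 2 = R ^ 2 - 2 * μ * (x * R) + μ ^ 2 := by
    rw [hx, hR]; ring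
  have e1 : ((a ^ 2 - b ^ 2 - μ) * a + 2 * a * b * b) * a +
      (2 * a * b * a - (a ^ 2 - b ^ 2 - μ) * b) * b = R ^ 2 - μ * (x * R) := by
    rw [hx, hR]; ring
  have e2 : ((a ^ 2 - b ^ 2 - 1) * a + 2 * a * b * b) * a +
      (2 * a * b * a - (a ^ 2 - b ^ 2 - 1) * b) * b = R ^ 2 - x * R := by
    rw [hx, hR]; ring
  have e3 : regWa μ c a b * a + regWb μ c a b * b =
      8 * R * (c + (R ^ 2 - 2 * μ * (x * R) + μ ^ 2) / 2 + μ / dist₁ a b) +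
      8 * R * (R ^ 2 - μ * (x * R) - μ * (R ^ 2 - x * R) / dist₁ a b ^ 3) := by
    rw [← e1, ← e2, ← hN, regWa, regWb, hR]
    ring
  rw [e3, radialPotential, radialForce, ← dist₁_eq hR hx]
  have := h.ne'
  have hd : ∀ t : ℝ, 8 * R ^ 2 * (μ * (R - x) / t) = 8 * R * (μ * (R ^ 2 - x * R) / t) := by
    intro t; ring
  have hd2 : ∀ t : ℝ, 8 * R ^ 2 * (-R + μ * x + μ * (R - x) / t + (1 - μ) / R ^ 2) =
      8 * R ^ 2 * (-R + μ * x) + 8 * R * (μ * (R ^ 2 - x * R) / t) + 8 * (1 - μ) := by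
    intro t
    rw [← hd]
    field_simp
  rw [hd2]
  have hd3 : ∀ t : ℝ, 8 * R * (c - (-((R ^ 2 - 2 * μ * x * R + μ ^ 2) / 2) - t - (1 - μ) / R)) =
      8 * R * (c + (R ^ 2 - 2 * μ * (x * R) + μ ^ 2) / 2 + t) + 8 * (1 - μ) := by
    intro t
    field_simp
    ring
  rw [hd3]
  ring

lemma regK_transversal {μ c r₀ : ℝ} (hμ : μ ∈ Ioo (0 : ℝ) 1) (hr1 : r₀ < 1)
    (h0 : (1 - μ) / r₀ ^ 2 - r₀ + μ - μ / (1 - r₀) ^ 2 = 0) (hc : c < radialPotential μ 1 r₀)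
    {x : ℂ × ℂ} (hx : x.1.re ^ 2 + x.1.im ^ 2 < r₀) (hK : regK μ c x = 0) :
    0 < fderiv ℝ (regK μ c) x x := by
  rw [fderiv_regK (hx.trans hr1)]
  have hv : (regQ x).re ^ 2 + (regQ x).im ^ 2 = 2 * regW μ c x.1.re x.1.im := by
    simp only [regK] at hK
    simp only [regQ]
    linarith
  have hp : x.2.re = (regQ x).re - 2 * (x.1.re ^ 2 + x.1.im ^ 2) * x.1.im := by simp [regQ]
  have hq : x.2.im = (regQ x).im + 2 * (x.1.re ^ 2 + x.1.im ^ 2) * x.1.re := by simp [regQ]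
  have e : (regP μ c x).re * x.1.re + (regP μ c x).im * x.1.im +
      ((regQ x).re * x.2.re + (regQ x).im * x.2.im) =
      ((regQ x).re ^ 2 + (regQ x).im ^ 2) +
        4 * (x.1.re ^ 2 + x.1.im ^ 2) * ((regQ x).re * x.1.im - (regQ x).im * x.1.re) -
        (regWa μ c x.1.re x.1.im * x.1.re + regWb μ c x.1.re x.1.im * x.1.im) := by
    rw [hp, hq]
    simp only [regP]
    ring
  rw [e]
  generalize (regQ x).re = v1 at *
  generalize (regQ x).im = v2 at *
  generalize x.1.re = a at *
  generalize x.1.im = b at *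
  rcases (by positivity : 0 ≤ a ^ 2 + b ^ 2).eq_or_lt with hR | hR
  · have ha : a = 0 := by nlinarith [sq_nonneg a, sq_nonneg b]
    have hb : b = 0 := by nlinarith [sq_nonneg a, sq_nonneg b]
    subst ha hb
    rw [hv]
    simp [regW]
    linarith [hμ.2]
  · obtain ⟨R, hRd⟩ : ∃ R, R = a ^ 2 + b ^ 2 := ⟨_, rfl⟩
    obtain ⟨y, hy⟩ : ∃ y, y = (a ^ 2 - b ^ 2) / (a ^ 2 + b ^ 2) := ⟨_, rfl⟩
    have hyR : y * R = a ^ 2 - b ^ 2 := by rw [hy, hRd]; field_simp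
    have hym : y ∈ Icc (-1 : ℝ) 1 := hy ▸ cos_double_mem hR
    rw [← hRd] at hR hx
    have hsq := lt_radialForce_sq hμ hR hx hr1 hym h0 hc
    have hF := radialForce_pos hμ hR (hx.trans hr1) hym (collinear_balance_pos hμ hR hx hr1 h0)
    have hWe := regW_eq_radial (μ := μ) (c := c) hRd hyR hR
    rw [regW_radial_deriv hRd hyR hR, ← hRd, hv, hWe]
    rw [hWe] at hv
    generalize radialForce μ y R = F at *
    generalize radialPotential μ y R = U at *
    have hg : (v1 * b - v2 * a) ^ 2 ≤ 8 * R ^ 2 * (c - U) := by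
      have : (v1 * b - v2 * a) ^ 2 ≤ (v1 ^ 2 + v2 ^ 2) * R := by
        rw [hRd]; nlinarith [sq_nonneg (v1 * a + v2 * b)]
      rw [hv] at this
      linarith
    have hg2 : (v1 * b - v2 * a) ^ 2 < (2 * R * F) ^ 2 := by
      have : 0 < R ^ 2 := by positivity
      nlinarith
    have hg3 := abs_lt_of_sq_lt_sq' hg2 (by positivity) |>.1
    nlinarith

lemma exists_regK_nonneg_ray {μ c r₀ : ℝ} (hμ : μ ∈ Ioo (0 : ℝ) 1) (hr : 0 < r₀) (hr1 : r₀ < 1)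
    (hc : c < radialPotential μ 1 r₀) {x : ℂ × ℂ} (hx : x ≠ 0) :
    ∃ r > (0 : ℝ), (r • x).1.re ^ 2 + (r • x).1.im ^ 2 < r₀ ∧ 0 ≤ regK μ c (r • x) := by
  obtain ⟨z, w⟩ := x
  by_cases hz : z = 0
  · subst hz
    have hw : w ≠ 0 := fun h => hx (by simp [h])
    have hn : 0 < w.re ^ 2 + w.im ^ 2 := by
      have := Complex.normSq_pos.2 hw
      rw [Complex.normSq_apply] at this
      linarith
    have hs := Real.sq_sqrt (show 0 ≤ 8 / (w.re ^ 2 + w.im ^ 2) by positivity)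
    refine ⟨√(8 / (w.re ^ 2 + w.im ^ 2)), by positivity, by simpa using hr, ?_⟩
    generalize √(8 / (w.re ^ 2 + w.im ^ 2)) = s at hs
    rw [eq_div_iff hn.ne'] at hs
    simp [regK, regW]
    nlinarith [hμ.1]
  · have hn : 0 < z.re ^ 2 + z.im ^ 2 := by
      have := Complex.normSq_pos.2 hz
      rw [Complex.normSq_apply] at this
      linarith
    obtain ⟨y, hy⟩ : ∃ y, y = (z.re ^ 2 - z.im ^ 2) / (z.re ^ 2 + z.im ^ 2) := ⟨_, rfl⟩
    have hym : y ∈ Icc (-1 : ℝ) 1 := hy ▸ cos_double_mem hn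
    have hcont : ContinuousAt (radialPotential μ y) r₀ :=
      (hasDerivAt_radialPotential hr.ne' (dist_sq_pos hr hr1 hym)).continuousAt
    have hev := hcont.eventually (lt_mem_nhds (hc.trans_le (radialPotential_ge hμ hr hr1 hym)))
    have hev2 := (hev.and (lt_mem_nhds hr)).filter_mono (nhdsWithin_le_nhds (s := Iio r₀))
    obtain ⟨R, ⟨hRU, hR0⟩, hRr⟩ := (hev2.and self_mem_nhdsWithin).exists
    have hs := Real.sq_sqrt (show 0 ≤ R / (z.re ^ 2 + z.im ^ 2) by positivity)
    refine ⟨√(R / (z.re ^ 2 + z.im ^ 2)), by positivity, ?_⟩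
    generalize √(R / (z.re ^ 2 + z.im ^ 2)) = s at hs
    have hRs : R = (s * z.re) ^ 2 + (s * z.im) ^ 2 := by
      rw [mul_pow, mul_pow, ← mul_add, hs]; field_simp
    have hyR : y * R = (s * z.re) ^ 2 - (s * z.im) ^ 2 := by
      rw [mul_pow, mul_pow, ← mul_sub, hs, hy]; field_simp
    have hW := regW_eq_radial (μ := μ) (c := c) hRs hyR hR0
    have hre : (s • (z, w)).1.re = s * z.re := by simp
    have him : (s • (z, w)).1.im = s * z.im := by simp
    rw [regK, hre, him, ← hRs, hW]
    refine ⟨hRr, ?_⟩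
    have h1 : 4 * R * (c - radialPotential μ y R) ≤ 0 :=
      mul_nonpos_of_nonneg_of_nonpos (by positivity) (by linarith)
    have h2 : 0 ≤ ((s • (z, w)).2.re + 2 * R * (s * z.im)) ^ 2 +
      ((s • (z, w)).2.im - 2 * R * (s * z.re)) ^ 2 := by positivity
    linarith

lemma exists_regularized_chord_aux {μ c r₀ : ℝ} (hμ : μ ∈ Ioo (0 : ℝ) 1) (hr : 0 < r₀)
    (hr1 : r₀ < 1) (h0 : (1 - μ) / r₀ ^ 2 - r₀ + μ - μ / (1 - r₀) ^ 2 = 0)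
    (hc : c < radialPotential μ 1 r₀) {Θ : ℝ} (hΘ : 0 ≤ Θ) :
    ∃ (θ : ℝ → ℝ) (f : ℝ → ℂ × ℂ), ContinuousOn θ (Icc 0 1) ∧
      (∀ s ∈ Icc (0 : ℝ) 1, 0 < θ s ∧ Θ ≤ θ s) ∧
      (∀ s ∈ Icc (0 : ℝ) 1, f s ∈ {x : ℂ × ℂ | x.1.re ^ 2 + x.1.im ^ 2 < r₀} ∧
        regK μ c (f s) = 0 ∧
        HasDerivWithinAt f (θ s • (regQ (f s), -regP μ c (f s))) (Icc 0 1) s) ∧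
      (f 0).1 = 0 ∧ (f 1).1 = 0 := by
  refine exists_weighted_chord (V := ℂ) (K := regK μ c) (P := regP μ c) (Q := regQ)
    (Ω := {x : ℂ × ℂ | x.1.re ^ 2 + x.1.im ^ 2 < r₀}) ?_ ?_ ?_ ?_ ?_ ?_ ?_ ?_ ?_ hΘ
  · exact isOpen_lt (by fun_prop) continuous_const
  · intro x hx t ht
    simp only [mem_ofPred_eq] at hx ⊢
    have : (t • x).1.re ^ 2 + (t • x).1.im ^ 2 = t ^ 2 * (x.1.re ^ 2 + x.1.im ^ 2) := by
      simp; ring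
    rw [this]
    have : t ^ 2 ≤ 1 := by nlinarith [ht.1, ht.2]
    nlinarith [sq_nonneg x.1.re, sq_nonneg x.1.im]
  · intro x hx
    simpa using hx
  · intro x hx
    exact contDiffAt_regK (lt_trans hx hr1)
  · intro x
    have h1 : dist₁ (-x.1.re) (-x.1.im) = dist₁ x.1.re x.1.im := by simp [dist₁]
    simp only [regK, regW, Prod.fst_neg, Prod.snd_neg, Complex.neg_re, Complex.neg_im, h1]
    ring
  · simp [regK, regW]
    exact hμ.2
  · intro x hx hK
    exact regK_transversal hμ hr1 h0 hc hx hK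
  · intro x hx
    exact exists_regK_nonneg_ray hμ hr hr1 hc hx
  · intro x hx v
    rw [fderiv_regK (lt_trans hx hr1)]
    simp [Complex.inner]
    ring

/-- The regularized equations of motion on `[0,1]`, with a positive time weight `θ`. -/
structure RegularizedChord (μ c r₀ Θ : ℝ) where
  /-- time weight -/
  θ : ℝ → ℝ
  /-- regularized position -/
  z : ℝ → ℂ
  /-- regularized velocity -/
  v : ℝ → ℂ
  continuousOn_weight : ContinuousOn θ (Icc 0 1)
  weight_pos : ∀ s ∈ Icc (0 : ℝ) 1, 0 < θ s
  le_weight : ∀ s ∈ Icc (0 : ℝ) 1, Θ ≤ θ s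
  normSq_lt : ∀ s ∈ Icc (0 : ℝ) 1, Complex.normSq (z s) < r₀
  energy : ∀ s ∈ Icc (0 : ℝ) 1, Complex.normSq (v s) = 2 * regW μ c (z s).re (z s).im
  deriv_z : ∀ s ∈ Icc (0 : ℝ) 1, HasDerivWithinAt z (θ s * v s) (Icc 0 1) s
  deriv_v : ∀ s ∈ Icc (0 : ℝ) 1, HasDerivWithinAt v
    (θ s * ⟨8 * Complex.normSq (z s) * (v s).im + regWa μ c (z s).re (z s).im,
      -(8 * Complex.normSq (z s) * (v s).re) + regWb μ c (z s).re (z s).im⟩) (Icc 0 1) s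
  start : z 0 = 0
  finish : z 1 = 0

lemma hasDerivWithinAt_regQ {f : ℝ → ℂ × ℂ} {f' : ℂ × ℂ} {S : Set ℝ} {s : ℝ}
    (h : HasDerivWithinAt f f' S s) : HasDerivWithinAt (fun t => regQ (f t))
      (⟨f'.2.re + 2 * (2 * (f s).1.re * f'.1.re + 2 * (f s).1.im * f'.1.im) * (f s).1.im +
          2 * ((f s).1.re ^ 2 + (f s).1.im ^ 2) * f'.1.im,
        f'.2.im - 2 * (2 * (f s).1.re * f'.1.re + 2 * (f s).1.im * f'.1.im) * (f s).1.re -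
          2 * ((f s).1.re ^ 2 + (f s).1.im ^ 2) * f'.1.re⟩ : ℂ) S s := by
  have ha : HasDerivWithinAt (fun t => (f t).1.re) f'.1.re S s :=
    (Complex.reCLM.comp (ContinuousLinearMap.fst ℝ ℂ ℂ)).hasFDerivAt.comp_hasDerivWithinAt s h
  have hb : HasDerivWithinAt (fun t => (f t).1.im) f'.1.im S s :=
    (Complex.imCLM.comp (ContinuousLinearMap.fst ℝ ℂ ℂ)).hasFDerivAt.comp_hasDerivWithinAt s h
  have hp : HasDerivWithinAt (fun t => (f t).2.re) f'.2.re S s :=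
    (Complex.reCLM.comp (ContinuousLinearMap.snd ℝ ℂ ℂ)).hasFDerivAt.comp_hasDerivWithinAt s h
  have hq : HasDerivWithinAt (fun t => (f t).2.im) f'.2.im S s :=
    (Complex.imCLM.comp (ContinuousLinearMap.snd ℝ ℂ ℂ)).hasFDerivAt.comp_hasDerivWithinAt s h
  have hR := ((ha.fun_pow 2).fun_add (hb.fun_pow 2)).const_mul 2
  have h1 := hp.fun_add (hR.fun_mul hb)
  have h2 := hq.fun_sub (hR.fun_mul ha)
  have h3 := (Complex.equivRealProdCLM.symm.toContinuousLinearMap.hasFDerivAt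
    (x := ((f s).2.re + 2 * ((f s).1.re ^ 2 + (f s).1.im ^ 2) * (f s).1.im,
      (f s).2.im - 2 * ((f s).1.re ^ 2 + (f s).1.im ^ 2) * (f s).1.re))).comp_hasDerivWithinAt s
    (h1.prodMk h2)
  have h4 : (fun t => regQ (f t)) = Complex.equivRealProdCLM.symm.toContinuousLinearMap ∘
      fun t => ((f t).2.re + 2 * ((f t).1.re ^ 2 + (f t).1.im ^ 2) * (f t).1.im,
        (f t).2.im - 2 * ((f t).1.re ^ 2 + (f t).1.im ^ 2) * (f t).1.re) := by
    funext t
    apply Complex.ext <;> simp [regQ]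
  rw [h4]
  refine h3.congr_deriv ?_
  apply Complex.ext <;> simp <;> ring

theorem exists_regularizedChord {μ c r₀ : ℝ} (hμ : μ ∈ Ioo (0 : ℝ) 1) (hr : 0 < r₀)
    (hr1 : r₀ < 1) (h0 : (1 - μ) / r₀ ^ 2 - r₀ + μ - μ / (1 - r₀) ^ 2 = 0)
    (hc : c < radialPotential μ 1 r₀) {Θ : ℝ} (hΘ : 0 ≤ Θ) :
    Nonempty (RegularizedChord μ c r₀ Θ) := by
  obtain ⟨θ, f, hθ, hθp, hf, hf0, hf1⟩ := exists_regularized_chord_aux hμ hr hr1 h0 hc hΘ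
  refine ⟨⟨θ, fun s => (f s).1, fun s => regQ (f s), hθ, fun s hs => (hθp s hs).1,
    fun s hs => (hθp s hs).2, fun s hs => ?_, fun s hs => ?_, fun s hs => ?_, fun s hs => ?_,
    hf0, hf1⟩⟩
  · have := (hf s hs).1
    simp only [mem_ofPred_eq] at this
    rw [Complex.normSq_apply]
    linarith
  · have := (hf s hs).2.1
    rw [regK] at this
    rw [Complex.normSq_apply, regQ]
    linarith
  · have := (ContinuousLinearMap.fst ℝ ℂ ℂ).hasFDerivAt.comp_hasDerivWithinAt s (hf s hs).2.2
    refine this.congr_deriv ?_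
    simp
  · refine (hasDerivWithinAt_regQ (hf s hs).2.2).congr_deriv ?_
    rw [Complex.normSq_apply]
    apply Complex.ext
    · simp [regP]
      ring
    · simp [regP]
      ring

end RegularizedChord

section HillComponent

lemma nrm_sq (q : ℝ × ℝ) : nrm q ^ 2 = q.1 ^ 2 + q.2 ^ 2 := Real.sq_sqrt (by positivity)

lemma nrm_pos {q : ℝ × ℝ} (h : q ≠ (0, 0)) : 0 < nrm q := by
  have := sq_add_sq_pos_of_ne (x := q.1) (y := q.2) (a := 0) (by simpa using h)
  exact Real.sqrt_pos.2 (by simpa using this)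

lemma V_smul {μ R x t : ℝ} {q : ℝ × ℝ} (hR : R = nrm q) (hx : x * R = q.1) (ht : 0 < t) :
    V μ (t • q) = radialPotential μ x (t * R) := by
  have h2 : q.1 ^ 2 + q.2 ^ 2 = R ^ 2 := by rw [hR, nrm_sq]
  have hR0 : 0 ≤ R := hR ▸ Real.sqrt_nonneg _
  have e1 : nrm (t • q) = t * R := by
    rw [nrm, ← Real.sqrt_sq (show 0 ≤ t * R by positivity)]
    congr 1
    rw [mul_pow, ← h2]
    simp
    ring
  have e2 : nrm ((t • q).1 - 1, (t • q).2) = √((t * R) ^ 2 - 2 * x * (t * R) + 1) := by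
    rw [nrm]
    congr 1
    rw [mul_pow, ← h2, show 2 * x * (t * R) = 2 * t * q.1 by rw [← hx]; ring]
    simp
    ring
  rw [V, radialPotential, e1, e2]
  congr 3
  rw [mul_pow, ← h2, show 2 * μ * x * (t * R) = 2 * t * μ * q.1 by rw [← hx]; ring]
  simp
  ring

lemma cos_mem {R x : ℝ} {q : ℝ × ℝ} (hR : R = nrm q) (hR0 : 0 < R) (hx : x * R = q.1) :
    x ∈ Icc (-1 : ℝ) 1 := by
  have h2 : q.1 ^ 2 + q.2 ^ 2 = R ^ 2 := by rw [hR, nrm_sq]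
  have h3 : |q.1| ≤ R := abs_le_of_sq_le_sq (by nlinarith [sq_nonneg q.2]) hR0.le
  rw [← hx, abs_mul, abs_of_pos hR0] at h3
  have := abs_le.1 (le_of_mul_le_mul_right (by linarith : |x| * R ≤ 1 * R) hR0)
  exact this

lemma monotoneOn_radialPotential {μ r₀ x : ℝ} (hμ : μ ∈ Ioo (0 : ℝ) 1) (hr1 : r₀ < 1)
    (h0 : (1 - μ) / r₀ ^ 2 - r₀ + μ - μ / (1 - r₀) ^ 2 = 0) (hx : x ∈ Icc (-1 : ℝ) 1) :
    MonotoneOn (radialPotential μ x) (Ioo 0 r₀) := by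
  have hd : ∀ t ∈ Ioo 0 r₀, HasDerivAt (radialPotential μ x) (radialForce μ x t) t :=
    fun t ht => hasDerivAt_radialPotential ht.1.ne' (dist_sq_pos ht.1 (ht.2.trans hr1) hx)
  refine monotoneOn_of_deriv_nonneg (convex_Ioo _ _)
    (fun t ht => (hd t ht).continuousAt.continuousWithinAt) ?_ ?_
  · rw [interior_Ioo]
    exact fun t ht => (hd t ht).differentiableAt.differentiableWithinAt
  · rw [interior_Ioo]
    intro t ht
    rw [(hd t ht).deriv]
    exact (radialForce_pos hμ ht.1 (ht.2.trans hr1) hx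
      (collinear_balance_pos hμ ht.1 ht.2 hr1 h0)).le

theorem mem_KSet {μ c r₀ : ℝ} (hμ : μ ∈ Ioo (0 : ℝ) 1) (hr1 : r₀ < 1)
    (h0 : (1 - μ) / r₀ ^ 2 - r₀ + μ - μ / (1 - r₀) ^ 2 = 0) {q : ℝ × ℝ} (hq : q ≠ (0, 0))
    (hqr : nrm q < r₀) (hV : V μ q ≤ c) : q ∈ KSet μ c := by
  obtain ⟨R, hR⟩ : ∃ R, R = nrm q := ⟨_, rfl⟩
  have hR0 : 0 < R := hR ▸ nrm_pos hq
  obtain ⟨x, hxd⟩ : ∃ x, x = q.1 / R := ⟨_, rfl⟩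
  have hx : x * R = q.1 := by rw [hxd]; field_simp
  have hxm := cos_mem hR hR0 hx
  rw [← hR] at hqr
  have hmono := monotoneOn_radialPotential hμ hr1 h0 hxm
  have hseg : (fun t : ℝ => t • q) '' Ioc 0 1 ⊆ Hill μ c := by
    rintro _ ⟨t, ht, rfl⟩
    have hn : nrm (t • q) = t * R := by
      rw [nrm, ← Real.sqrt_sq (show 0 ≤ t * R from mul_nonneg ht.1.le hR0.le)]
      congr 1
      rw [mul_pow, hR, nrm_sq]
      simp
      ring
    refine ⟨?_, ?_, ?_⟩
    · exact smul_ne_zero ht.1.ne' hq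
    · intro h
      have h2 : t * R < 1 := by nlinarith [ht.1, ht.2]
      change t • q = (1, 0) at h
      rw [h] at hn
      simp [nrm] at hn
      linarith
    · change V μ (t • q) ≤ c
      rw [V_smul hR hx ht.1]
      refine le_trans ?_ hV
      have h1 : V μ q = radialPotential μ x (1 * R) := by
        rw [← V_smul hR hx one_pos, one_smul]
      rw [h1, one_mul]
      have h3 : t * R ≤ R := by nlinarith [ht.2]
      exact hmono ⟨mul_pos ht.1 hR0, by linarith⟩ ⟨hR0, hqr⟩ h3
  have hq1 : q ∈ (fun t : ℝ => t • q) '' Ioc 0 1 := ⟨1, by simp, by simp⟩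
  refine ⟨hseg hq1, ?_⟩
  have hpre : IsPreconnected ((fun t : ℝ => t • q) '' Ioc 0 1) :=
    isPreconnected_Ioc.image _ (by fun_prop)
  refine closure_mono (hpre.subset_connectedComponentIn hq1 hseg) ?_
  have : (nhdsWithin (0 : ℝ) (Ioc 0 1)).NeBot := mem_closure_iff_nhdsWithin_neBot.1 (by
    rw [closure_Ioc (by norm_num)]; exact ⟨le_rfl, zero_le_one⟩)
  refine mem_closure_of_tendsto (f := fun t : ℝ => t • q) (b := nhdsWithin 0 (Ioc 0 1)) ?_ ?_
  · have : Tendsto (fun t : ℝ => t • q) (nhds 0) (nhds ((0 : ℝ) • q)) :=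
      Continuous.tendsto (by fun_prop) 0
    rw [zero_smul] at this
    exact this.mono_left nhdsWithin_le_nhds
  · exact eventually_of_mem self_mem_nhdsWithin fun t ht => ⟨t, ht, rfl⟩

end HillComponent

section LeviCivita

/-- Acceleration in the rotating frame at position `q` and velocity `v`. -/
noncomputable def acc (μ : ℝ) (q v : ℝ × ℝ) : ℝ × ℝ :=
  (2 * v.2 - gradV1 μ q.1 q.2, -(2 * v.1) - gradV2 μ q.1 q.2)

lemma sqrt_norm_sq_square (a b : ℝ) :
    √((a ^ 2 - b ^ 2) ^ 2 + (2 * a * b) ^ 2) = a ^ 2 + b ^ 2 := by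
  rw [show (a ^ 2 - b ^ 2) ^ 2 + (2 * a * b) ^ 2 = (a ^ 2 + b ^ 2) ^ 2 by ring]
  exact Real.sqrt_sq (by positivity)

lemma regW_eq_V {μ c a b : ℝ} (h : 0 < a ^ 2 + b ^ 2) :
    regW μ c a b = 4 * (a ^ 2 + b ^ 2) * (c - V μ (a ^ 2 - b ^ 2, 2 * a * b)) := by
  simp only [V, nrm, sqrt_norm_sq_square, regW, dist₁]
  have := h.ne'
  generalize √((a ^ 2 - b ^ 2 - 1) ^ 2 + (2 * a * b) ^ 2) = d
  have e : (a ^ 2 + b ^ 2) * ((1 - μ) / (a ^ 2 + b ^ 2)) = 1 - μ := by field_simp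
  linear_combination (-4) * e

lemma regWa_eq_V {μ c a b : ℝ} (h : 0 < a ^ 2 + b ^ 2) :
    regWa μ c a b = 8 * a * (c - V μ (a ^ 2 - b ^ 2, 2 * a * b)) -
      8 * (a ^ 2 + b ^ 2) * (a * gradV1 μ (a ^ 2 - b ^ 2) (2 * a * b) +
        b * gradV2 μ (a ^ 2 - b ^ 2) (2 * a * b)) := by
  simp only [V, nrm, sqrt_norm_sq_square, regWa, dist₁, gradV1, gradV2]
  have := h.ne'
  generalize √((a ^ 2 - b ^ 2 - 1) ^ 2 + (2 * a * b) ^ 2) = d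
  have e : (a ^ 2 + b ^ 2) * (a * ((1 - μ) * (a ^ 2 - b ^ 2) / (a ^ 2 + b ^ 2) ^ 3) +
      b * ((1 - μ) * (2 * a * b) / (a ^ 2 + b ^ 2) ^ 3)) = a * ((1 - μ) / (a ^ 2 + b ^ 2)) := by
    field_simp
    ring
  linear_combination 8 * e

lemma regWb_eq_V {μ c a b : ℝ} (h : 0 < a ^ 2 + b ^ 2) :
    regWb μ c a b = 8 * b * (c - V μ (a ^ 2 - b ^ 2, 2 * a * b)) -
      8 * (a ^ 2 + b ^ 2) * (a * gradV2 μ (a ^ 2 - b ^ 2) (2 * a * b) -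
        b * gradV1 μ (a ^ 2 - b ^ 2) (2 * a * b)) := by
  simp only [V, nrm, sqrt_norm_sq_square, regWb, dist₁, gradV1, gradV2]
  have := h.ne'
  generalize √((a ^ 2 - b ^ 2 - 1) ^ 2 + (2 * a * b) ^ 2) = d
  have e : (a ^ 2 + b ^ 2) * (a * ((1 - μ) * (2 * a * b) / (a ^ 2 + b ^ 2) ^ 3) -
      b * ((1 - μ) * (a ^ 2 - b ^ 2) / (a ^ 2 + b ^ 2) ^ 3)) =
      b * ((1 - μ) / (a ^ 2 + b ^ 2)) := by
    field_simp
    ring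
  linear_combination 8 * e

/-- The Levi-Civita square, as a point of `ℝ × ℝ`. -/
def lcSq (a b : ℝ) : ℝ × ℝ := (a ^ 2 - b ^ 2, 2 * a * b)

/-- Velocity of the Levi-Civita square in physical time. -/
noncomputable def lcVel (a b p r : ℝ) : ℝ × ℝ :=
  ((a * p - b * r) / (2 * (a ^ 2 + b ^ 2)), (a * r + b * p) / (2 * (a ^ 2 + b ^ 2)))

lemma hasDerivAt_lcSq {a b : ℝ → ℝ} {p r t : ℝ} (h : 0 < a t ^ 2 + b t ^ 2)
    (ha : HasDerivAt a (p / (4 * (a t ^ 2 + b t ^ 2))) t)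
    (hb : HasDerivAt b (r / (4 * (a t ^ 2 + b t ^ 2))) t) :
    HasDerivAt (fun t => lcSq (a t) (b t)) (lcVel (a t) (b t) p r) t := by
  have h1 := (ha.fun_pow 2).fun_sub (hb.fun_pow 2)
  have h2 := (ha.const_mul 2).fun_mul hb
  refine (h1.prodMk h2).congr_deriv ?_
  have := h.ne'
  rw [lcVel]
  refine Prod.ext ?_ ?_
  · simp only []
    field_simp
    push_cast
    ring
  · simp only []
    field_simp
    ring

lemma hasDerivAt_lcVel {μ c : ℝ} {a b p r : ℝ → ℝ} {t : ℝ} (h : 0 < a t ^ 2 + b t ^ 2)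
    (ha : HasDerivAt a (p t / (4 * (a t ^ 2 + b t ^ 2))) t)
    (hb : HasDerivAt b (r t / (4 * (a t ^ 2 + b t ^ 2))) t)
    (hp : HasDerivAt p ((8 * (a t ^ 2 + b t ^ 2) * r t + regWa μ c (a t) (b t)) /
      (4 * (a t ^ 2 + b t ^ 2))) t)
    (hr : HasDerivAt r ((-(8 * (a t ^ 2 + b t ^ 2) * p t) + regWb μ c (a t) (b t)) /
      (4 * (a t ^ 2 + b t ^ 2))) t)
    (he : p t ^ 2 + r t ^ 2 = 2 * regW μ c (a t) (b t)) :
    HasDerivAt (fun t => lcVel (a t) (b t) (p t) (r t))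
      (acc μ (lcSq (a t) (b t)) (lcVel (a t) (b t) (p t) (r t))) t := by
  have hR := ((ha.fun_pow 2).fun_add (hb.fun_pow 2)).const_mul 2
  have h0 : 2 * (a t ^ 2 + b t ^ 2) ≠ 0 := by positivity
  have h1 := ((ha.fun_mul hp).fun_sub (hb.fun_mul hr)).fun_div hR h0
  have h2 := ((ha.fun_mul hr).fun_add (hb.fun_mul hp)).fun_div hR h0
  refine (h1.prodMk h2).congr_deriv ?_
  rw [regW_eq_V h] at he
  rw [regWa_eq_V h, regWb_eq_V h]
  simp only [lcVel, lcSq, acc]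
  have hE : c - V μ (a t ^ 2 - b t ^ 2, 2 * a t * b t) =
      (p t ^ 2 + r t ^ 2) / (8 * (a t ^ 2 + b t ^ 2)) := by
    rw [he]; field_simp; ring
  rw [hE]
  generalize gradV1 μ (a t ^ 2 - b t ^ 2) (2 * a t * b t) = g1
  generalize gradV2 μ (a t ^ 2 - b t ^ 2) (2 * a t * b t) = g2
  generalize a t = a at *
  generalize b t = b at *
  generalize p t = p at *
  generalize r t = r at *
  have := h.ne'
  refine Prod.ext ?_ ?_
  · simp only []
    field_simp
    push_cast
    ring
  · simp only []
    field_simp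
    push_cast
    ring

lemma lc_energy {μ c a b p r : ℝ} (h : 0 < a ^ 2 + b ^ 2)
    (he : p ^ 2 + r ^ 2 = 2 * regW μ c a b) :
    nrm (lcVel a b p r) ^ 2 / 2 + V μ (lcSq a b) = c := by
  rw [regW_eq_V h] at he
  have hE : c - V μ (a ^ 2 - b ^ 2, 2 * a * b) =
      (p ^ 2 + r ^ 2) / (8 * (a ^ 2 + b ^ 2)) := by
    rw [he]; field_simp; ring
  rw [nrm_sq, lcVel, lcSq, show V μ (a ^ 2 - b ^ 2, 2 * a * b) =
    c - (p ^ 2 + r ^ 2) / (8 * (a ^ 2 + b ^ 2)) by linarith]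
  field_simp
  ring

lemma nrm_lcSq (a b : ℝ) : nrm (lcSq a b) = a ^ 2 + b ^ 2 := sqrt_norm_sq_square a b

end LeviCivita

section CollisionArcs

/-- A trajectory starting and ending at `O`, regular away from finitely many collisions,
together with the integral `S` of `1 / (4 ‖q‖)`. -/
structure CollisionArc (μ c Θ : ℝ) where
  /-- final time -/
  L : ℝ
  /-- position -/
  q : ℝ → ℝ × ℝ
  /-- velocity -/
  q' : ℝ → ℝ × ℝ
  /-- regularized time -/
  S : ℝ → ℝ
  L_pos : 0 < L
  continuous_q : Continuous q
  continuous_S : Continuous S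
  q_zero : q 0 = (0, 0)
  q_L : q L = (0, 0)
  finite_zeros : {t ∈ Icc 0 L | q t = (0, 0)}.Finite
  deriv_q : ∀ t ∈ Icc 0 L, q t ≠ (0, 0) → HasDerivAt q (q' t) t
  deriv_q' : ∀ t ∈ Icc 0 L, q t ≠ (0, 0) → HasDerivAt q' (acc μ (q t) (q' t)) t
  deriv_S : ∀ t ∈ Icc 0 L, q t ≠ (0, 0) → HasDerivAt S (1 / (4 * nrm (q t))) t
  energy : ∀ t ∈ Icc 0 L, q t ≠ (0, 0) → nrm (q' t) ^ 2 / 2 + V μ (q t) = c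
  mem_KSet : ∀ t ∈ Icc 0 L, q t ≠ (0, 0) → q t ∈ KSet μ c
  direction : ∀ t ∈ Icc 0 L, q t = (0, 0) →
    ∃ u, Tendsto (fun t => (nrm (q t))⁻¹ • q t) (𝓝[Icc 0 L \ {t}] t) (𝓝 u)
  S_zero : S 0 = 0
  le_S : Θ ≤ S L

/-- Direction of the Levi-Civita square. -/
noncomputable def lcDir (z : ℂ) : ℝ × ℝ := (nrm (lcSq z.re z.im))⁻¹ • lcSq z.re z.im

lemma lcDir_smul {k : ℝ} (hk : k ≠ 0) (z : ℂ) : lcDir (k • z) = lcDir z := by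
  rw [lcDir, lcDir, nrm_lcSq, nrm_lcSq]
  have : (k • z).re ^ 2 + (k • z).im ^ 2 = k ^ 2 * (z.re ^ 2 + z.im ^ 2) := by simp; ring
  rw [this, mul_inv]
  refine Prod.ext ?_ ?_
  · simp [lcSq]
    field_simp
  · simp [lcSq]
    field_simp

lemma re_sq_add_im_sq_pos {z : ℂ} (h : z ≠ 0) : 0 < z.re ^ 2 + z.im ^ 2 := by
  have := Complex.normSq_pos.2 h
  rw [Complex.normSq_apply] at this
  linarith

lemma continuousAt_lcDir {z : ℂ} (h : z ≠ 0) : ContinuousAt lcDir z := by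
  have h1 := (re_sq_add_im_sq_pos h).ne'
  have h2 : lcDir = fun z : ℂ => (z.re ^ 2 + z.im ^ 2)⁻¹ • ((z.re ^ 2 - z.im ^ 2, 2 * z.re * z.im) : ℝ × ℝ) := by
    funext z
    rw [lcDir, nrm_lcSq, lcSq]
  rw [h2]
  have h3 : ContinuousAt (fun z : ℂ => (z.re ^ 2 + z.im ^ 2)⁻¹) z :=
    ContinuousAt.inv₀ (by fun_prop) h1
  exact h3.smul (by fun_prop)

lemma tendsto_lcDir {z : ℝ → ℂ} {w : ℂ} {D : Set ℝ} {s : ℝ} (h : HasDerivWithinAt z w D s)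
    (h0 : z s = 0) (hw : w ≠ 0) :
    Tendsto (fun t => lcDir (z t)) (𝓝[D \ {s}] s) (𝓝 (lcDir w)) := by
  have h1 := (continuousAt_lcDir hw).tendsto.comp (hasDerivWithinAt_iff_tendsto_slope.1 h)
  refine h1.congr' ?_
  filter_upwards [self_mem_nhdsWithin] with t ht
  have : t - s ≠ 0 := sub_ne_zero.2 ht.2
  rw [Function.comp_apply, slope_def_module, h0, sub_zero, lcDir_smul (inv_ne_zero this)]

lemma lcSq_eq_zero_iff {z : ℂ} : lcSq z.re z.im = (0, 0) ↔ z = 0 := by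
  constructor
  · intro h
    by_contra hz
    have h1 := re_sq_add_im_sq_pos hz
    rw [← nrm_lcSq, h] at h1
    simp [nrm] at h1
  · rintro rfl
    simp [lcSq]

namespace RegularizedChord

variable {μ c r₀ Θ : ℝ}

lemma weight_mul_v_ne_zero (γ : RegularizedChord μ c r₀ Θ) (hμ : μ ∈ Ioo (0 : ℝ) 1)
    {s : ℝ} (hs : s ∈ Icc (0 : ℝ) 1) (h : γ.z s = 0) : (γ.θ s : ℂ) * γ.v s ≠ 0 := by
  refine mul_ne_zero (by exact_mod_cast (γ.weight_pos s hs).ne') fun hv => ?_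
  have := γ.energy s hs
  rw [hv, h] at this
  simp [regW] at this
  linarith [hμ.2]

lemma finite_zeros (γ : RegularizedChord μ c r₀ Θ) (hμ : μ ∈ Ioo (0 : ℝ) 1) :
    {s ∈ Icc (0 : ℝ) 1 | γ.z s = 0}.Finite := by
  by_contra hinf
  obtain ⟨s, hs, hacc⟩ := Set.Infinite.exists_accPt_of_subset_isCompact hinf isCompact_Icc
    (sep_subset _ _)
  have hfr : ∃ᶠ t in 𝓝[Icc 0 1 \ {s}] s, γ.z t = 0 := by
    rw [accPt_iff_frequently] at hacc
    rw [frequently_nhdsWithin_iff]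
    exact hacc.mono fun t ht => ⟨ht.2.2, ht.2.1, ht.1⟩
  have hz : γ.z s = 0 := by
    have hcont : Tendsto γ.z (𝓝[Icc 0 1 \ {s}] s) (𝓝 (γ.z s)) :=
      (γ.deriv_z s hs).continuousWithinAt.tendsto.mono_left (nhdsWithin_mono _ sdiff_subset)
    by_contra hne
    exact hfr (hcont.eventually_ne hne)
  have hsl := hasDerivWithinAt_iff_tendsto_slope.1 (γ.deriv_z s hs)
  refine hfr ((hsl.eventually_ne (γ.weight_mul_v_ne_zero hμ hs hz)).mono fun t ht h0 => ht ?_)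
  simp [slope_def_module, h0, hz]

end RegularizedChord

/-- Projection of the line to the unit interval. -/
def clamp (s : ℝ) : ℝ := max 0 (min s 1)

lemma clamp_mem (s : ℝ) : clamp s ∈ Icc (0 : ℝ) 1 := ⟨le_max_left _ _, by simp [clamp]⟩

lemma clamp_of_mem {s : ℝ} (h : s ∈ Icc (0 : ℝ) 1) : clamp s = s := by
  rw [clamp, min_eq_left h.2, max_eq_right h.1]

lemma continuous_clamp : Continuous clamp := by unfold clamp; fun_prop

lemma clamp_eventuallyEq {s : ℝ} (h : s ∈ Ioo (0 : ℝ) 1) : ∀ᶠ t in 𝓝 s, clamp t = t := by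
  filter_upwards [Icc_mem_nhds h.1 h.2] with t ht using clamp_of_mem ht

lemma sub_clamp_mono : Monotone fun s => s - clamp s := by
  intro a b hab
  simp only [clamp]
  rcases le_total a 1 with h1 | h1 <;> rcases le_total b 1 with h2 | h2 <;>
    rcases le_total a 0 with h3 | h3 <;> rcases le_total b 0 with h4 | h4 <;>
    simp [h1, h2, h3, h4] <;> linarith

/-- A nonnegative continuous rate on `[0,1]` with finitely many zeros, integrated and extended
to a homeomorphism of the line. -/
lemma exists_time_change {lam : ℝ → ℝ} (hc : Continuous lam) (h0 : ∀ s, 0 ≤ lam s)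
    (hfin : {s ∈ Icc (0 : ℝ) 1 | lam s = 0}.Finite) :
    ∃ T : ℝ ≃ₜ ℝ, StrictMono T ∧ T 0 = 0 ∧ ∀ s ∈ Ioo (0 : ℝ) 1, HasDerivAt T (lam s) s := by
  set G : ℝ → ℝ := fun s => ∫ u in (0 : ℝ)..clamp s, lam u with hG
  have hintg : ∀ a b, IntervalIntegrable lam MeasureTheory.volume a b :=
    fun a b => hc.intervalIntegrable a b
  have hprim : ∀ s, HasDerivAt (fun s => ∫ u in (0 : ℝ)..s, lam u) (lam s) s :=
    fun s => intervalIntegral.integral_hasDerivAt_right (hintg _ _)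
      hc.stronglyMeasurable.stronglyMeasurableAtFilter hc.continuousAt
  have hpos : ∀ a b, a < b → 0 ≤ a → b ≤ 1 → 0 < ∫ u in a..b, lam u := by
    intro a b hab ha hb
    refine intervalIntegral.integral_pos hab hc.continuousOn (fun x _ => h0 x) ?_
    by_contra hcon
    push Not at hcon
    refine (Icc_infinite hab) (hfin.subset fun x hx => ⟨⟨ha.trans hx.1, hx.2.trans hb⟩, ?_⟩)
    exact le_antisymm (hcon x hx) (h0 x)
  have hdiff : ∀ a b, (∫ u in (0 : ℝ)..b, lam u) - ∫ u in (0 : ℝ)..a, lam u = ∫ u in a..b, lam u :=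
    fun a b => intervalIntegral.integral_interval_sub_left (hintg _ _) (hintg _ _)
  have hmono : ∀ a b, a ≤ b → G a ≤ G b := by
    intro a b hab
    have h1 : clamp a ≤ clamp b := by unfold clamp; gcongr
    rcases h1.eq_or_lt with h2 | h2
    · simp only [hG, h2]; exact le_rfl
    · have := hpos _ _ h2 (clamp_mem a).1 (clamp_mem b).2
      rw [← hdiff] at this
      simp only [hG]
      linarith
  have hstrict : StrictMono fun s => G s + (s - clamp s) := by
    intro a b hab
    have h1 := hmono a b hab.le
    have h2 := sub_clamp_mono hab.le
    simp only at h2 ⊢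
    rcases h2.eq_or_lt with h3 | h3
    · have h4 : clamp a < clamp b := by linarith
      have := hpos _ _ h4 (clamp_mem a).1 (clamp_mem b).2
      rw [← hdiff] at this
      simp only [hG]
      linarith
    · linarith
  have hGc : Continuous G :=
    (continuous_iff_continuousAt.2 fun s => (hprim s).continuousAt).comp continuous_clamp
  have hcont : Continuous fun s => G s + (s - clamp s) :=
    hGc.add (continuous_id.sub continuous_clamp)
  have hG0 : ∀ s, s ≤ 0 → G s = 0 := by
    intro s hs
    have : clamp s = 0 := by
      unfold clamp; exact max_eq_left ((min_le_left _ _).trans hs)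
    simp only [hG, this, intervalIntegral.integral_same]
  have htop : Tendsto (fun s => G s + (s - clamp s)) atTop atTop := by
    refine tendsto_atTop_mono' (f₁ := fun s : ℝ => s - 1) _ ?_ (tendsto_atTop_add_const_right _ _ tendsto_id)
    filter_upwards [eventually_ge_atTop 0] with s hs
    have := hmono 0 s hs
    rw [hG0 0 le_rfl] at this
    linarith [(clamp_mem s).2]
  have hbot : Tendsto (fun s => G s + (s - clamp s)) atBot atBot := by
    refine tendsto_atBot_mono' (f₁ := fun s : ℝ => s) _ ?_ tendsto_id
    filter_upwards [eventually_le_atBot 0] with s hs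
    rw [hG0 s hs]
    linarith [(clamp_mem s).1]
  have hsurj := hcont.surjective htop hbot
  refine ⟨(StrictMono.orderIsoOfSurjective (α := ℝ) (β := ℝ) _ hstrict hsurj).toHomeomorph, hstrict, ?_, fun s hs => ?_⟩
  · change G 0 + (0 - clamp 0) = 0
    rw [hG0 0 le_rfl, clamp_of_mem ⟨le_rfl, zero_le_one⟩]
    simp
  · refine (hprim s).congr_of_eventuallyEq ?_
    filter_upwards [clamp_eventuallyEq hs] with t ht
    change G t + (t - clamp t) = _
    simp only [hG, ht]
    ring

end CollisionArcs

section ArcConstruction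

/-- A regularized chord yields a collision arc by passing to physical time. -/
theorem RegularizedChord.exists_collisionArc {μ c r₀ Θ : ℝ} (hμ : μ ∈ Ioo (0 : ℝ) 1)
    (hr1 : r₀ < 1) (h0 : (1 - μ) / r₀ ^ 2 - r₀ + μ - μ / (1 - r₀) ^ 2 = 0)
    (γ : RegularizedChord μ c r₀ Θ) : Nonempty (CollisionArc μ c Θ) := by
  have hθc : Continuous fun s => γ.θ (clamp s) :=
    γ.continuousOn_weight.comp_continuous continuous_clamp clamp_mem
  have hzc : Continuous fun s => γ.z (clamp s) :=
    ContinuousOn.comp_continuous (fun s hs => (γ.deriv_z s hs).continuousWithinAt)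
      continuous_clamp clamp_mem
  set R : ℝ → ℝ := fun s => (γ.z (clamp s)).re ^ 2 + (γ.z (clamp s)).im ^ 2 with hR
  have hRc : Continuous R :=
    ((Complex.continuous_re.comp hzc).pow 2).add ((Complex.continuous_im.comp hzc).pow 2)
  have hR0 : ∀ s, γ.z (clamp s) ≠ 0 → 0 < R s := fun s hs => re_sq_add_im_sq_pos hs
  have hθ0 : ∀ s, 0 < γ.θ (clamp s) := fun s => γ.weight_pos _ (clamp_mem s)
  have hnorm : ∀ z : ℂ, Complex.normSq z = z.re ^ 2 + z.im ^ 2 := fun z => by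
    rw [Complex.normSq_apply]; ring
  obtain ⟨T, hTm, hT0, hTd⟩ := exists_time_change (lam := fun s => 4 * R s * γ.θ (clamp s))
    (by fun_prop) (fun s => by have := hθ0 s; positivity) (by
      refine (γ.finite_zeros hμ).subset fun s hs => ⟨hs.1, ?_⟩
      by_contra hz
      have h1 := hR0 s (by rwa [clamp_of_mem hs.1])
      have h2 := hθ0 s
      have h3 : 4 * R s * γ.θ (clamp s) = 0 := hs.2
      have : 0 < 4 * R s * γ.θ (clamp s) := by positivity
      linarith)
  set σ : ℝ → ℝ := fun t => T.symm t with hσ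
  have hσc : Continuous σ := T.symm.continuous
  have hTσ : ∀ t, T (σ t) = t := fun t => T.apply_symm_apply t
  have hσmem : ∀ t ∈ Icc 0 (T 1), σ t ∈ Icc (0 : ℝ) 1 := by
    intro t ht
    constructor
    · rw [← hTm.le_iff_le, hTσ, hT0]; exact ht.1
    · rw [← hTm.le_iff_le, hTσ]; exact ht.2
  have hσ0 : σ 0 = 0 := by rw [← hTm.injective.eq_iff, hTσ, hT0]
  have hσL : σ (T 1) = 1 := T.symm_apply_apply 1
  set q : ℝ → ℝ × ℝ := fun t => lcSq (γ.z (clamp (σ t))).re (γ.z (clamp (σ t))).im with hq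
  have hqz : ∀ t ∈ Icc 0 (T 1), (q t = (0, 0) ↔ γ.z (σ t) = 0) := by
    intro t ht
    rw [hq, lcSq_eq_zero_iff, clamp_of_mem (hσmem t ht)]
  have hintg : ∀ t ∈ Icc 0 (T 1), q t ≠ (0, 0) → σ t ∈ Ioo (0 : ℝ) 1 := by
    intro t ht hne
    rw [Ne, hqz t ht] at hne
    have h1 := hσmem t ht
    refine ⟨lt_of_le_of_ne h1.1 fun h => hne ?_, lt_of_le_of_ne h1.2 fun h => hne ?_⟩
    · rw [← h]; exact γ.start
    · rw [h]; exact γ.finish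
  have hz0 : ∀ t ∈ Icc 0 (T 1), q t ≠ (0, 0) → γ.z (clamp (σ t)) ≠ 0 := by
    intro t ht hne
    rwa [clamp_of_mem (hσmem t ht), Ne, ← hqz t ht]
  have hσd : ∀ t ∈ Icc 0 (T 1), q t ≠ (0, 0) →
      HasDerivAt σ (4 * R (σ t) * γ.θ (clamp (σ t)))⁻¹ t := by
    intro t ht hne
    have h1 := hR0 _ (hz0 t ht hne)
    have h2 := hθ0 (σ t)
    exact HasDerivAt.of_local_left_inverse hσc.continuousAt (hTd _ (hintg t ht hne))
      (by positivity) (Eventually.of_forall hTσ)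
  have hzd : ∀ t ∈ Icc 0 (T 1), q t ≠ (0, 0) → HasDerivAt (fun t => γ.z (clamp (σ t)))
      (((4 * R (σ t))⁻¹ : ℝ) • γ.v (clamp (σ t))) t := by
    intro t ht hne
    have hs := hintg t ht hne
    have h1 := ((γ.deriv_z (σ t) (Ioo_subset_Icc_self hs)).hasDerivAt (Icc_mem_nhds hs.1 hs.2))
    have h2 : HasDerivAt (fun s => γ.z (clamp s)) (γ.θ (σ t) * γ.v (σ t)) (σ t) :=
      h1.congr_of_eventuallyEq ((clamp_eventuallyEq hs).mono fun s hs => by simp only [hs])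
    refine (h2.scomp t (hσd t ht hne)).congr_deriv ?_
    rw [clamp_of_mem (hσmem t ht)]
    have h3 := hR0 _ (hz0 t ht hne)
    have h4 := hθ0 (σ t)
    rw [clamp_of_mem (hσmem t ht)] at h4
    apply Complex.ext
    · simp
      field_simp
    · simp
      field_simp
  have hvd : ∀ t ∈ Icc 0 (T 1), q t ≠ (0, 0) → HasDerivAt (fun t => γ.v (clamp (σ t)))
      (((4 * R (σ t))⁻¹ : ℝ) • (⟨8 * R (σ t) * (γ.v (clamp (σ t))).im +
          regWa μ c (γ.z (clamp (σ t))).re (γ.z (clamp (σ t))).im,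
        -(8 * R (σ t) * (γ.v (clamp (σ t))).re) +
          regWb μ c (γ.z (clamp (σ t))).re (γ.z (clamp (σ t))).im⟩ : ℂ)) t := by
    intro t ht hne
    have hs := hintg t ht hne
    have h1 := ((γ.deriv_v (σ t) (Ioo_subset_Icc_self hs)).hasDerivAt (Icc_mem_nhds hs.1 hs.2))
    have h2 := h1.congr_of_eventuallyEq (f₁ := fun s => γ.v (clamp s))
      ((clamp_eventuallyEq hs).mono fun s hs => by simp only [hs])
    refine (h2.scomp t (hσd t ht hne)).congr_deriv ?_
    have h3 := hR0 _ (hz0 t ht hne)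
    have h4 := hθ0 (σ t)
    have h5 : R (σ t) = Complex.normSq (γ.z (σ t)) := by
      rw [hnorm, hR]; simp only [clamp_of_mem (hσmem t ht)]
    rw [h5] at *
    rw [clamp_of_mem (hσmem t ht)] at *
    generalize Complex.normSq (γ.z (σ t)) = ρ at *
    apply Complex.ext
    · simp
      field_simp
    · simp
      field_simp
  have hre : ∀ {f : ℝ → ℂ} {f' : ℂ} {t : ℝ}, HasDerivAt f f' t →
      HasDerivAt (fun t => (f t).re) f'.re t := fun h =>
    Complex.reCLM.hasFDerivAt.comp_hasDerivAt _ h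
  have him : ∀ {f : ℝ → ℂ} {f' : ℂ} {t : ℝ}, HasDerivAt f f' t →
      HasDerivAt (fun t => (f t).im) f'.im t := fun h =>
    Complex.imCLM.hasFDerivAt.comp_hasDerivAt _ h
  have hsmre : ∀ (k : ℝ) (z : ℂ), (k⁻¹ • z).re = z.re / k := fun k z => by
    rw [Complex.smul_re, smul_eq_mul, div_eq_inv_mul]
  have hsmim : ∀ (k : ℝ) (z : ℂ), (k⁻¹ • z).im = z.im / k := fun k z => by
    rw [Complex.smul_im, smul_eq_mul, div_eq_inv_mul]
  have hen : ∀ t ∈ Icc 0 (T 1), (γ.v (clamp (σ t))).re ^ 2 + (γ.v (clamp (σ t))).im ^ 2 =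
      2 * regW μ c (γ.z (clamp (σ t))).re (γ.z (clamp (σ t))).im := by
    intro t ht
    rw [← hnorm]
    exact γ.energy _ (clamp_mem _)
  have hqc : Continuous q := by
    have h1 : Continuous fun t => γ.z (clamp (σ t)) := hzc.comp hσc
    have h2 := Complex.continuous_re.comp h1
    have h3 := Complex.continuous_im.comp h1
    exact ((h2.pow 2).sub (h3.pow 2)).prodMk ((continuous_const.mul h2).mul h3)
  have hprim : ∀ s, HasDerivAt (fun s => ∫ u in (0 : ℝ)..s, γ.θ (clamp u)) (γ.θ (clamp s)) s :=
    fun s => intervalIntegral.integral_hasDerivAt_right (hθc.intervalIntegrable _ _)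
      hθc.stronglyMeasurable.stronglyMeasurableAtFilter hθc.continuousAt
  have henergy : ∀ t ∈ Icc 0 (T 1), q t ≠ (0, 0) →
      nrm (lcVel (γ.z (clamp (σ t))).re (γ.z (clamp (σ t))).im (γ.v (clamp (σ t))).re
        (γ.v (clamp (σ t))).im) ^ 2 / 2 + V μ (q t) = c := fun t ht hne =>
    lc_energy (hR0 _ (hz0 t ht hne)) (hen t ht)
  refine ⟨{
    L := T 1
    q := q
    q' := fun t => lcVel (γ.z (clamp (σ t))).re (γ.z (clamp (σ t))).im (γ.v (clamp (σ t))).re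
      (γ.v (clamp (σ t))).im
    S := fun t => ∫ u in (0 : ℝ)..σ t, γ.θ (clamp u)
    L_pos := hT0 ▸ hTm one_pos
    continuous_q := hqc
    continuous_S := (continuous_iff_continuousAt.2 fun s => (hprim s).continuousAt).comp hσc
    q_zero := ?_
    q_L := ?_
    finite_zeros := ?_
    deriv_q := ?_
    deriv_q' := ?_
    deriv_S := ?_
    energy := henergy
    mem_KSet := ?_
    direction := ?_
    S_zero := ?_
    le_S := ?_ }⟩
  · rw [hqz 0 ⟨le_rfl, hT0 ▸ (hTm one_pos).le⟩, hσ0, γ.start]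
  · rw [hqz _ ⟨hT0 ▸ (hTm one_pos).le, le_rfl⟩, hσL, γ.finish]
  · refine ((γ.finite_zeros hμ).image T).subset fun t ht => ⟨σ t, ⟨hσmem t ht.1, ?_⟩, hTσ t⟩
    exact (hqz t ht.1).1 ht.2
  · intro t ht hne
    refine hasDerivAt_lcSq (hR0 _ (hz0 t ht hne)) ?_ ?_
    · exact (hre (hzd t ht hne)).congr_deriv (hsmre _ _)
    · exact (him (hzd t ht hne)).congr_deriv (hsmim _ _)
  · intro t ht hne
    refine hasDerivAt_lcVel (hR0 _ (hz0 t ht hne)) ?_ ?_ ?_ ?_ (hen t ht)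
    · exact (hre (hzd t ht hne)).congr_deriv (hsmre _ _)
    · exact (him (hzd t ht hne)).congr_deriv (hsmim _ _)
    · exact (hre (hvd t ht hne)).congr_deriv (hsmre _ _)
    · exact (him (hvd t ht hne)).congr_deriv (hsmim _ _)
  · intro t ht hne
    refine ((hprim (σ t)).comp t (hσd t ht hne)).congr_deriv ?_
    have h3 := hR0 _ (hz0 t ht hne)
    have h4 := hθ0 (σ t)
    rw [hq, nrm_lcSq]
    change _ = 1 / (4 * R (σ t))
    field_simp
  · intro t ht hne
    refine mem_KSet hμ hr1 h0 hne ?_ ?_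
    · rw [hq, nrm_lcSq, ← hnorm]
      exact γ.normSq_lt _ (clamp_mem _)
    · have := henergy t ht hne
      nlinarith [sq_nonneg (nrm (lcVel (γ.z (clamp (σ t))).re (γ.z (clamp (σ t))).im
        (γ.v (clamp (σ t))).re (γ.v (clamp (σ t))).im))]
  · intro t ht h0
    have hs := hσmem t ht
    have hz := (hqz t ht).1 h0
    have h1 := tendsto_lcDir (γ.deriv_z (σ t) hs) hz (γ.weight_mul_v_ne_zero hμ hs hz)
    refine ⟨_, (h1.comp (f := σ) (x := 𝓝[Icc 0 (T 1) \ {t}] t) ?_).congr' ?_⟩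
    · refine tendsto_nhdsWithin_of_tendsto_nhds_of_eventually_within _
        (hσc.continuousAt.tendsto.mono_left nhdsWithin_le_nhds) ?_
      filter_upwards [self_mem_nhdsWithin] with u hu
      exact ⟨hσmem u hu.1, fun h => hu.2 (T.symm.injective h)⟩
    · filter_upwards [self_mem_nhdsWithin] with u hu
      rw [Function.comp_apply, lcDir, hq]
      simp only [clamp_of_mem (hσmem u hu.1)]
  · simp [hσ0]
  · simp only [hσL]
    have h1 : ∫ _ in (0 : ℝ)..1, Θ ≤ ∫ u in (0 : ℝ)..1, γ.θ (clamp u) :=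
      intervalIntegral.integral_mono_on zero_le_one (by simp) (hθc.intervalIntegrable _ _)
        fun u _ => γ.le_weight _ (clamp_mem u)
    simpa using h1

end ArcConstruction

section Pieces

/-- A finite subset of `[a,b]` containing the endpoints can be listed increasingly. -/
lemma exists_increasing_listing {F : Set ℝ} (hF : F.Finite) {a b : ℝ} (ha : a ∈ F)
    (hb : b ∈ F) (hsub : F ⊆ Icc a b) :
    ∃ (p : ℕ) (s : ℕ → ℝ), s 0 = a ∧ s p = b ∧ (∀ i ≤ p, s i ∈ F) ∧
      (∀ i j, i < j → j ≤ p → s i < s j) ∧ ∀ i < p, ∀ t ∈ Ioo (s i) (s (i + 1)), t ∉ F := by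
  obtain ⟨E, rfl⟩ := hF.exists_finset_coe
  have hne : 0 < E.card := Finset.card_pos.2 ⟨a, ha⟩
  obtain ⟨p, hp⟩ : ∃ p, E.card = p + 1 := ⟨E.card - 1, by omega⟩
  set e := E.orderEmbOfFin hp with he
  have hmem : ∀ i, e i ∈ (E : Set ℝ) := fun i => E.orderEmbOfFin_mem hp i
  have hex : ∀ t ∈ (E : Set ℝ), ∃ i, e i = t := by
    intro t ht
    have : t ∈ Set.range (E.orderEmbOfFin hp) := by rw [Finset.range_orderEmbOfFin]; exact ht
    exact this
  have hval : ∀ i (hi : i ≤ p), (fun i => e ⟨min i p, by omega⟩) i = e ⟨i, by omega⟩ := by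
    intro i hi
    simp only [min_eq_left hi]
  refine ⟨p, fun i => e ⟨min i p, by omega⟩, ?_, ?_, fun i _ => hmem _, ?_, ?_⟩
  · rw [hval 0 (Nat.zero_le _)]
    refine le_antisymm ?_ (hsub (hmem _)).1
    obtain ⟨i, hi⟩ := hex a ha
    rw [← hi]
    exact e.monotone (Fin.mk_le_of_le_val (Nat.zero_le _))
  · rw [hval p le_rfl]
    refine le_antisymm (hsub (hmem _)).2 ?_
    obtain ⟨i, hi⟩ := hex b hb
    rw [← hi]
    exact e.monotone (Fin.le_def.2 (Nat.lt_succ_iff.1 i.2))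
  · intro i j hij hj
    rw [hval i (hij.le.trans hj), hval j hj]
    exact e.strictMono (Fin.mk_lt_mk.2 hij)
  · intro i hi t ht htF
    rw [hval i hi.le, hval (i + 1) hi] at ht
    obtain ⟨j, rfl⟩ := hex t htF
    have h1 := e.lt_iff_lt.1 ht.1
    have h2 := e.lt_iff_lt.1 ht.2
    rw [Fin.lt_def] at h1 h2
    simp only at h1 h2
    omega

lemma continuousAt_gradV {μ : ℝ} {q : ℝ × ℝ} (h0 : q ≠ (0, 0)) (h1 : q ≠ (1, 0)) :
    ContinuousAt (fun q : ℝ × ℝ => gradV1 μ q.1 q.2) q ∧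
      ContinuousAt (fun q : ℝ × ℝ => gradV2 μ q.1 q.2) q := by
  have e0 : √(q.1 ^ 2 + q.2 ^ 2) ^ 3 ≠ 0 := by
    have := sq_add_sq_pos_of_ne (x := q.1) (y := q.2) (a := 0) h0
    rw [sub_zero] at this
    have := Real.sqrt_pos.2 this
    positivity
  have e1 : √((q.1 - 1) ^ 2 + q.2 ^ 2) ^ 3 ≠ 0 := by
    have := Real.sqrt_pos.2 (sq_add_sq_pos_of_ne (x := q.1) (y := q.2) (a := 1) h1)
    positivity
  unfold gradV1 gradV2
  constructor <;>
  · refine (ContinuousAt.add (ContinuousAt.add (by fun_prop) ?_) ?_)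
    · exact ContinuousAt.div (by fun_prop) (by fun_prop) e1
    · exact ContinuousAt.div (by fun_prop) (by fun_prop) e0

lemma continuousAt_acc {μ t : ℝ} {q v : ℝ → ℝ × ℝ} (hq : ContinuousAt q t)
    (hv : ContinuousAt v t) (h0 : q t ≠ (0, 0)) (h1 : q t ≠ (1, 0)) :
    ContinuousAt (fun t => acc μ (q t) (v t)) t := by
  obtain ⟨g1, g2⟩ := continuousAt_gradV (μ := μ) h0 h1
  have e1 : ContinuousAt (fun t => gradV1 μ (q t).1 (q t).2) t :=
    ContinuousAt.comp (g := fun q : ℝ × ℝ => gradV1 μ q.1 q.2) g1 hq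
  have e2 : ContinuousAt (fun t => gradV2 μ (q t).1 (q t).2) t :=
    ContinuousAt.comp (g := fun q : ℝ × ℝ => gradV2 μ q.1 q.2) g2 hq
  unfold acc
  exact ((hv.snd.const_mul 2).sub e1).prodMk ((hv.fst.const_mul 2).neg.sub e2)

lemma acc_eq_fderiv {μ : ℝ} {q v : ℝ × ℝ} (h0 : q ≠ (0, 0)) (h1 : q ≠ (1, 0)) :
    (acc μ q v).1 - 2 * v.2 = -((fderiv ℝ (V μ) q) (1, 0)) ∧
      (acc μ q v).2 + 2 * v.1 = -((fderiv ℝ (V μ) q) (0, 1)) := by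
  obtain ⟨e1, e2⟩ := fderiv_V (μ := μ) h0 h1
  rw [e1, e2, acc]
  constructor <;> dsimp only <;> ring

lemma ne_zero_and_ne_one_of_mem_KSet {μ c : ℝ} {q : ℝ × ℝ} (h : q ∈ KSet μ c) :
    q ≠ (0, 0) ∧ q ≠ (1, 0) := ⟨h.1.1, h.1.2.1⟩

/-- Restriction of a path to `(a, b)`, shifted to start at time zero and extended by zero. -/
noncomputable def piece (q : ℝ → ℝ × ℝ) (a b : ℝ) (u : ℝ) : ℝ × ℝ := by
  classical exact if u ∈ Ioo 0 (b - a) then q (a + u) else (0, 0)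

lemma piece_of_mem {q : ℝ → ℝ × ℝ} {a b u : ℝ} (h : u ∈ Ioo 0 (b - a)) :
    piece q a b u = q (a + u) := by rw [piece, if_pos h]

lemma piece_of_notMem {q : ℝ → ℝ × ℝ} {a b u : ℝ} (h : u ∉ Ioo 0 (b - a)) :
    piece q a b u = (0, 0) := by rw [piece, if_neg h]

namespace CollisionArc

variable {μ c Θ : ℝ}

lemma isCCO_piece (γ : CollisionArc μ c Θ) {a b : ℝ} (ha : 0 ≤ a) (hab : a < b) (hb : b ≤ γ.L)
    (hqa : γ.q a = (0, 0)) (hqb : γ.q b = (0, 0)) (hne : ∀ t ∈ Ioo a b, γ.q t ≠ (0, 0)) :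
    IsCCO μ c (b - a) (piece γ.q a b) := by
  have hm : ∀ u ∈ Ioo 0 (b - a), a + u ∈ Icc 0 γ.L := fun u hu =>
    ⟨by linarith [hu.1], by linarith [hu.2]⟩
  have hn : ∀ u ∈ Ioo 0 (b - a), γ.q (a + u) ≠ (0, 0) := fun u hu =>
    hne _ ⟨by linarith [hu.1], by linarith [hu.2]⟩
  have hev : ∀ u ∈ Ioo 0 (b - a), piece γ.q a b =ᶠ[𝓝 u] fun u => γ.q (a + u) := fun u hu => by
    filter_upwards [Ioo_mem_nhds hu.1 hu.2] with w hw using piece_of_mem hw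
  have hcont : Continuous fun u => γ.q (a + u) := γ.continuous_q.comp (by fun_prop)
  refine ⟨by linarith, fun u => γ.q' (a + u), fun u => acc μ (γ.q (a + u)) (γ.q' (a + u)),
    fun u hu => ?_, fun u hu => ?_, fun u hu => ?_, fun u hu => ?_, fun u hu => ?_, fun u hu => ?_,
    ?_, ?_⟩
  · exact ((γ.deriv_q _ (hm u hu) (hn u hu)).comp_const_add a u).congr_of_eventuallyEq (hev u hu)
  · exact (γ.deriv_q' _ (hm u hu) (hn u hu)).comp_const_add a u
  · obtain ⟨h0, h1⟩ := ne_zero_and_ne_one_of_mem_KSet (γ.mem_KSet _ (hm u hu) (hn u hu))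
    exact (continuousAt_acc (q := fun u => γ.q (a + u)) (v := fun u => γ.q' (a + u))
      hcont.continuousAt
      ((γ.deriv_q' _ (hm u hu) (hn u hu)).comp_const_add a u).continuousAt h0 h1).continuousWithinAt
  · rw [piece_of_mem hu]
    exact γ.mem_KSet _ (hm u hu) (hn u hu)
  · rw [piece_of_mem hu]
    obtain ⟨h0, h1⟩ := ne_zero_and_ne_one_of_mem_KSet (γ.mem_KSet _ (hm u hu) (hn u hu))
    exact acc_eq_fderiv h0 h1
  · rw [piece_of_mem hu]
    exact γ.energy _ (hm u hu) (hn u hu)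
  · have h1 : Tendsto (fun u => γ.q (a + u)) (𝓝[>] 0) (𝓝 (0, 0)) := by
      have := (hcont.tendsto 0).mono_left (nhdsWithin_le_nhds (s := Ioi 0))
      rwa [add_zero, hqa] at this
    refine h1.congr' ?_
    filter_upwards [Ioo_mem_nhdsGT (show (0 : ℝ) < b - a by linarith)] with u hu
    exact (piece_of_mem hu).symm
  · have h1 : Tendsto (fun u => γ.q (a + u)) (𝓝[<] (b - a)) (𝓝 (0, 0)) := by
      have := (hcont.tendsto (b - a)).mono_left (nhdsWithin_le_nhds (s := Iio (b - a)))
      rwa [add_sub_cancel, hqb] at this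
    refine h1.congr' ?_
    filter_upwards [Ioo_mem_nhdsLT (show (0 : ℝ) < b - a by linarith)] with u hu
    exact (piece_of_mem hu).symm

lemma integral_piece (γ : CollisionArc μ c Θ) {a b : ℝ} (ha : 0 ≤ a) (hab : a < b) (hb : b ≤ γ.L)
    (hne : ∀ t ∈ Ioo a b, γ.q t ≠ (0, 0)) :
    ∫ u in (0 : ℝ)..(b - a), 1 / (4 * nrm (piece γ.q a b u)) = γ.S b - γ.S a := by
  have hcont : ContinuousOn (fun u => γ.S (a + u)) (Icc 0 (b - a)) :=
    (γ.continuous_S.comp (by fun_prop)).continuousOn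
  have hd : ∀ u ∈ Ioo 0 (b - a), HasDerivAt (fun u => γ.S (a + u))
      (1 / (4 * nrm (piece γ.q a b u))) u := by
    intro u hu
    rw [piece_of_mem hu]
    exact (γ.deriv_S _ ⟨by linarith [hu.1], by linarith [hu.2]⟩
      (hne _ ⟨by linarith [hu.1], by linarith [hu.2]⟩)).comp_const_add a u
  have hab' : 0 ≤ b - a := by linarith
  have hintg := intervalIntegral.integrableOn_deriv_of_nonneg hcont hd fun u _ => by
    have : 0 ≤ nrm (piece γ.q a b u) := Real.sqrt_nonneg _
    positivity
  have := intervalIntegral.integral_eq_sub_of_hasDerivAt_of_le hab' hcont hd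
    ((intervalIntegrable_iff_integrableOn_Ioc_of_le hab').2 hintg)
  rw [this]
  simp

end CollisionArc

end Pieces

section Conclusion

/-- If a path repeats on `[b, b + τ)` what it did on `[a, a + τ)`, its periodic extension from
`[a, b)` locally agrees with translates of the path. -/
lemma exists_periodic_extension {q : ℝ → ℝ × ℝ} {a b τ : ℝ} (hτ : 0 < τ) (hab : a + τ ≤ b)
    (heq : ∀ u ∈ Ico 0 τ, q (b + u) = q (a + u)) :
    ∃ Q : ℝ → ℝ × ℝ, (∀ t, Q (t + (b - a)) = Q t) ∧ Q a = q a ∧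
      ∀ t₀, ∃ m, t₀ - m ∈ Ioc a b ∧ Q =ᶠ[𝓝 t₀] fun t => q (t - m) := by
  have hT : 0 < b - a := by linarith
  have hper : ∀ (n : ℤ) t, q (toIcoMod hT a t) = q (toIcoMod hT a (t - n • (b - a))) := by
    intro n t
    rw [toIcoMod_sub_zsmul]
  have hself : ∀ w ∈ Ico a b, toIcoMod hT a w = w := by
    intro w hw
    rw [toIcoMod_eq_self]
    exact ⟨hw.1, by linarith [hw.2]⟩
  have hloc : ∀ w ∈ Ioo a (b + τ), q (toIcoMod hT a w) = q w := by
    intro w hw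
    rcases lt_or_ge w b with h | h
    · rw [hself w ⟨hw.1.le, h⟩]
    · have h1 : toIcoMod hT a w = w - (b - a) := by
        rw [← toIcoMod_sub hT a w]
        exact hself _ ⟨by linarith, by linarith [hw.2]⟩
      have h2 := heq (w - b) ⟨by linarith, by linarith [hw.2]⟩
      rw [h1, show w - (b - a) = a + (w - b) by ring, ← h2]
      congr 1
      ring
  refine ⟨fun t => q (toIcoMod hT a t), fun t => ?_, ?_, fun t₀ => ?_⟩
  · simp only [toIcoMod_add_right]
  · simp only [toIcoMod_apply_left]
  · refine ⟨toIocDiv hT a t₀ • (b - a), ?_, ?_⟩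
    · have := sub_toIocDiv_zsmul_mem_Ioc hT a t₀
      exact ⟨this.1, by linarith [this.2]⟩
    · have h0 := sub_toIocDiv_zsmul_mem_Ioc hT a t₀
      have hc : ContinuousAt (fun t => t - toIocDiv hT a t₀ • (b - a)) t₀ := by fun_prop
      filter_upwards [hc.eventually (Ioo_mem_nhds h0.1
        (show _ < b + τ by linarith [h0.2]))] with t ht
      rw [hper (toIocDiv hT a t₀) t]
      exact hloc _ ht

namespace CollisionArc

variable {μ c Θ : ℝ}

lemma exists_isPCO (γ : CollisionArc μ c Θ) {a b τ : ℝ} (ha : 0 ≤ a) (hτ : 0 < τ)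
    (hab : a + τ ≤ b) (hb : b + τ ≤ γ.L) (hqa : γ.q a = (0, 0))
    (heq : ∀ u ∈ Ico 0 τ, γ.q (b + u) = γ.q (a + u)) : ∃ Q, IsPCO μ c Q := by
  obtain ⟨Q, hper, hQa, hloc⟩ := exists_periodic_extension hτ hab heq
  have hIoo : ∀ {w}, w ∈ Ioc a b → w ∈ Ioo 0 γ.L := fun hw =>
    ⟨by linarith [hw.1], by linarith [hw.2]⟩
  have hIcc : ∀ {w}, w ∈ Ioc a b → w ∈ Icc 0 γ.L := fun hw => Ioo_subset_Icc_self (hIoo hw)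
  have hsol : ∀ t, Q t ≠ (0, 0) → Q t ∈ KSet μ c ∧ HasDerivAt Q (deriv Q t) t ∧
      HasDerivAt (deriv Q) (acc μ (Q t) (deriv Q t)) t ∧
      nrm (deriv Q t) ^ 2 / 2 + V μ (Q t) = c := by
    intro t ht
    obtain ⟨m, hm, hev⟩ := hloc t
    have hQt : Q t = γ.q (t - m) := hev.eq_of_nhds
    rw [hQt] at ht
    have hd : HasDerivAt Q (γ.q' (t - m)) t :=
      ((γ.deriv_q _ (hIcc hm) ht).comp_sub_const t m).congr_of_eventuallyEq hev
    have hnear : ∀ᶠ x in 𝓝 t, x - m ∈ Icc 0 γ.L ∧ γ.q (x - m) ≠ (0, 0) := by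
      have hc : ContinuousAt (fun x => x - m) t := by fun_prop
      have hc2 : ContinuousAt (fun x => γ.q (x - m)) t :=
        (γ.continuous_q.comp (by fun_prop)).continuousAt
      exact (hc.eventually (Icc_mem_nhds (hIoo hm).1 (hIoo hm).2)).and (hc2.eventually_ne ht)
    have hev' : deriv Q =ᶠ[𝓝 t] fun x => γ.q' (x - m) := by
      filter_upwards [hev.deriv, hnear] with x hx hx2
      rw [hx]
      exact ((γ.deriv_q _ hx2.1 hx2.2).comp_sub_const x m).deriv
    rw [hd.deriv, hQt]
    exact ⟨γ.mem_KSet _ (hIcc hm) ht, hd,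
      ((γ.deriv_q' _ (hIcc hm) ht).comp_sub_const t m).congr_of_eventuallyEq hev',
      γ.energy _ (hIcc hm) ht⟩
  have hcont : Continuous Q := continuous_iff_continuousAt.2 fun t => by
    obtain ⟨m, -, hev⟩ := hloc t
    exact (show ContinuousAt (fun x => γ.q (x - m)) t from
      (γ.continuous_q.comp (by fun_prop)).continuousAt).congr hev.symm
  refine ⟨Q, hcont, ⟨b - a, by linarith, hper⟩, fun t => ?_, ⟨a, by simp [hQa, hqa]⟩, ?_,
    ⟨deriv Q, fun t => acc μ (Q t) (deriv Q t), fun t ht => ⟨(hsol t ht).2.1, (hsol t ht).2.2.1⟩,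
      fun t ht => ?_, fun t ht => ?_⟩, ?_⟩
  · by_cases ht : Q t = (0, 0)
    · exact Or.inr ht
    · exact Or.inl (hsol t ht).1
  · intro t₀ _
    obtain ⟨m, hm, hev⟩ := hloc t₀
    have hfin : (({t ∈ Icc 0 γ.L | γ.q t = (0, 0)} \ {t₀ - m})ᶜ) ∈ 𝓝 (t₀ - m) :=
      (γ.finite_zeros.sdiff).isClosed.isOpen_compl.mem_nhds (by simp)
    have hc : ContinuousAt (fun x => x - m) t₀ := by fun_prop
    have hall : ∀ᶠ t in 𝓝 t₀, Q t = (0, 0) → t = t₀ := by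
      filter_upwards [hev, hc.eventually hfin,
        hc.eventually (Icc_mem_nhds (hIoo hm).1 (hIoo hm).2)] with t h1 h2 h3 h4
      by_contra hne
      exact h2 ⟨⟨h3, h1 ▸ h4⟩, fun h => hne (by simpa using h)⟩
    obtain ⟨ε, hε, h⟩ := Metric.eventually_nhds_iff.1 hall
    exact ⟨ε, hε, fun t ht hd => h (by rwa [Real.dist_eq]) ht⟩
  · obtain ⟨hK, -, hd2, -⟩ := hsol t ht
    obtain ⟨h0, h1⟩ := ne_zero_and_ne_one_of_mem_KSet hK
    exact (continuousAt_acc hcont.continuousAt hd2.continuousAt h0 h1).continuousWithinAt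
  · obtain ⟨hK, -, -, he⟩ := hsol t ht
    obtain ⟨h0, h1⟩ := ne_zero_and_ne_one_of_mem_KSet hK
    obtain ⟨e1, e2⟩ := acc_eq_fderiv (v := deriv Q t) h0 h1
    exact ⟨e1, e2, he⟩
  · intro t₀ h0
    obtain ⟨m, hm, hev⟩ := hloc t₀
    have hz : γ.q (t₀ - m) = (0, 0) := by rw [← h0]; exact hev.eq_of_nhds.symm
    obtain ⟨v, hv⟩ := γ.direction _ (hIcc hm) hz
    refine ⟨v, ?_⟩
    have hshift : Tendsto (fun t => t - m) (𝓝[≠] t₀) (𝓝[Icc 0 γ.L \ {t₀ - m}] (t₀ - m)) := by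
      have hc : Tendsto (fun t => t - m) (𝓝[≠] t₀) (𝓝 (t₀ - m)) :=
        (show ContinuousAt (fun x => x - m) t₀ by fun_prop).tendsto.mono_left nhdsWithin_le_nhds
      refine tendsto_nhdsWithin_iff.2 ⟨hc, ?_⟩
      filter_upwards [hc.eventually (Icc_mem_nhds (hIoo hm).1 (hIoo hm).2),
        self_mem_nhdsWithin] with t h1 h2
      exact ⟨h1, fun h => h2 (by simpa using h)⟩
    refine (hv.comp hshift).congr' ?_
    filter_upwards [hev.filter_mono nhdsWithin_le_nhds] with t ht
    simp [Function.comp, ht]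

/-- Either two pieces of the arc agree, which gives a periodic collision orbit, or the arc consists
of pairwise distinct consecutive collision orbits whose regularized durations add up. -/
lemma exists_isPCO_or_finset (γ : CollisionArc μ c Θ) :
    (∃ Q, IsPCO μ c Q) ∨ ∃ E : Finset (ℝ × (ℝ → ℝ × ℝ)),
      (∀ x ∈ E, IsCCO μ c x.1 x.2 ∧ ∀ t ∉ Ioo (0 : ℝ) x.1, x.2 t = (0, 0)) ∧
      Θ ≤ ∑ x ∈ E, ∫ u in (0 : ℝ)..x.1, 1 / (4 * nrm (x.2 u)) := by
  classical
  obtain ⟨p, s, hs0, hsp, hmem, hlt, hgap⟩ := exists_increasing_listing γ.finite_zeros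
    (a := 0) (b := γ.L) ⟨⟨le_rfl, γ.L_pos.le⟩, γ.q_zero⟩ ⟨⟨γ.L_pos.le, le_rfl⟩, γ.q_L⟩
    (fun t ht => ht.1)
  have hmono : ∀ i j, i ≤ j → j ≤ p → s i ≤ s j := fun i j hij hj => by
    rcases hij.eq_or_lt with rfl | h
    · exact le_rfl
    · exact (hlt i j h hj).le
  have hne : ∀ i < p, ∀ t ∈ Ioo (s i) (s (i + 1)), γ.q t ≠ (0, 0) := fun i hi t ht h0 =>
    hgap i hi t ht ⟨⟨by linarith [(hmem i hi.le).1.1, ht.1],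
      by linarith [(hmem (i + 1) hi).1.2, ht.2]⟩, h0⟩
  let P : ℕ → ℝ × (ℝ → ℝ × ℝ) := fun i => (s (i + 1) - s i, piece γ.q (s i) (s (i + 1)))
  by_cases hinj : InjOn P (Finset.range p)
  · right
    refine ⟨(Finset.range p).image P, fun x hx => ?_, ?_⟩
    · obtain ⟨i, hi, rfl⟩ := Finset.mem_image.1 hx
      rw [Finset.mem_range] at hi
      exact ⟨γ.isCCO_piece (hmem i hi.le).1.1 (hlt i (i + 1) (Nat.lt_succ_self i) hi)
        (hmem (i + 1) hi).1.2 (hmem i hi.le).2 (hmem (i + 1) hi).2 (hne i hi),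
        fun t ht => piece_of_notMem ht⟩
    · rw [Finset.sum_image hinj, Finset.sum_congr rfl (g := fun i => γ.S (s (i + 1)) - γ.S (s i)),
        Finset.sum_range_sub (fun i => γ.S (s i)), hsp, hs0, γ.S_zero, sub_zero]
      · exact γ.le_S
      · intro i hi
        rw [Finset.mem_range] at hi
        exact γ.integral_piece (hmem i hi.le).1.1 (hlt i (i + 1) (Nat.lt_succ_self i) hi)
          (hmem (i + 1) hi).1.2 (hne i hi)
  · left
    obtain ⟨i, j, hij, hj, hP⟩ : ∃ i j, i < j ∧ j < p ∧ P i = P j := by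
      simp only [InjOn, Finset.coe_range, mem_Iio] at hinj
      push Not at hinj
      obtain ⟨i, hi, j, hj, hP, hij⟩ := hinj
      rcases lt_or_gt_of_ne hij with h | h
      · exact ⟨i, j, h, hj, hP⟩
      · exact ⟨j, i, h, hi, hP.symm⟩
    have hi : i < p := hij.trans hj
    have hτ : s (i + 1) - s i = s (j + 1) - s j := congrArg Prod.fst hP
    have hpc : piece γ.q (s i) (s (i + 1)) = piece γ.q (s j) (s (j + 1)) := congrArg Prod.snd hP
    have hpos := hlt i (i + 1) (Nat.lt_succ_self i) hi
    refine γ.exists_isPCO (a := s i) (b := s j) (τ := s (i + 1) - s i) (hmem i hi.le).1.1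
      (by linarith) (by linarith [hmono (i + 1) j hij hj.le])
      (by linarith [(hmem (j + 1) hj).1.2]) (hmem i hi.le).2 fun u hu => ?_
    rcases hu.1.eq_or_lt with rfl | h
    · rw [add_zero, add_zero, (hmem i hi.le).2, (hmem j hj.le).2]
    · have hu' : u ∈ Ioo 0 (s (i + 1) - s i) := ⟨h, hu.2⟩
      rw [← piece_of_mem (q := γ.q) hu', hpc, piece_of_mem (hτ ▸ hu')]

end CollisionArc

end Conclusion

/-- Below the first critical value there is either a periodic collision orbit or
infinitely many consecutive collision orbits (normalized to vanish outside `(0,τ)`). -/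
theorem pcr3bp_periodic_collision_or_infinitely_many_consecutive_collision_orbits
    (μ c : ℝ) (hμ : μ ∈ Ioo (0 : ℝ) 1) (hc : c < firstCriticalValue μ) :
    (∃ q : ℝ → ℝ × ℝ, IsPCO μ c q) ∨
    {x : ℝ × (ℝ → ℝ × ℝ) |
      IsCCO μ c x.1 x.2 ∧ ∀ t ∉ Ioo (0 : ℝ) x.1, x.2 t = (0, 0)}.Infinite := by
  by_cases hfin : {x : ℝ × (ℝ → ℝ × ℝ) |
      IsCCO μ c x.1 x.2 ∧ ∀ t ∉ Ioo (0 : ℝ) x.1, x.2 t = (0, 0)}.Finite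
  · left
    obtain ⟨r₀, hr, h0⟩ := exists_collinear_point hμ
    set F := hfin.toFinset
    set l : ℝ × (ℝ → ℝ × ℝ) → ℝ := fun x => ∫ u in (0 : ℝ)..x.1, 1 / (4 * nrm (x.2 u))
    have hF : 0 ≤ ∑ x ∈ F, |l x| := Finset.sum_nonneg fun x _ => abs_nonneg _
    obtain ⟨ρ⟩ := exists_regularizedChord hμ hr.1 hr.2 h0
      (hc.trans_le (firstCriticalValue_le hμ hr h0))
      (show 0 ≤ ∑ x ∈ F, |l x| + 1 by linarith)
    obtain ⟨γ⟩ := ρ.exists_collisionArc hμ hr.2 h0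
    refine γ.exists_isPCO_or_finset.resolve_right ?_
    rintro ⟨E, hE, hle⟩
    have hEF : E ⊆ F := fun x hx => hfin.mem_toFinset.2 (hE x hx)
    have h1 : ∑ x ∈ E, l x ≤ ∑ x ∈ E, |l x| := Finset.sum_le_sum fun x _ => le_abs_self _
    have h2 : ∑ x ∈ E, |l x| ≤ ∑ x ∈ F, |l x| :=
      Finset.sum_le_sum_of_subset_of_nonneg hEF fun x _ _ => abs_nonneg _
    linarith
  · exact Or.inr hfin
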